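/- arXiv:1705.04609 — 2 statements merged into one kernel-verified Lean document; each statement's English description precedes it below -/
import Mathlib

section
/- Let ℓ ≥ 24 be an integer and let φ : ℕ → ℕ be a nondecreasing function. For all integers κ, d ≥ 0 there exists an integer c ≥ 0 such that every (2,φ)-controlled graph G with ω(G) ≤ κ and χ(G) > c has a d-peripheral hole of length exactly ℓ. -/
open SimpleGraph

/-- The set of vertices at `G`-distance at most `ρ` from `v`. -/
def closedNbhd {V : Type*} (G : SimpleGraph V) (v : V) (ρ : ℕ) : Set V :=
  {u | G.Reachable v u ∧ G.dist v u ≤ ρ}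

/-- `χ^ρ(G)`. -/
noncomputable def chiRho {V : Type*} (G : SimpleGraph V) (ρ : ℕ) : ℕ∞ :=
  ⨆ v : V, (G.induce (closedNbhd G v ρ)).chromaticNumber

/-- `G` is `(ρ,φ)`-controlled. -/
def Controlled {V : Type*} (ρ : ℕ) (φ : ℕ → ℕ) (G : SimpleGraph V) : Prop :=
  ∀ X : Set V, (G.induce X).chromaticNumber ≤ (φ (chiRho (G.induce X) ρ).toNat : ℕ∞)

/-- The set of vertices of `G` not in the range of `f` and with no neighbour in it. -/
def periphSet {V : Type*} {W : Type*} (G : SimpleGraph V) (f : W → V) : Set V :=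
  {v | v ∉ Set.range f ∧ ∀ u ∈ Set.range f, ¬ G.Adj v u}

/-- `G` has a `d`-peripheral hole of length `n`. -/
def HasPeriphHole {V : Type*} (G : SimpleGraph V) (d n : ℕ) : Prop :=
  4 ≤ n ∧ ∃ f : cycleGraph n ↪g G,
    (d : ℕ∞) < (G.induce (periphSet G f)).chromaticNumber

/-- The first `L + 1` terms of `p` form an induced path. -/
def IndPath {V : Type*} (G : SimpleGraph V) (p : ℕ → V) (L : ℕ) : Prop :=
  ∀ a b, a ≤ L → b ≤ L → (G.Adj (p a) (p b) ↔ b = a + 1 ∨ a = b + 1)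

/-- The sequence `p` up to index `L`, followed by `w`. -/
def snoc {V : Type*} (p : ℕ → V) (L : ℕ) (w : V) : ℕ → V := fun a => if a ≤ L then p a else w

theorem snoc_le {V : Type*} (p : ℕ → V) {L a : ℕ} (w : V) (h : a ≤ L) : snoc p L w a = p a :=
  if_pos h

theorem snoc_succ {V : Type*} (p : ℕ → V) (L : ℕ) (w : V) : snoc p L w (L + 1) = w :=
  if_neg (by omega)

theorem IndPath.snoc {V : Type*} {G : SimpleGraph V} {p : ℕ → V} {L : ℕ} (hp : IndPath G p L)
    {w : V} (hw : ∀ a ≤ L, G.Adj (p a) w ↔ a = L) : IndPath G (snoc p L w) (L + 1) := by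
  intro a b ha hb
  rcases Nat.lt_or_ge L a with h1 | h1 <;> rcases Nat.lt_or_ge L b with h2 | h2
  · obtain rfl : a = L + 1 := by omega
    obtain rfl : b = L + 1 := by omega
    simp
  · obtain rfl : a = L + 1 := by omega
    rw [snoc_succ, snoc_le _ _ h2, G.adj_comm, hw b h2]
    omega
  · obtain rfl : b = L + 1 := by omega
    rw [snoc_succ, snoc_le _ _ h1, hw a h1]
    omega
  · rw [snoc_le _ _ h1, snoc_le _ _ h2, hp a b h1 h2]

theorem indPath_zero {V : Type*} {G : SimpleGraph V} (p : ℕ → V) : IndPath G p 0 := by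
  intro a b ha hb
  obtain rfl : a = 0 := by omega
  obtain rfl : b = 0 := by omega
  simp

theorem cycleGraph_adj_iff {n : ℕ} (hn : 2 ≤ n) (i j : Fin n) : (cycleGraph n).Adj i j ↔
    (j : ℕ) = i + 1 ∨ (i : ℕ) = j + 1 ∨ ((i : ℕ) = 0 ∧ (j : ℕ) + 1 = n)
      ∨ ((j : ℕ) = 0 ∧ (i : ℕ) + 1 = n) := by
  rw [cycleGraph_adj', Fin.sub_def, Fin.sub_def]
  obtain ⟨i, hi⟩ := i
  obtain ⟨j, hj⟩ := j
  simp only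
  have h1 : (n - j + i) % n = if j ≤ i then i - j else n - j + i := by
    split_ifs with h
    · rw [show n - j + i = (i - j) + n by omega, Nat.add_mod_right, Nat.mod_eq_of_lt (by omega)]
    · rw [Nat.mod_eq_of_lt (by omega)]
  have h2 : (n - i + j) % n = if i ≤ j then j - i else n - i + j := by
    split_ifs with h
    · rw [show n - i + j = (j - i) + n by omega, Nat.add_mod_right, Nat.mod_eq_of_lt (by omega)]
    · rw [Nat.mod_eq_of_lt (by omega)]
  rw [h1, h2]
  split_ifs <;> omega

theorem IndPath.cycle {V : Type*} {G : SimpleGraph V} {p : ℕ → V} {L n : ℕ} (hp : IndPath G p L)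
    {w : V} (hw : ∀ a ≤ L, G.Adj (p a) w ↔ a = 0 ∨ a = L) (hn : n = L + 2) (h5 : 5 ≤ n) :
    Nonempty (cycleGraph n ↪g G) := by
  have key : ∀ i j : Fin n, G.Adj (_root_.snoc p L w i) (_root_.snoc p L w j) ↔
      (cycleGraph n).Adj i j := by
    intro i j
    rw [cycleGraph_adj_iff (by omega)]
    obtain ⟨i, hi⟩ := i
    obtain ⟨j, hj⟩ := j
    simp only
    rcases Nat.lt_or_ge L i with h1 | h1 <;> rcases Nat.lt_or_ge L j with h2 | h2
    · obtain rfl : i = L + 1 := by omega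
      obtain rfl : j = L + 1 := by omega
      simp
    · obtain rfl : i = L + 1 := by omega
      rw [snoc_succ, snoc_le _ _ h2, G.adj_comm, hw j h2]
      omega
    · obtain rfl : j = L + 1 := by omega
      rw [snoc_succ, snoc_le _ _ h1, hw i h1]
      omega
    · rw [snoc_le _ _ h1, snoc_le _ _ h2, hp i j h1 h2]
      omega
  refine ⟨⟨⟨fun i => _root_.snoc p L w i, ?_⟩, key _ _⟩⟩
  intro i j hij
  simp only at hij
  have e : ∀ k, (cycleGraph n).Adj i k ↔ (cycleGraph n).Adj j k := fun k => by
    rw [← key, ← key, hij]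
  simp only [cycleGraph_adj_iff (show 2 ≤ n by omega)] at e
  have e1 := fun (k : ℕ) (hk : k < n) => e ⟨k, hk⟩
  simp only at e1
  obtain ⟨i, hi⟩ := i
  obtain ⟨j, hj⟩ := j
  simp only at e1
  rw [Fin.mk.injEq]
  by_contra hne
  rcases Nat.eq_or_lt_of_le (show i + 1 ≤ n from hi) with a1 | a1
  · have f1 := e1 0 (by omega)
    have f2 := e1 (i - 1) (by omega)
    omega
  · have f1 := e1 (i + 1) a1
    rcases Nat.eq_zero_or_pos i with a2 | a2
    · have f2 := e1 (n - 1) (by omega)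
      omega
    · have f2 := e1 (i - 1) (by omega)
      omega

theorem exists_column_constant (k N : ℕ) : ∃ Q : ℕ, ∀ (f : ℕ → ℕ → Fin k) (T : Finset ℕ),
    Q ≤ T.card → ∃ S ⊆ T, N ≤ S.card ∧ ∃ F : ℕ → Fin k, ∀ i ∈ S, ∀ j ∈ S, i < j → f i j = F j := by
  classical
  induction N with
  | zero =>
    refine ⟨1, fun f T hT => ⟨∅, by simp, by simp, fun j => f j j, by simp⟩⟩
  | succ N ih =>
    obtain ⟨Q, hQ⟩ := ih
    refine ⟨k * Q + 1, fun f T hT => ?_⟩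
    have hne : T.Nonempty := by
      rw [← Finset.card_pos]
      omega
    set j := T.max' hne with hj
    have hjT : j ∈ T := T.max'_mem hne
    have hk : 0 < k := Fin.pos (f 0 0)
    have : NeZero k := ⟨hk.ne'⟩
    obtain ⟨y, -, hy⟩ := Finset.exists_le_card_fiber_of_mul_le_card_of_maps_to
      (s := T.erase j) (t := (Finset.univ : Finset (Fin k))) (f := fun i => f i j) (n := Q)
      (fun _ _ => Finset.mem_univ _) ⟨0, Finset.mem_univ _⟩ (by
        rw [Finset.card_erase_of_mem hjT, Finset.card_univ, Fintype.card_fin]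
        omega)
    obtain ⟨S, hST, hS, F, hF⟩ := hQ f _ hy
    have hS' : ∀ i ∈ S, i ∈ T ∧ i < j ∧ f i j = y := by
      intro i hi
      have := hST hi
      rw [Finset.mem_filter, Finset.mem_erase] at this
      exact ⟨this.1.2, lt_of_le_of_ne (T.le_max' i this.1.2) this.1.1, this.2⟩
    refine ⟨insert j S, ?_, ?_, Function.update F j y, ?_⟩
    · intro i hi
      rcases Finset.mem_insert.1 hi with rfl | hi
      · exact hjT
      · exact (hS' i hi).1
    · rw [Finset.card_insert_of_notMem (fun h => (lt_irrefl _ (hS' j h).2.1))]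
      omega
    · intro a ha b hb hab
      rcases Finset.mem_insert.1 hb with rfl | hb
      · rcases Finset.mem_insert.1 ha with rfl | ha
        · exact absurd hab (lt_irrefl _)
        · rw [Function.update_self]
          exact (hS' a ha).2.2
      · rcases Finset.mem_insert.1 ha with rfl | ha
        · exact absurd hab (hS' b hb).2.1.le.not_gt
        · rw [Function.update_of_ne (hS' b hb).2.1.ne]
          exact hF a ha b hb hab

/-- `k 0 < k 1 < ⋯ < k (H - 1)` is a chain in `S` with consecutive terms related by `r`. -/
def IsChainIn (r : ℕ → ℕ → Prop) (H : ℕ) (S : Finset ℕ) (k : ℕ → ℕ) : Prop :=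
  (∀ b < H, k b ∈ S) ∧ ∀ b, b + 1 < H → k b < k (b + 1) ∧ r (k b) (k (b + 1))

theorem exists_chain_or_free (H N : ℕ) : ∃ T : ℕ, ∀ (r : ℕ → ℕ → Prop) (S : Finset ℕ),
    T ≤ S.card → (∃ k, IsChainIn r H S k) ∨
      ∃ S' ⊆ S, N ≤ S'.card ∧ ∀ k ∈ S', ∀ l ∈ S', k < l → ¬ r k l := by
  classical
  induction H with
  | zero => exact ⟨0, fun r S _ => Or.inl ⟨id, by simp, by simp⟩⟩
  | succ H ih =>
    obtain ⟨T, hT⟩ := ih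
    refine ⟨T + N + 1, fun r S hS => ?_⟩
    set S₁ := S.filter (fun l => ∃ k ∈ S, k < l ∧ r k l) with hS₁
    set S₂ := S.filter (fun l => ¬ ∃ k ∈ S, k < l ∧ r k l) with hS₂
    have hc : S₁.card + S₂.card = S.card := Finset.card_filter_add_card_filter_not _
    by_cases h2 : N ≤ S₂.card
    · refine Or.inr ⟨S₂, Finset.filter_subset _ _, h2, fun k hk l hl hkl hr => ?_⟩
      exact (Finset.mem_filter.1 hl).2 ⟨k, (Finset.mem_filter.1 hk).1, hkl, hr⟩
    rcases hT r S₁ (by omega) with ⟨k, hk, hk'⟩ | ⟨S', hS', h1, h3⟩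
    · left
      rcases Nat.eq_zero_or_pos H with rfl | hH
      · obtain ⟨x, hx⟩ : S.Nonempty := by
          rw [← Finset.card_pos]
          omega
        exact ⟨fun _ => x, fun b _ => hx, fun b hb => by omega⟩
      · obtain ⟨-, k0, h0, h0', h0''⟩ := Finset.mem_filter.1 (hk 0 hH)
        refine ⟨fun b => if b = 0 then k0 else k (b - 1), ?_, ?_⟩
        · intro b hb
          by_cases hb0 : b = 0
          · simp [hb0, h0]
          · simp only [hb0, if_false]
            exact (Finset.mem_filter.1 (hk (b - 1) (by omega))).1
        · intro b hb
          by_cases hb0 : b = 0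
          · subst hb0
            simp [h0', h0'']
          · have := hk' (b - 1) (by omega)
            rw [show b - 1 + 1 = b by omega] at this
            simpa [hb0] using this
    · exact Or.inr ⟨S', hS'.trans (Finset.filter_subset _ _), h1, h3⟩

/-- An index `i` followed by a long homogeneous chain of larger indices. -/
def HomChain (α σ : ℕ → ℕ → Prop) (good : ℕ → ℕ → ℕ → Prop) (H : ℕ) (S : Finset ℕ) : Prop :=
  ∃ i ∈ S, ∃ k, IsChainIn (good i) H S k ∧ (∀ b < H, i < k b ∧ ¬ α i (k b)) ∧
    ((∀ b < H, σ i (k b)) ∨ (∀ b < H, ¬ σ i (k b))) ∧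
    ((∀ b, b + 1 < H → σ (k b) (k (b + 1))) ∨ (∀ b, b + 1 < H → ¬ σ (k b) (k (b + 1))))

/-- The pair `p` is nested strictly inside the pair `q`, badly. -/
def BadNest (good : ℕ → ℕ → ℕ → Prop) (p q : ℕ × ℕ) : Prop :=
  q.1 < p.1 ∧ p.2 < q.2 ∧ ¬ good q.1 p.1 p.2

theorem exists_homChain (H a b : ℕ) : ∃ R : ℕ, ∀ (α σ : ℕ → ℕ → Prop)
    (good : ℕ → ℕ → ℕ → Prop) (S : Finset ℕ), R ≤ S.card → HomChain α σ good H S ∨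
      (∃ A ⊆ S, A.card = a ∧ ∀ i ∈ A, ∀ j ∈ A, i < j → α i j) ∨
      ∃ Y : Finset (ℕ × ℕ), Y.card = b ∧ (∀ p ∈ Y, p.1 ∈ S ∧ p.2 ∈ S ∧ p.1 < p.2) ∧
        ∀ p ∈ Y, ∀ q ∈ Y, p ≠ q → BadNest good p q ∨ BadNest good q p := by
  classical
  induction a generalizing b with
  | zero => exact ⟨0, fun α σ good S _ => Or.inr (Or.inl ⟨∅, by simp, by simp, by simp⟩)⟩
  | succ a iha =>
  induction b with
  | zero => exact ⟨0, fun α σ good S _ => Or.inr (Or.inr ⟨∅, by simp, by simp, by simp⟩)⟩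
  | succ b ihb =>
  obtain ⟨R₁, hR₁⟩ := iha (b + 1)
  obtain ⟨R₂, hR₂⟩ := ihb
  obtain ⟨T₁, hT₁⟩ := exists_chain_or_free H (R₂ + 1)
  obtain ⟨T₂, hT₂⟩ := exists_chain_or_free H T₁
  refine ⟨1 + R₁ + T₂ + T₂, fun α σ good S hS => ?_⟩
  have hne : S.Nonempty := by
    rw [← Finset.card_pos]
    omega
  set i := S.min' hne with hi
  have hiS : i ∈ S := S.min'_mem hne
  have hlt : ∀ k ∈ S.erase i, i < k := fun k hk =>
    lt_of_le_of_ne (S.min'_le k (Finset.mem_of_mem_erase hk)) (Finset.ne_of_mem_erase hk).symm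
  have hc0 : (S.erase i).card = S.card - 1 := Finset.card_erase_of_mem hiS
  have hc1 : ((S.erase i).filter (fun k => α i k)).card +
    ((S.erase i).filter (fun k => ¬ α i k)).card = _ := Finset.card_filter_add_card_filter_not _
  by_cases h1 : R₁ ≤ ((S.erase i).filter (fun k => α i k)).card
  · have hsub : (S.erase i).filter (fun k => α i k) ⊆ S :=
      (Finset.filter_subset _ _).trans (Finset.erase_subset _ _)
    rcases hR₁ α σ good _ h1 with ⟨i', hi', k, ⟨hk, hk'⟩, hk''⟩ | ⟨A, hA, hAc, hAα⟩ | ⟨Y, hY, hYS, hYb⟩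
    · exact Or.inl ⟨i', hsub hi', k, ⟨fun b hb => hsub (hk b hb), hk'⟩, hk''⟩
    · refine Or.inr (Or.inl ⟨insert i A, ?_, ?_, ?_⟩)
      · exact Finset.insert_subset hiS (hA.trans hsub)
      · rw [Finset.card_insert_of_notMem, hAc]
        intro h
        exact lt_irrefl _ (hlt i (Finset.mem_filter.1 (hA h)).1)
      · intro x hx y hy hxy
        rcases Finset.mem_insert.1 hy with rfl | hy
        · rcases Finset.mem_insert.1 hx with rfl | hx
          · exact absurd hxy (lt_irrefl _)
          · exact absurd hxy (hlt x (Finset.mem_filter.1 (hA hx)).1).le.not_gt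
        · rcases Finset.mem_insert.1 hx with rfl | hx
          · exact (Finset.mem_filter.1 (hA hy)).2
          · exact hAα x hx y hy hxy
    · exact Or.inr (Or.inr ⟨Y, hY, fun p hp => ⟨hsub (hYS p hp).1, hsub (hYS p hp).2.1,
        (hYS p hp).2.2⟩, hYb⟩)
  -- pass to a set on which `σ i` is constant
  obtain ⟨S₁, hS₁, hS₁c, hS₁σ⟩ : ∃ S₁ ⊆ (S.erase i).filter (fun k => ¬ α i k), T₂ ≤ S₁.card ∧
      ((∀ k ∈ S₁, σ i k) ∨ (∀ k ∈ S₁, ¬ σ i k)) := by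
    have hc2 : (((S.erase i).filter (fun k => ¬ α i k)).filter (fun k => σ i k)).card +
      (((S.erase i).filter (fun k => ¬ α i k)).filter (fun k => ¬ σ i k)).card = _ :=
      Finset.card_filter_add_card_filter_not _
    by_cases h2 : T₂ ≤ (((S.erase i).filter (fun k => ¬ α i k)).filter (fun k => σ i k)).card
    · exact ⟨_, Finset.filter_subset _ _, h2, Or.inl fun k hk => (Finset.mem_filter.1 hk).2⟩
    · refine ⟨((S.erase i).filter (fun k => ¬ α i k)).filter (fun k => ¬ σ i k),
        Finset.filter_subset _ _, by omega, Or.inr fun k hk => (Finset.mem_filter.1 hk).2⟩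
  have hS₁S : ∀ k ∈ S₁, k ∈ S ∧ i < k ∧ ¬ α i k := fun k hk =>
    ⟨Finset.mem_of_mem_erase (Finset.mem_filter.1 (hS₁ hk)).1,
      hlt k (Finset.mem_filter.1 (hS₁ hk)).1, (Finset.mem_filter.1 (hS₁ hk)).2⟩
  have hdes : ∀ k, (IsChainIn (fun x y => good i x y ∧ σ x y) H S₁ k ∨
      IsChainIn (fun x y => good i x y ∧ ¬ σ x y) H S₁ k) → HomChain α σ good H S := by
    intro k hk
    have hm : ∀ b < H, k b ∈ S₁ := by
      rcases hk with hk | hk <;> exact hk.1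
    refine ⟨i, hiS, k, ⟨fun b hb => (hS₁S _ (hm b hb)).1, fun b hb => ?_⟩,
      fun b hb => (hS₁S _ (hm b hb)).2, ?_, ?_⟩
    · rcases hk with hk | hk <;> exact ⟨(hk.2 b hb).1, (hk.2 b hb).2.1⟩
    · rcases hS₁σ with h | h
      · exact Or.inl fun b hb => h _ (hm b hb)
      · exact Or.inr fun b hb => h _ (hm b hb)
    · rcases hk with hk | hk
      · exact Or.inl fun b hb => (hk.2 b hb).2.2
      · exact Or.inr fun b hb => (hk.2 b hb).2.2
  rcases hT₂ (fun x y => good i x y ∧ σ x y) S₁ hS₁c with ⟨k, hk⟩ | ⟨S₂, hS₂, hS₂c, hfree⟩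
  · exact Or.inl (hdes k (Or.inl hk))
  rcases hT₁ (fun x y => good i x y ∧ ¬ σ x y) S₂ hS₂c with ⟨k, hk⟩ | ⟨S₃, hS₃, hS₃c, hfree'⟩
  · exact Or.inl (hdes k (Or.inr ⟨fun b hb => hS₂ (hk.1 b hb), hk.2⟩))
  have hbad : ∀ k ∈ S₃, ∀ l ∈ S₃, k < l → ¬ good i k l := by
    intro k hk l hl hkl hg
    by_cases hs : σ k l
    · exact hfree k (hS₃ hk) l (hS₃ hl) hkl ⟨hg, hs⟩
    · exact hfree' k hk l hl hkl ⟨hg, hs⟩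
  have hne3 : S₃.Nonempty := by
    rw [← Finset.card_pos]
    omega
  set t := S₃.max' hne3 with ht
  have htS : t ∈ S₃ := S₃.max'_mem hne3
  have hsub : S₃.erase t ⊆ S := fun x hx => (hS₁S x (hS₂ (hS₃ (Finset.mem_of_mem_erase hx)))).1
  rcases hR₂ α σ good (S₃.erase t) (by rw [Finset.card_erase_of_mem htS]; omega) with
    ⟨i', hi', k, ⟨hk, hk'⟩, hk''⟩ | ⟨A, hA, hAc, hAα⟩ | ⟨Y, hY, hYS, hYb⟩
  · exact Or.inl ⟨i', hsub hi', k, ⟨fun b hb => hsub (hk b hb), hk'⟩, hk''⟩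
  · exact Or.inr (Or.inl ⟨A, hA.trans hsub, hAc, hAα⟩)
  · have hnew : ∀ p ∈ Y, BadNest good p (i, t) := by
      intro p hp
      obtain ⟨h1, h2, h3⟩ := hYS p hp
      refine ⟨(hS₁S _ (hS₂ (hS₃ (Finset.mem_of_mem_erase h1)))).2.1,
        lt_of_le_of_ne (S₃.le_max' _ (Finset.mem_of_mem_erase h2)) (Finset.ne_of_mem_erase h2),
        hbad _ (Finset.mem_of_mem_erase h1) _ (Finset.mem_of_mem_erase h2) h3⟩
    refine Or.inr (Or.inr ⟨insert (i, t) Y, ?_, ?_, ?_⟩)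
    · rw [Finset.card_insert_of_notMem, hY]
      intro h
      exact lt_irrefl _ (hnew _ h).1
    · intro p hp
      rcases Finset.mem_insert.1 hp with rfl | hp
      · exact ⟨hiS, (hS₁S t (hS₂ (hS₃ htS))).1, (hS₁S t (hS₂ (hS₃ htS))).2.1⟩
      · exact ⟨hsub (hYS p hp).1, hsub (hYS p hp).2.1, (hYS p hp).2.2⟩
    · intro p hp q hq hpq
      rcases Finset.mem_insert.1 hp with rfl | hp <;> rcases Finset.mem_insert.1 hq with rfl | hq
      · exact absurd rfl hpq
      · exact Or.inr (hnew q hq)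
      · exact Or.inl (hnew p hp)
      · exact hYb p hp q hq hpq

/-- A chain of `q` cliques `K j` of size `k` in shrinking zones `D j`, together with covers `M i j`
of `D j` by neighbours of `K i`, and connecting vertices `c i j a` between `K i` and `K j`. -/
structure AChain {V : Type*} (G : SimpleGraph V) (k q : ℕ) (K : ℕ → Fin k → V)
    (M : ℕ → ℕ → Set V) (D : ℕ → Set V) (f : ℕ → ℕ → Fin k) (c : ℕ → ℕ → Fin k → V) : Prop where
  D_anti : ∀ j < q, D (j + 1) ⊆ D j
  K_mem : ∀ j < q, ∀ a, K j a ∈ D j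
  K_adj : ∀ j < q, ∀ a b, a ≠ b → G.Adj (K j a) (K j b)
  D_K : ∀ j < q, ∀ d ∈ D (j + 1), ∀ a, d ≠ K j a ∧ ¬ G.Adj (K j a) d
  M_K : ∀ i j, i < j → j ≤ q → ∀ m ∈ M i j, ∀ a, G.Adj (K i a) m
  M_anti : ∀ i j, i < j → j < q → M i (j + 1) ⊆ M i j
  M_stable : ∀ i < q, ∀ m ∈ M i (i + 1), ∀ m' ∈ M i (i + 1), ¬ G.Adj m m'
  M_D : ∀ i < q, M i (i + 1) ⊆ D i
  cover : ∀ i j, i < j → j ≤ q → ∀ d ∈ D j, ∃ m ∈ M i j, G.Adj m d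
  M_f : ∀ i j, i < j → j < q → ∀ m ∈ M i (j + 1), ¬ G.Adj (K j (f i j)) m
  c_mem : ∀ i j, i < j → j < q → ∀ a, c i j a ∈ M i j
  c_K : ∀ i j, i < j → j < q → ∀ a, G.Adj (c i j a) (K j a)
  c_D : ∀ i j, i < j → j < q → ∀ a, ∀ d ∈ D (j + 1), ¬ G.Adj (c i j a) d
  hom : ∀ i j, i < j → j < q → ∀ a, ∀ i' ≤ j, (∀ m ∈ M i' (j + 1), G.Adj (c i j a) m) ∨
    ∀ m ∈ M i' (j + 1), ¬ G.Adj (c i j a) m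

namespace AChain

variable {V : Type*} {G : SimpleGraph V} {k q : ℕ} {K : ℕ → Fin k → V} {M : ℕ → ℕ → Set V}
  {D : ℕ → Set V} {f : ℕ → ℕ → Fin k} {c : ℕ → ℕ → Fin k → V}

theorem D_le (h : AChain G k q K M D f c) {i j : ℕ} (hij : i ≤ j) (hj : j ≤ q) : D j ⊆ D i := by
  induction j, hij using Nat.le_induction with
  | base => exact subset_rfl
  | succ n hn ih => exact (h.D_anti n hj).trans (ih (by omega))

theorem M_le (h : AChain G k q K M D f c) {i l j : ℕ} (hil : i < l) (hlj : l ≤ j) (hj : j ≤ q) :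
    M i j ⊆ M i l := by
  induction j, hlj using Nat.le_induction with
  | base => exact subset_rfl
  | succ n hn ih => exact (h.M_anti i n (by omega) hj).trans (ih (by omega))

theorem M_sub_D (h : AChain G k q K M D f c) {i j : ℕ} (hij : i < j) (hj : j ≤ q) :
    M i j ⊆ D i :=
  (h.M_le (Nat.lt_succ_self i) hij hj).trans (h.M_D i (by omega))

theorem M_stab (h : AChain G k q K M D f c) {i j j' : ℕ} (hij : i < j) (hj : j ≤ q)
    (hij' : i < j') (hj' : j' ≤ q) {m m' : V} (hm : m ∈ M i j) (hm' : m' ∈ M i j') :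
    ¬ G.Adj m m' :=
  h.M_stable i (by omega) _ (h.M_le (Nat.lt_succ_self i) hij hj hm) _
    (h.M_le (Nat.lt_succ_self i) hij' hj' hm')

/-- An induced path starting at `x` that attaches to the zone `D (j + 1)` only through `M j`. -/
structure Forward (G : SimpleGraph V) (M : ℕ → ℕ → Set V) (D : ℕ → Set V) (i j : ℕ) (x : V)
    (p : ℕ → V) (L : ℕ) : Prop where
  path : IndPath G p L
  start : p 0 = x
  pos : 0 < L
  zone : ∀ a ≤ L, ∀ d ∈ D (j + 1), ¬ G.Adj (p a) d
  side : ∀ a ≤ L, 0 < a → ∀ m ∈ M i (j + 1), ¬ G.Adj (p a) m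
  front : ∀ a < L, ∀ m ∈ M j (j + 1), ¬ G.Adj (p a) m
  last : ∀ m ∈ M j (j + 1), G.Adj (p L) m

theorem forward_single {F : ℕ → Fin k} (h : AChain G k q K M D f c) {i j : ℕ} (hij : i < j)
    (hj : j < q) (hs : ∀ m ∈ M j (j + 1), G.Adj (c i j (F j)) m) :
    ∃ p, Forward G M D i j (K i (F i)) p 1 := by
  have hcm := h.c_mem i j hij hj (F j)
  refine ⟨snoc (fun _ => K i (F i)) 0 (c i j (F j)), ?_, ?_, by omega, ?_, ?_, ?_, ?_⟩
  · refine (indPath_zero _).snoc ?_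
    intro a ha
    simp only [show a = 0 by omega, h.M_K i j hij hj.le _ hcm]
  · exact snoc_le _ _ le_rfl
  · intro a ha d hd
    obtain rfl | rfl : a = 0 ∨ a = 0 + 1 := by omega
    · rw [snoc_le _ _ le_rfl]
      exact (h.D_K i (by omega) d (h.D_le (by omega) (by omega) hd) _).2
    · rw [snoc_succ]
      exact h.c_D i j hij hj _ d hd
  · intro a ha ha0 m hm
    obtain rfl : a = 0 + 1 := by omega
    rw [snoc_succ]
    exact h.M_stab hij hj.le (by omega) (by omega) hcm hm
  · intro a ha m hm
    obtain rfl : a = 0 := by omega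
    rw [snoc_le _ _ le_rfl]
    exact (h.D_K i (by omega) m (h.D_le (by omega) (by omega) (h.M_D j hj hm)) _).2
  · rw [show (1 : ℕ) = 0 + 1 from rfl, snoc_succ]
    exact hs

/-- A forward path with two edges, when `c i j` misses `M j (j + 1)`. -/
theorem forward_double {F : ℕ → Fin k} (h : AChain G k q K M D f c) {i j : ℕ} (hij : i < j)
    (hj : j < q) (hf : f i j = F j) (hs : ∀ m ∈ M j (j + 1), ¬ G.Adj (c i j (F j)) m) :
    ∃ p, Forward G M D i j (K i (F i)) p 2 := by
  have hcm := h.c_mem i j hij hj (F j)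
  have hxx : ¬ G.Adj (K i (F i)) (K j (F j)) :=
    (h.D_K i (by omega) _ (h.D_le (show i + 1 ≤ j by omega) hj.le (h.K_mem j hj _)) _).2
  have e0 : ∀ (x y z : V), snoc (snoc (fun _ => x) 0 y) 1 z 0 = x := fun x y z => by simp [snoc]
  have e1 : ∀ (x y z : V), snoc (snoc (fun _ => x) 0 y) 1 z 1 = y := fun x y z => by simp [snoc]
  have e2 : ∀ (x y z : V), snoc (snoc (fun _ => x) 0 y) 1 z 2 = z := fun x y z => by simp [snoc]
  refine ⟨snoc (snoc (fun _ => K i (F i)) 0 (c i j (F j))) 1 (K j (F j)), ?_, e0 _ _ _, by omega,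
    ?_, ?_, ?_, ?_⟩
  · refine IndPath.snoc ((indPath_zero _).snoc ?_) ?_
    · intro a ha
      simp only [show a = 0 by omega, h.M_K i j hij hj.le _ hcm]
    · intro a ha
      obtain rfl | rfl : a = 0 ∨ a = 1 := by omega
      · simpa [snoc] using hxx
      · simpa [snoc] using h.c_K i j hij hj (F j)
  · intro a ha d hd
    obtain rfl | rfl | rfl : a = 0 ∨ a = 1 ∨ a = 2 := by omega
    · rw [e0]
      exact (h.D_K i (by omega) d (h.D_le (by omega) (by omega) hd) _).2
    · rw [e1]
      exact h.c_D i j hij hj _ d hd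
    · rw [e2]
      exact (h.D_K j hj d hd _).2
  · intro a ha ha0 m hm
    obtain rfl | rfl : a = 1 ∨ a = 2 := by omega
    · rw [e1]
      exact h.M_stab hij hj.le (by omega) (by omega) hcm hm
    · rw [e2, ← hf]
      exact h.M_f i j hij hj m hm
  · intro a ha m hm
    obtain rfl | rfl : a = 0 ∨ a = 1 := by omega
    · rw [e0]
      exact (h.D_K i (by omega) m (h.D_le (by omega) (by omega) (h.M_D j hj hm)) _).2
    · rw [e1]
      exact hs m hm
  · rw [e2]
    intro m hm
    exact h.M_K j (j + 1) (by omega) hj m hm _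

theorem forward_append (h : AChain G k q K M D f c) {i j l L : ℕ} {x : V} {p : ℕ → V} {a : Fin k}
    (hij : i < j) (hjl : j < l) (hl : l < q) (hp : Forward G M D i j x p L)
    (hg : ∀ m ∈ M i (l + 1), ¬ G.Adj (c j l a) m) :
    IndPath G (snoc p L (c j l a)) (L + 1) ∧ snoc p L (c j l a) 0 = x ∧
    (∀ b ≤ L, ∀ d ∈ D (j + 1), ¬ G.Adj (snoc p L (c j l a) b) d) ∧
    (∀ d ∈ D (l + 1), ¬ G.Adj (snoc p L (c j l a) (L + 1)) d) ∧
    ∀ b ≤ L + 1, 0 < b → ∀ m ∈ M i (l + 1), ¬ G.Adj (snoc p L (c j l a) b) m := by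
  have hcm := h.c_mem j l hjl hl a
  have hcm' := h.M_le (Nat.lt_succ_self j) hjl hl.le hcm
  refine ⟨hp.path.snoc ?_, ?_, ?_, ?_, ?_⟩
  · intro b hb
    rcases Nat.eq_or_lt_of_le hb with rfl | hb
    · simp only [hp.last _ hcm']
    · simp only [hp.front b hb _ hcm', hb.ne]
  · rw [snoc_le _ _ (Nat.zero_le _), hp.start]
  · intro b hb
    rw [snoc_le _ _ hb]
    exact hp.zone b hb
  · rw [snoc_succ]
    exact h.c_D j l hjl hl a
  · intro b hb hb0 m hm
    rcases Nat.lt_or_ge L b with h1 | h1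
    · obtain rfl : b = L + 1 := by omega
      rw [snoc_succ]
      exact hg m hm
    · rw [snoc_le _ _ h1]
      exact hp.side b h1 hb0 m (h.M_le (by omega) (by omega) (by omega) hm)

theorem forward_succ (h : AChain G k q K M D f c) {i j l L : ℕ} {x : V} {p : ℕ → V} {a : Fin k}
    (hij : i < j) (hjl : j < l) (hl : l < q) (hp : Forward G M D i j x p L)
    (hg : ∀ m ∈ M i (l + 1), ¬ G.Adj (c j l a) m) (hs : ∀ m ∈ M l (l + 1), G.Adj (c j l a) m) :
    ∃ p', Forward G M D i l x p' (L + 1) := by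
  obtain ⟨h1, h2, h3, h4, h5⟩ := h.forward_append hij hjl hl hp hg
  refine ⟨_, h1, h2, by omega, ?_, h5, ?_, ?_⟩
  · intro b hb d hd
    rcases Nat.lt_or_ge L b with hb1 | hb1
    · obtain rfl : b = L + 1 := by omega
      exact h4 d hd
    · exact h3 b hb1 d (h.D_le (by omega) (by omega) hd)
  · intro b hb m hm
    exact h3 b (by omega) m (h.D_le (by omega) (by omega) (h.M_D l hl hm))
  · rw [snoc_succ]
    exact hs

theorem forward_succ_succ (h : AChain G k q K M D f c) {i j l L : ℕ} {x : V} {p : ℕ → V}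
    {a : Fin k} (hij : i < j) (hjl : j < l) (hl : l < q) (hp : Forward G M D i j x p L)
    (hf : f i l = a)
    (hg : ∀ m ∈ M i (l + 1), ¬ G.Adj (c j l a) m) (hs : ∀ m ∈ M l (l + 1), ¬ G.Adj (c j l a) m) :
    ∃ p', Forward G M D i l x p' (L + 2) := by
  obtain ⟨h1, h2, h3, h4, h5⟩ := h.forward_append hij hjl hl hp hg
  refine ⟨_, h1.snoc (w := K l a) ?_, ?_, by omega, ?_, ?_, ?_, ?_⟩
  · intro b hb
    rcases Nat.lt_or_ge L b with hb1 | hb1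
    · obtain rfl : b = L + 1 := by omega
      rw [snoc_succ]
      simp only [h.c_K j l hjl hl a]
    · have := h3 b hb1 _ (h.D_le (show j + 1 ≤ l by omega) hl.le (h.K_mem l hl a))
      simp only [this, false_iff]
      omega
  · rw [snoc_le _ _ (Nat.zero_le _), h2]
  · intro b hb d hd
    rcases Nat.lt_or_ge (L + 1) b with hb1 | hb1
    · obtain rfl : b = L + 1 + 1 := by omega
      rw [snoc_succ]
      exact (h.D_K l hl d hd a).2
    · rw [snoc_le _ _ hb1]
      rcases Nat.lt_or_ge L b with hb2 | hb2
      · obtain rfl : b = L + 1 := by omega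
        exact h4 d hd
      · exact h3 b hb2 d (h.D_le (by omega) (by omega) hd)
  · intro b hb hb0 m hm
    rcases Nat.lt_or_ge (L + 1) b with hb1 | hb1
    · obtain rfl : b = L + 1 + 1 := by omega
      rw [snoc_succ, ← hf]
      exact h.M_f i l (by omega) hl m hm
    · rw [snoc_le _ _ hb1]
      exact h5 b hb1 hb0 m hm
  · intro b hb m hm
    rw [snoc_le _ _ (by omega)]
    rcases Nat.lt_or_ge L b with hb2 | hb2
    · obtain rfl : b = L + 1 := by omega
      rw [snoc_succ]
      exact hs m hm
    · exact h3 b hb2 m (h.D_le (by omega) (by omega) (h.M_D l hl hm))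
  · rw [show L + 2 = L + 1 + 1 by omega, snoc_succ]
    intro m hm
    exact h.M_K l (l + 1) (by omega) hl m hm a

variable {F : ℕ → Fin k}

/-- Closing a forward path by an edge between the two covers. -/
theorem Forward.cycle_edge (h : AChain G k q K M D f c) {i j L n : ℕ} {a : Fin k} {p : ℕ → V}
    (hij : i < j) (hj : j < q) (hp : Forward G M D i j (K i a) p L) (hn : n = L + 3) (h5 : 5 ≤ n)
    {m m' : V} (hm : m ∈ M j (j + 1)) (hm' : m' ∈ M i (j + 1)) (hmm : G.Adj m m') :
    Nonempty (cycleGraph n ↪g G) := by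
  have h1 : IndPath G (snoc p L m) (L + 1) := by
    refine hp.path.snoc fun b hb => ?_
    rcases Nat.eq_or_lt_of_le hb with rfl | hb
    · simp only [hp.last _ hm]
    · simp only [hp.front b hb _ hm, hb.ne]
  refine h1.cycle (w := m') (fun b hb => ?_) (by omega) h5
  rcases Nat.lt_or_ge L b with hb2 | hb2
  · obtain rfl : b = L + 1 := by omega
    rw [snoc_succ]
    simp only [hmm, or_true]
  · rw [snoc_le _ _ hb2]
    rcases Nat.eq_zero_or_pos b with rfl | hb0
    · rw [hp.start]
      simp only [h.M_K i (j + 1) (by omega) hj _ hm' a, true_or]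
    · simp only [hp.side b hb2 hb0 _ hm', false_iff]
      omega

/-- Closing a forward path through a vertex of the zone. -/
theorem Forward.cycle_zone (h : AChain G k q K M D f c) {i j L n : ℕ} {a : Fin k} {p : ℕ → V}
    (hij : i < j) (hj : j < q) (hp : Forward G M D i j (K i a) p L) (hn : n = L + 4) (h5 : 5 ≤ n)
    {d m m' : V} (hd : d ∈ D (j + 1)) (hm : m ∈ M j (j + 1)) (hm' : m' ∈ M i (j + 1))
    (hmm : ¬ G.Adj m m') (hmd : G.Adj m d) (hmd' : G.Adj m' d) :
    Nonempty (cycleGraph n ↪g G) := by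
  have h1 : IndPath G (snoc p L m) (L + 1) := by
    refine hp.path.snoc fun b hb => ?_
    rcases Nat.eq_or_lt_of_le hb with rfl | hb
    · simp only [hp.last _ hm]
    · simp only [hp.front b hb _ hm, hb.ne]
  have h2 : IndPath G (snoc (snoc p L m) (L + 1) d) (L + 1 + 1) := by
    refine h1.snoc fun b hb => ?_
    rcases Nat.lt_or_ge L b with hb2 | hb2
    · obtain rfl : b = L + 1 := by omega
      rw [snoc_succ]
      simp only [hmd]
    · rw [snoc_le _ _ hb2]
      simp only [hp.zone b hb2 d hd, false_iff]
      omega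
  refine h2.cycle (w := m') (fun b hb => ?_) (by omega) h5
  rcases Nat.lt_or_ge (L + 1) b with hb1 | hb1
  · obtain rfl : b = L + 1 + 1 := by omega
    rw [snoc_succ]
    simp only [hmd'.symm, or_true]
  rw [snoc_le _ _ hb1]
  rcases Nat.lt_or_ge L b with hb2 | hb2
  · obtain rfl : b = L + 1 := by omega
    rw [snoc_succ]
    simp only [hmm, false_iff]
    omega
  · rw [snoc_le _ _ hb2]
    rcases Nat.eq_zero_or_pos b with rfl | hb0
    · rw [hp.start]
      simp only [h.M_K i (j + 1) (by omega) hj _ hm' a, true_or]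
    · simp only [hp.side b hb2 hb0 _ hm', false_iff]
      omega

/-- Closing a forward path through a path with three edges. -/
theorem Forward.cycle_long (h : AChain G k q K M D f c) {i j l L N : ℕ} {a : Fin k} {p : ℕ → V}
    (hij : i < j) (hjl : j < l) (hl : l < q) (hp : Forward G M D i j (K i a) p L)
    (hN : N = L + 5) {d n m m' : V} (hd : d ∈ D (l + 1)) (hm : m ∈ M j l)
    (hn : n ∈ M l (l + 1)) (hm' : m' ∈ M i (l + 1)) (hmn : G.Adj m n) (hnd : G.Adj n d)
    (hdm : G.Adj m' d) (hmd : ¬ G.Adj m d) (hmm : ¬ G.Adj m m') (hnm : ¬ G.Adj n m') :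
    Nonempty (cycleGraph N ↪g G) := by
  replace hm := h.M_le (Nat.lt_succ_self j) hjl hl.le hm
  have hnD := h.D_le (show j + 1 ≤ l by omega) hl.le (h.M_D l hl hn)
  replace hd := h.D_le (show j + 1 ≤ l + 1 by omega) hl hd
  replace hm' := h.M_le (show i < j + 1 by omega) (show j + 1 ≤ l + 1 by omega) hl hm'
  have h1 : IndPath G (snoc p L m) (L + 1) := by
    refine hp.path.snoc fun b hb => ?_
    rcases Nat.eq_or_lt_of_le hb with rfl | hb
    · simp only [hp.last _ hm]
    · simp only [hp.front b hb _ hm, hb.ne]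
  have h2 : IndPath G (snoc (snoc p L m) (L + 1) n) (L + 1 + 1) := by
    refine h1.snoc fun b hb => ?_
    rcases Nat.lt_or_ge L b with hb2 | hb2
    · obtain rfl : b = L + 1 := by omega
      rw [snoc_succ]
      simp only [hmn]
    · rw [snoc_le _ _ hb2]
      simp only [hp.zone b hb2 _ hnD, false_iff]
      omega
  have h3 : IndPath G (snoc (snoc (snoc p L m) (L + 1) n) (L + 1 + 1) d) (L + 1 + 1 + 1) := by
    refine h2.snoc fun b hb => ?_
    rcases Nat.lt_or_ge (L + 1) b with hb1 | hb1
    · obtain rfl : b = L + 1 + 1 := by omega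
      rw [snoc_succ]
      simp only [hnd]
    rw [snoc_le _ _ hb1]
    rcases Nat.lt_or_ge L b with hb2 | hb2
    · obtain rfl : b = L + 1 := by omega
      rw [snoc_succ]
      simp only [hmd, false_iff]
      omega
    · rw [snoc_le _ _ hb2]
      simp only [hp.zone b hb2 _ hd, false_iff]
      omega
  refine h3.cycle (w := m') (fun b hb => ?_) (by omega) (by omega)
  rcases Nat.lt_or_ge (L + 1 + 1) b with hb0 | hb0
  · obtain rfl : b = L + 1 + 1 + 1 := by omega
    rw [snoc_succ]
    simp only [hdm.symm, or_true]
  rw [snoc_le _ _ hb0]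
  rcases Nat.lt_or_ge (L + 1) b with hb1 | hb1
  · obtain rfl : b = L + 1 + 1 := by omega
    rw [snoc_succ]
    simp only [hnm, false_iff]
    omega
  rw [snoc_le _ _ hb1]
  rcases Nat.lt_or_ge L b with hb2 | hb2
  · obtain rfl : b = L + 1 := by omega
    rw [snoc_succ]
    simp only [hmm, false_iff]
    omega
  · rw [snoc_le _ _ hb2]
    rcases Nat.eq_zero_or_pos b with rfl | hb0
    · rw [hp.start]
      simp only [h.M_K i (j + 1) (by omega) (by omega) _ hm' a, true_or]
    · simp only [hp.side b hb2 hb0 _ hm', false_iff]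
      omega

end AChain

/-- Every clique of `G` has at most `κ` vertices. -/
def CliqueLE {V : Type*} (G : SimpleGraph V) (κ : ℕ) : Prop :=
  ∀ s : Finset V, (∀ x ∈ s, ∀ y ∈ s, x ≠ y → G.Adj x y) → s.card ≤ κ

/-- Pairwise adjacency along an indexing finset bounds its cardinality. -/
theorem CliqueLE.card_le {V ι : Type*} {G : SimpleGraph V} {κ : ℕ} (h : CliqueLE G κ)
    (s : Finset ι) (g : ι → V) (hg : ∀ x ∈ s, ∀ y ∈ s, x ≠ y → G.Adj (g x) (g y)) :
    s.card ≤ κ := by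
  classical
  have hinj : Set.InjOn g s := by
    intro x hx y hy hxy
    by_contra hne
    exact (hg x hx y hy hne).ne hxy
  rw [← Finset.card_image_of_injOn hinj]
  refine h _ fun x hx y hy hxy => ?_
  obtain ⟨a, ha, rfl⟩ := Finset.mem_image.1 hx
  obtain ⟨b, hb, rfl⟩ := Finset.mem_image.1 hy
  exact hg a ha b hb fun hab => hxy (by rw [hab])

namespace AChain

theorem cycle_of_homChain {V : Type*} {G : SimpleGraph V} {k Q κ ℓ H : ℕ} (hℓ : 24 ≤ ℓ)
    (hH : H = ℓ + κ + 5) {K : ℕ → Fin k → V} {M : ℕ → ℕ → Set V} {D : ℕ → Set V}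
    {f : ℕ → ℕ → Fin k} {c : ℕ → ℕ → Fin k → V} (h : AChain G k Q K M D f c)
    (hD : (D Q).Nonempty) (hω : CliqueLE G κ) {S : Finset ℕ} (hS : ∀ i ∈ S, i < Q)
    {F : ℕ → Fin k} (hF : ∀ i ∈ S, ∀ j ∈ S, i < j → f i j = F j)
    (hc : HomChain (fun i j => ∀ d ∈ D Q, ∀ m ∈ M i Q, ∀ m' ∈ M j Q, G.Adj m d → G.Adj m' d →
        G.Adj m m') (fun k l => ∀ m ∈ M l (l + 1), G.Adj (c k l (F l)) m)
      (fun i k l => ∀ m ∈ M i (l + 1), ¬ G.Adj (c k l (F l)) m) H S) :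
    Nonempty (cycleGraph ℓ ↪g G) := by
  classical
  obtain ⟨i, hiS, k, ⟨hkS, hk⟩, hik, hσ, hσ'⟩ := hc
  have hkQ : ∀ b < H, k b < Q := fun b hb => hS _ (hkS b hb)
  obtain ⟨L₀, hL₀, hstart⟩ : ∃ L₀, (L₀ = 1 ∨ L₀ = 2) ∧
      ∀ b < H, ∃ p, Forward G M D i (k b) (K i (F i)) p L₀ := by
    rcases hσ with hσ | hσ
    · exact ⟨1, Or.inl rfl, fun b hb => h.forward_single (hik b hb).1 (hkQ b hb) (hσ b hb)⟩
    · refine ⟨2, Or.inr rfl, fun b hb => h.forward_double (hik b hb).1 (hkQ b hb)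
        (hF i hiS _ (hkS b hb) (hik b hb).1) ?_⟩
      rcases h.hom i (k b) (hik b hb).1 (hkQ b hb) (F (k b)) (k b) le_rfl with h1 | h1
      · exact absurd h1 (hσ b hb)
      · exact h1
  obtain ⟨s, hs, hstep⟩ : ∃ s, (s = 1 ∨ s = 2) ∧ ∀ b, b + 1 < H → ∀ p L,
      Forward G M D i (k b) (K i (F i)) p L →
        ∃ p', Forward G M D i (k (b + 1)) (K i (F i)) p' (L + s) := by
    rcases hσ' with hσ | hσ
    · exact ⟨1, Or.inl rfl, fun b hb p L hp => h.forward_succ (hik b (by omega)).1 (hk b hb).1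
        (hkQ _ hb) hp (hk b hb).2 (hσ b hb)⟩
    · refine ⟨2, Or.inr rfl, fun b hb p L hp => h.forward_succ_succ (hik b (by omega)).1
        (hk b hb).1 (hkQ _ hb) hp (hF i hiS _ (hkS _ hb) (hik _ hb).1) (hk b hb).2 ?_⟩
      rcases h.hom (k b) (k (b + 1)) (hk b hb).1 (hkQ _ hb) (F (k (b + 1))) (k (b + 1)) le_rfl
        with h1 | h1
      · exact absurd h1 (hσ b hb)
      · exact h1
  have hpath : ∀ t a, a + t < H →
      ∃ p, Forward G M D i (k (a + t)) (K i (F i)) p (L₀ + s * t) := by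
    intro t
    induction t with
    | zero => exact fun a ha => hstart a ha
    | succ t ih =>
      intro a ha
      obtain ⟨p, hp⟩ := ih a (by omega)
      have := hstep (a + t) ha p _ hp
      rwa [Nat.add_assoc, Nat.add_assoc] at this
  by_cases hpar : ∃ t, L₀ + s * t + 4 = ℓ
  · obtain ⟨t, ht⟩ := hpar
    have htℓ : t < H := by
      have : t ≤ s * t := Nat.le_mul_of_pos_left t (by omega)
      omega
    obtain ⟨p, hp⟩ := hpath t 0 (by omega)
    rw [Nat.zero_add] at hp
    have := (hik t htℓ).2
    push Not at this
    obtain ⟨d, hd, m', hm', m, hm, hmd', hmd, hmm⟩ := this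
    have hlt := hkQ t htℓ
    have hlt' := (hik t htℓ).1
    exact hp.cycle_zone h hlt' hlt ht.symm (by omega) (h.D_le hlt le_rfl hd)
      (h.M_le (Nat.lt_succ_self _) hlt le_rfl hm) (h.M_le (by omega) hlt le_rfl hm')
      (fun hmm' => hmm hmm'.symm) hmd hmd'
  obtain ⟨w, hw1, hw⟩ : ∃ w, 1 ≤ w ∧ L₀ + s * w + 3 = ℓ := by
    rcases hs with rfl | rfl
    · exact absurd ⟨ℓ - 4 - L₀, by omega⟩ hpar
    · rcases Nat.even_or_odd' (ℓ - 4 - L₀) with ⟨c, hc | hc⟩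
      · exact absurd ⟨c, by omega⟩ hpar
      · exact ⟨c + 1, by omega, by omega⟩
  have hs2 : s = 2 := by
    rcases hs with rfl | rfl
    · exact absurd ⟨w - 1, by omega⟩ hpar
    · rfl
  subst hs2
  by_cases hE : ∃ b, w ≤ b ∧ b < H ∧ ∃ m ∈ M (k b) (k b + 1), ∃ m' ∈ M i (k b + 1), G.Adj m m'
  · obtain ⟨b, hwb, hb, m, hm, m', hm', hmm⟩ := hE
    obtain ⟨p, hp⟩ := hpath w (b - w) (by omega)
    rw [Nat.sub_add_cancel hwb] at hp
    exact hp.cycle_edge h (hik b hb).1 (hkQ b hb) hw.symm (by omega) hm hm' hmm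
  push Not at hE
  by_cases hV : ∃ b, w ≤ b ∧ b + 1 < H ∧ ∃ d ∈ D (k (b + 1) + 1),
      ∃ n ∈ M (k (b + 1)) (k (b + 1) + 1), ∃ m ∈ M (k b) (k (b + 1)),
      G.Adj n d ∧ G.Adj m n ∧ ¬ G.Adj m d
  · obtain ⟨b, hwb, hb, d, hd, n, hn, m, hm, hnd, hmn, hmd⟩ := hV
    obtain ⟨p, hp⟩ := hpath (w - 1) (b - (w - 1)) (by omega)
    rw [Nat.sub_add_cancel (by omega)] at hp
    have hbb := (hk b hb).1
    have hib := (hik b (by omega)).1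
    have hbQ := hkQ _ hb
    obtain ⟨m', hm', hmd'⟩ := h.cover i (k (b + 1) + 1) (by omega) hbQ d hd
    exact hp.cycle_long h hib hbb hbQ (by omega) hd hm hn hm' hmn hnd hmd' hmd
      (hE b hwb (by omega) m (h.M_le (Nat.lt_succ_self _) hbb hbQ.le hm) m'
        (h.M_le (by omega) (by omega) hbQ hm'))
      (hE (b + 1) (by omega) hb n hn m' hm')
  push Not at hV
  have hcl : ∀ t ≤ κ, ∃ W : Finset V, (∀ x ∈ W, ∀ y ∈ W, x ≠ y → G.Adj x y) ∧ W.card = t + 1 ∧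
      (∀ x ∈ W, x ∈ D (k (H - 1 - t) + 1)) ∧
      ∃ n ∈ M (k (H - 1 - t)) (k (H - 1 - t) + 1), ∀ x ∈ W, G.Adj n x := by
    intro t
    induction t with
    | zero =>
      intro _
      obtain ⟨d, hd⟩ := hD
      have hQ := hkQ (H - 1 - 0) (by omega)
      have hd' := h.D_le (show k (H - 1 - 0) + 1 ≤ Q from hQ) le_rfl hd
      obtain ⟨n, hn, hnd⟩ := h.cover (k (H - 1 - 0)) (k (H - 1 - 0) + 1) (by omega) hQ d hd'
      refine ⟨{d}, ?_, by simp, by simpa using hd', n, hn, by simpa using hnd⟩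
      intro x hx y hy hxy
      simp only [Finset.mem_singleton] at hx hy
      exact absurd (hx.trans hy.symm) hxy
    | succ t ih =>
      intro ht
      obtain ⟨W, hW, hWc, hWD, n, hn, hnW⟩ := ih (by omega)
      obtain ⟨b, hb⟩ : ∃ b, b = H - 1 - (t + 1) := ⟨_, rfl⟩
      rw [show H - 1 - t = b + 1 by omega] at hWD hn
      rw [← hb]
      have hbH : b + 1 < H := by omega
      have hbb := (hk b hbH).1
      have hbQ := hkQ _ hbH
      have hnD := h.M_D _ hbQ hn
      obtain ⟨n', hn', hnn⟩ := h.cover (k b) (k (b + 1)) hbb hbQ.le n hnD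
      refine ⟨insert n W, ?_, ?_, ?_, n', h.M_le (Nat.lt_succ_self _) hbb hbQ.le hn', ?_⟩
      · intro x hx y hy hxy
        rcases Finset.mem_insert.1 hx with rfl | hx' <;>
          rcases Finset.mem_insert.1 hy with rfl | hy'
        · exact absurd rfl hxy
        · exact hnW y hy'
        · exact (hnW x hx').symm
        · exact hW x hx' y hy' hxy
      · rw [Finset.card_insert_of_notMem (fun h' => G.irrefl (hnW n h')), hWc]
      · intro x hx
        rcases Finset.mem_insert.1 hx with rfl | hx
        · exact h.D_le hbb hbQ.le hnD
        · exact h.D_le (by omega) hbQ (hWD x hx)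
      · intro x hx
        rcases Finset.mem_insert.1 hx with rfl | hx
        · exact hnn
        · exact hV b (by omega) hbH x (hWD x hx) n hn n' hn' (hnW x hx) hnn
  obtain ⟨W, hW, hWc, -⟩ := hcl κ le_rfl
  have := hω W hW
  omega

theorem exists_cycle (k κ ℓ : ℕ) (hℓ : 24 ≤ ℓ) : ∃ Q, ∀ (V : Type) (G : SimpleGraph V)
    (K : ℕ → Fin k → V) (M : ℕ → ℕ → Set V) (D : ℕ → Set V) (f : ℕ → ℕ → Fin k)
    (c : ℕ → ℕ → Fin k → V), AChain G k Q K M D f c → (D Q).Nonempty → CliqueLE G κ →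
      Nonempty (cycleGraph ℓ ↪g G) := by
  classical
  obtain ⟨R, hR⟩ := exists_homChain (ℓ + κ + 5) (κ + 1) (κ + 1)
  obtain ⟨Q, hQ⟩ := exists_column_constant k R
  refine ⟨Q, fun V G K M D f c h hD hω => ?_⟩
  obtain ⟨S, hSQ, hS, F, hF⟩ := hQ f (Finset.range Q) (by simp)
  replace hSQ : ∀ i ∈ S, i < Q := fun i hi => Finset.mem_range.1 (hSQ hi)
  rcases hR (fun i j => ∀ d ∈ D Q, ∀ m ∈ M i Q, ∀ m' ∈ M j Q, G.Adj m d → G.Adj m' d →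
        G.Adj m m') (fun k l => ∀ m ∈ M l (l + 1), G.Adj (c k l (F l)) m)
      (fun i k l => ∀ m ∈ M i (l + 1), ¬ G.Adj (c k l (F l)) m) S hS with
    hc | ⟨A, hA, hAc, hAα⟩ | ⟨Y, hYc, hYS, hY⟩
  · exact h.cycle_of_homChain hℓ rfl hD hω hSQ hF hc
  · obtain ⟨d, hd⟩ := hD
    have hm : ∀ i : ℕ, ∃ m, i ∈ A → m ∈ M i Q ∧ G.Adj m d := by
      intro i
      by_cases hi : i ∈ A
      · obtain ⟨m, hm, hmd⟩ := h.cover i Q (hSQ i (hA hi)) le_rfl d hd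
        exact ⟨m, fun _ => ⟨hm, hmd⟩⟩
      · exact ⟨d, fun h' => absurd h' hi⟩
    choose m hm using hm
    have := hω.card_le A m fun x hx y hy hxy => by
      rcases lt_or_gt_of_ne hxy with h1 | h1
      · exact hAα x hx y hy h1 d hd _ (hm x hx).1 _ (hm y hy).1 (hm x hx).2 (hm y hy).2
      · exact (hAα y hy x hx h1 d hd _ (hm y hy).1 _ (hm x hx).1 (hm y hy).2 (hm x hx).2).symm
    omega
  · have key : ∀ p ∈ Y, ∀ q ∈ Y, BadNest (fun i k l => ∀ m ∈ M i (l + 1),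
        ¬ G.Adj (c k l (F l)) m) p q → G.Adj (c p.1 p.2 (F p.2)) (c q.1 q.2 (F q.2)) := by
      rintro p hp q hq ⟨h1, h2, h3⟩
      obtain ⟨-, hp2, hp3⟩ := hYS p hp
      obtain ⟨-, hq2, hq3⟩ := hYS q hq
      rcases h.hom p.1 p.2 hp3 (hSQ _ hp2) (F p.2) q.1 (by omega) with h4 | h4
      · exact h4 _ (h.M_le (by omega) h2 (hSQ _ hq2).le (h.c_mem q.1 q.2 hq3 (hSQ _ hq2) _))
      · exact absurd h4 h3
    have := hω.card_le Y (fun p => c p.1 p.2 (F p.2)) fun x hx y hy hxy => by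
      rcases hY x hx y hy hxy with h1 | h1
      · exact key x hx y hy h1
      · exact (key y hy x hx h1).symm
    omega

end AChain

/-- `c` colours `A` properly with colours `< k`, for some `c`. -/
def SetCol {V : Type*} (G : SimpleGraph V) (A : Set V) (k : ℕ) : Prop :=
  ∃ c : V → ℕ, (∀ v ∈ A, c v < k) ∧ ∀ u ∈ A, ∀ v ∈ A, G.Adj u v → c u ≠ c v

theorem SetCol.mono {V : Type*} {G : SimpleGraph V} {A B : Set V} {k l : ℕ} (h : SetCol G B k)
    (hAB : A ⊆ B) (hkl : k ≤ l) : SetCol G A l := by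
  obtain ⟨c, hc, hc'⟩ := h
  exact ⟨c, fun v hv => (hc v (hAB hv)).trans_le hkl, fun u hu v hv => hc' u (hAB hu) v (hAB hv)⟩

theorem SetCol.union {V : Type*} {G : SimpleGraph V} {A B : Set V} {k l : ℕ} (hA : SetCol G A k)
    (hB : SetCol G B l) : SetCol G (A ∪ B) (k + l) := by
  classical
  obtain ⟨c, hc, hc'⟩ := hA
  obtain ⟨e, he, he'⟩ := hB
  refine ⟨fun v => if v ∈ A then c v else k + e v, ?_, ?_⟩
  · intro v hv
    by_cases h : v ∈ A
    · have := hc v h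
      simp only [h, if_true]
      omega
    · have := he v (hv.resolve_left h)
      simp only [h, if_false]
      omega
  · intro u hu v hv huv
    by_cases h : u ∈ A <;> by_cases h' : v ∈ A
    · simpa [h, h'] using hc' u h v h' huv
    · have := hc u h
      simp only [h, h', if_true, if_false]
      omega
    · have := hc v h'
      simp only [h, h', if_true, if_false]
      omega
    · simpa [h, h'] using he' u (hu.resolve_left h) v (hv.resolve_left h') huv

theorem setCol_empty {V : Type*} (G : SimpleGraph V) : SetCol G ∅ 0 :=
  ⟨fun _ => 0, by simp, by simp⟩

theorem setCol_singleton {V : Type*} (G : SimpleGraph V) (v : V) : SetCol G {v} 1 := by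
  refine ⟨fun _ => 0, by simp, ?_⟩
  rintro x rfl y rfl h
  exact absurd h (G.irrefl)

theorem exists_setCol {V : Type*} [Finite V] (G : SimpleGraph V) (A : Set V) :
    ∃ k, SetCol G A k := by
  obtain ⟨n, ⟨e⟩⟩ := Finite.exists_equiv_fin V
  refine ⟨n, fun v => e v, fun v _ => (e v).2, fun u _ v _ huv h => huv.ne ?_⟩
  exact e.injective (Fin.ext h)

/-- The ball of radius two around `v` inside `X`. -/
def ballIn {V : Type*} (G : SimpleGraph V) (X : Set V) (v : V) : Set V :=
  {d | d ∈ X ∧ (d = v ∨ G.Adj v d ∨ ∃ m ∈ X, G.Adj v m ∧ G.Adj m d)}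

theorem exists_max_ballIn {V : Type*} [Finite V] (G : SimpleGraph V) {X : Set V}
    (hX : X.Nonempty) :
    ∃ v ∈ X, ∀ k, SetCol G (ballIn G X v) k → ∀ w ∈ X, SetCol G (ballIn G X w) k := by
  classical
  let g : V → ℕ := fun v => Nat.find (exists_setCol G (ballIn G X v))
  obtain ⟨v, hv, hmax⟩ := Set.exists_max_image X g (Set.toFinite X) hX
  refine ⟨v, hv, fun k hk w hw => ?_⟩
  exact (Nat.find_spec (exists_setCol G (ballIn G X w))).mono subset_rfl
    ((hmax w hw).trans (Nat.find_min' _ hk))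

/-- `K` is a `k`-clique in `E`. -/
def CliqueIn {W : Type*} (G : SimpleGraph W) (k : ℕ) (E : Set W) (K : Fin k → W) : Prop :=
  (∀ a b, a ≠ b → G.Adj (K a) (K b)) ∧ ∀ a, K a ∈ E

/-- A sequence of graphs, controlled in a uniform way, with unbounded chromatic number, bounded
cliques, locally bounded chromatic number, and no induced cycle of length `ℓ`. -/
structure GSeq where
  V : ℕ → Type
  fin : ∀ n, Finite (V n)
  ne : ∀ n, Nonempty (V n)
  G : ∀ n, SimpleGraph (V n)
  U : Ultrafilter ℕ
  φ : ℕ → ℕ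
  κ : ℕ
  τ : ℕ
  ℓ : ℕ
  ctrl : ∀ n k X, (∀ v ∈ X, SetCol (G n) (ballIn (G n) X v) k) → SetCol (G n) X (φ k)
  clique : ∀ n, CliqueLE (G n) κ
  nbr : ∀ n v, SetCol (G n) {w | (G n).Adj v w} τ
  large : ∀ k, ∀ᶠ n in U, ¬ SetCol (G n) Set.univ k
  le_ℓ : 24 ≤ ℓ
  hole : ∀ n, ¬ Nonempty (cycleGraph ℓ ↪g G n)

namespace GSeq

variable (S : GSeq)

instance (n : ℕ) : Finite (S.V n) := S.fin n
instance (n : ℕ) : Nonempty (S.V n) := S.ne n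

/-- A sequence of vertex sets. -/
abbrev Zone := ∀ n, Set (S.V n)

/-- The chromatic number of `A` tends to infinity. -/
def Large (A : S.Zone) : Prop := ∀ k, ∀ᶠ n in S.U, ¬ SetCol (S.G n) (A n) k

variable {S}

theorem exists_seq {α : ℕ → Type*} [∀ n, Nonempty (α n)] {P : ∀ n, α n → Prop}
    (h : ∀ᶠ n in S.U, ∃ x, P n x) : ∃ x : ∀ n, α n, ∀ᶠ n in S.U, P n (x n) := by
  classical
  refine ⟨fun n => if h : ∃ x, P n x then h.choose else Classical.arbitrary _, ?_⟩
  filter_upwards [h] with n hn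
  rw [dif_pos hn]
  exact hn.choose_spec

theorem not_large {A : S.Zone} : ¬ S.Large A ↔ ∃ k, ∀ᶠ n in S.U, SetCol (S.G n) (A n) k := by
  unfold Large
  push Not
  rfl

theorem Large.mono {A B : S.Zone} (h : S.Large A) (hAB : ∀ᶠ n in S.U, A n ⊆ B n) :
    S.Large B := by
  intro k
  filter_upwards [h k, hAB] with n h1 h2 h3
  exact h1 (h3.mono h2 le_rfl)

theorem large_univ : S.Large (fun _ => Set.univ) := S.large

theorem Large.of_union {A B C : S.Zone} (h : S.Large A) (hA : ∀ᶠ n in S.U, A n ⊆ B n ∪ C n) :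
    S.Large B ∨ S.Large C := by
  by_contra! hcon
  obtain ⟨⟨k, hk⟩, ⟨l, hl⟩⟩ := And.intro (not_large.1 hcon.1) (not_large.1 hcon.2)
  refine not_large.2 ⟨k + l, ?_⟩ h
  filter_upwards [hk, hl, hA] with n h1 h2 h3
  exact (h1.union h2).mono h3 le_rfl

theorem Large.diff {A B : S.Zone} (h : S.Large A) (hB : ¬ S.Large B) :
    S.Large (fun n => A n \ B n) :=
  (h.of_union (B := B) (C := fun n => A n \ B n)
    (Filter.Eventually.of_forall fun _ => by simp)).resolve_left hB

theorem not_large_union {A B : S.Zone} (hA : ¬ S.Large A) (hB : ¬ S.Large B) :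
    ¬ S.Large (fun n => A n ∪ B n) := fun h =>
  (h.of_union (Filter.Eventually.of_forall fun _ => subset_rfl)).elim hA hB

theorem not_large_empty : ¬ S.Large (fun _ => ∅) :=
  not_large.2 ⟨0, Filter.Eventually.of_forall fun _ => setCol_empty _⟩

theorem not_large_biUnion {ι : Type*} (s : Finset ι) {B : ι → S.Zone}
    (h : ∀ i ∈ s, ¬ S.Large (B i)) : ¬ S.Large (fun n => ⋃ i ∈ s, B i n) := by
  classical
  induction s using Finset.induction_on with
  | empty => simpa using not_large_empty
  | insert a s ha ih =>
    simp only [Finset.set_biUnion_insert]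
    exact not_large_union (h a (Finset.mem_insert_self _ _))
      (ih fun i hi => h i (Finset.mem_insert_of_mem hi))

theorem not_large_iUnion {ι : Type*} [Finite ι] {B : ι → S.Zone}
    (h : ∀ i, ¬ S.Large (B i)) : ¬ S.Large (fun n => ⋃ i, B i n) := by
  have := Fintype.ofFinite ι
  simpa using not_large_biUnion Finset.univ fun i _ => h i

theorem Large.of_iUnion {ι : Type*} [Finite ι] {A : S.Zone} {B : ι → S.Zone} (h : S.Large A)
    (hA : ∀ᶠ n in S.U, A n ⊆ ⋃ i, B i n) : ∃ i, S.Large (B i) := by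
  by_contra! hcon
  exact not_large_iUnion hcon (h.mono hA)

theorem Large.nonempty {A : S.Zone} (h : S.Large A) : ∀ᶠ n in S.U, (A n).Nonempty := by
  filter_upwards [h 0] with n hn
  by_contra hcon
  rw [Set.not_nonempty_iff_eq_empty] at hcon
  exact hn (hcon ▸ setCol_empty _)

theorem not_large_nbr (v : ∀ n, S.V n) : ¬ S.Large (fun n => {w | (S.G n).Adj (v n) w}) :=
  not_large.2 ⟨S.τ, Filter.Eventually.of_forall fun n => S.nbr n _⟩

theorem not_large_singleton (v : ∀ n, S.V n) : ¬ S.Large (fun n => {v n}) :=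
  not_large.2 ⟨1, Filter.Eventually.of_forall fun _ => setCol_singleton _ _⟩

theorem Large.mono' {A B : S.Zone} (h : S.Large A) (hAB : ∀ n, A n ⊆ B n) : S.Large B :=
  h.mono (Filter.Eventually.of_forall hAB)

theorem Large.exists_center {E : S.Zone} (hE : S.Large E) : ∃ v : ∀ n, S.V n,
    (∀ᶠ n in S.U, v n ∈ E n) ∧ S.Large (fun n => {d | d ∈ E n ∧ (d ≠ v n ∧ ¬ (S.G n).Adj (v n) d) ∧
      ∃ m ∈ E n, (S.G n).Adj (v n) m ∧ (S.G n).Adj m d}) := by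
  obtain ⟨v, hv⟩ := exists_seq (S := S) (P := fun n v => v ∈ E n ∧ ∀ k,
    SetCol (S.G n) (ballIn (S.G n) (E n) v) k → ∀ w ∈ E n,
      SetCol (S.G n) (ballIn (S.G n) (E n) w) k) (by
    filter_upwards [hE.nonempty] with n hn
    exact exists_max_ballIn _ hn)
  refine ⟨v, hv.mono fun n h => h.1, ?_⟩
  have h1 : S.Large (fun n => ballIn (S.G n) (E n) (v n)) := by
    by_contra hcon
    obtain ⟨k, hk⟩ := not_large.1 hcon
    refine not_large.2 ⟨S.φ k, ?_⟩ hE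
    filter_upwards [hv, hk] with n h2 h3
    exact S.ctrl n k _ (h2.2 k h3)
  refine (h1.diff (not_large_union (not_large_singleton v) (not_large_nbr v))).mono' ?_
  rintro n d ⟨⟨hd, hd'⟩, hd''⟩
  simp only [Set.mem_union, Set.mem_singleton_iff, Set.mem_ofPred_eq, not_or] at hd''
  exact ⟨hd, hd'', (hd'.resolve_left hd''.1).resolve_left hd''.2⟩

/-- A relation between a zone, a `k`-tuple and a vertex, in every graph of the sequence. -/
abbrev Rel (S : GSeq) (k : ℕ) := ∀ n, Set (S.V n) → (Fin k → S.V n) → S.V n → Prop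

/-- In every large part `E` of `Z` some clique is related to a large part of `E`. -/
def Full (S : GSeq) (k : ℕ) (P : S.Rel k) (Z : S.Zone) : Prop :=
  ∀ E : S.Zone, (∀ᶠ n in S.U, E n ⊆ Z n) → S.Large E → ∃ K : ∀ n, Fin k → S.V n,
    (∀ᶠ n in S.U, CliqueIn (S.G n) k (E n) (K n)) ∧ S.Large (fun n => {d | d ∈ E n ∧ P n (E n) (K n) d})

theorem Full.mono {k : ℕ} {P : S.Rel k} {Z Z' : S.Zone} (h : S.Full k P Z)
    (hZ : ∀ᶠ n in S.U, Z' n ⊆ Z n) : S.Full k P Z' := fun E hE hL =>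
  h E ((hE.and hZ).mono fun _ h => h.1.trans h.2) hL

/-- `d` is not attached to `K`, but has a common neighbour with `K` in `E`. -/
def Base (S : GSeq) (k : ℕ) : S.Rel k := fun n E K d =>
  (∀ a, d ≠ K a ∧ ¬ (S.G n).Adj (K a) d) ∧ ∃ m ∈ E, (∀ a, (S.G n).Adj (K a) m) ∧ (S.G n).Adj m d

theorem full_one : S.Full 1 (S.Base 1) (fun _ => Set.univ) := by
  intro E _ hL
  obtain ⟨v, hv, hv'⟩ := hL.exists_center
  refine ⟨fun n _ => v n, ?_, hv'.mono' ?_⟩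
  · filter_upwards [hv] with n hn
    exact ⟨fun a b hab => absurd (Subsingleton.elim a b) hab, fun _ => hn⟩
  · rintro n d ⟨h1, h2, m, hm, hm1, hm2⟩
    exact ⟨h1, fun _ => h2, m, hm, fun _ => hm1, hm2⟩

theorem exists_extremal (S : GSeq) : ∃ k, 1 ≤ k ∧ ∃ Z₀ : S.Zone, S.Large Z₀ ∧ S.Full k (S.Base k) Z₀ ∧
    ∀ K : ∀ n, Fin (k + 1) → S.V n, (∀ᶠ n in S.U, CliqueIn (S.G n) (k + 1) (Z₀ n) (K n)) →
      ¬ S.Large (fun n => {d | d ∈ Z₀ n ∧ S.Base (k + 1) n (Z₀ n) (K n) d}) := by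
  classical
  have hbig : ¬ S.Full (S.κ + 1) (S.Base _) (fun _ => Set.univ) := by
    intro h
    obtain ⟨K, hK, -⟩ := h _ (Filter.Eventually.of_forall fun _ => subset_rfl) large_univ
    obtain ⟨n, hn⟩ := hK.exists
    have := (S.clique n).card_le Finset.univ (K n) fun x _ y _ hxy => hn.1 x y hxy
    simp at this
  obtain ⟨k, hk1, hk, hk'⟩ : ∃ k, 1 ≤ k ∧ S.Full k (S.Base k) (fun _ => Set.univ) ∧
      ¬ S.Full (k + 1) (S.Base (k + 1)) (fun _ => Set.univ) := by
    by_contra! hcon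
    have : ∀ k, S.Full (k + 1) (S.Base (k + 1)) (fun _ => Set.univ) := by
      intro k
      induction k with
      | zero => exact full_one
      | succ k ih => exact hcon (k + 1) (by omega) ih
    exact hbig (this S.κ)
  unfold Full at hk'
  push Not at hk'
  obtain ⟨Z₀, -, hZ, hno⟩ := hk'
  exact ⟨k, hk1, Z₀, hZ, hk.mono (Filter.Eventually.of_forall fun _ => Set.subset_univ _), hno⟩

end GSeq

namespace AChain

variable {V : Type*} {G : SimpleGraph V} {k q τ : ℕ} {K : ℕ → Fin k → V} {M : ℕ → ℕ → Set V}
  {D : ℕ → Set V} {f : ℕ → ℕ → Fin k} {c : ℕ → ℕ → Fin k → V}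

theorem extend (h : AChain G k q K M D f c) (hk : 0 < k)
    (hτ : ∀ v, SetCol G {w | G.Adj v w} τ) {E F : Set V} (hE : E ⊆ D q) {L : Fin k → V}
    (hL : CliqueIn G k E L) (R : V → Prop) (hFE : F ⊆ E)
    (hF : ∀ d ∈ F, ∀ a, d ≠ L a ∧ ¬ G.Adj (L a) d)
    (hFR : ∀ d ∈ F, ∃ m ∈ E, (∀ a, G.Adj (L a) m) ∧ G.Adj m d ∧ R m)
    (hFM : ∀ d ∈ F, ∀ i < q, ∃ m ∈ M i q, G.Adj m d ∧ ∃ a, ¬ G.Adj (L a) m) :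
    ∃ (c' : ℕ → ℕ → Fin k → V)
      (M' : (Fin (q + 1) → (Fin k ⊕ Fin q × Fin k) → Prop) × Fin τ → ℕ → ℕ → Set V)
      (D' : (Fin (q + 1) → (Fin k ⊕ Fin q × Fin k) → Prop) × Fin τ → Set V)
      (f' : (Fin (q + 1) → (Fin k ⊕ Fin q × Fin k) → Prop) × Fin τ → ℕ → ℕ → Fin k),
      F ⊆ (⋃ p : Fin q × Fin k, {d | G.Adj (c' p.1 q p.2) d}) ∪ (⋃ g, D' g) ∧
      ∀ g, D' g ⊆ F ∧ (∀ m ∈ M' g q (q + 1), R m) ∧ (∀ i j, j ≤ q → M' g i j = M i j) ∧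
        AChain G k (q + 1) (Function.update K q L) (M' g) (Function.update D (q + 1) (D' g))
          (f' g) c' := by
  classical
  obtain ⟨col, hcol, hcol'⟩ := hτ (L ⟨0, hk⟩)
  have hconn : ∀ (i : ℕ) (a : Fin k), ∃ m, i < q → m ∈ M i q ∧ G.Adj m (L a) := by
    intro i a
    by_cases hi : i < q
    · obtain ⟨m, hm, hma⟩ := h.cover i q hi le_rfl _ (hE (hL.2 a))
      exact ⟨m, fun _ => ⟨hm, hma⟩⟩
    · exact ⟨L a, fun h' => absurd h' hi⟩
  choose e he using hconn
  -- the vertices with respect to which the covers are made homogeneous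
  let u : (Fin k ⊕ Fin q × Fin k) → V := Sum.elim L fun p => e p.1 p.2
  let I := (Fin (q + 1) → (Fin k ⊕ Fin q × Fin k) → Prop) × Fin τ
  let good : I → ℕ → V → Prop := fun g i m => ∀ (hi : i < q + 1) t, g.1 ⟨i, hi⟩ t ↔ G.Adj (u t) m
  let old : I → ℕ → Set V := fun g i => {m | m ∈ M i q ∧ (∃ a, ¬ G.Adj (L a) m) ∧ good g i m}
  let new : I → Set V := fun g => {m | m ∈ E ∧ (∀ a, G.Adj (L a) m) ∧ R m ∧ good g q m ∧
    col m = g.2}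
  let M' : I → ℕ → ℕ → Set V := fun g i j =>
    if j = q + 1 then (if i < q then old g i else new g) else M i j
  let D' : I → Set V := fun g => {d | d ∈ F ∧ (∀ i < q, ∀ a, ¬ G.Adj (e i a) d) ∧
    (∀ i < q, ∃ m ∈ old g i, G.Adj m d) ∧ ∃ m ∈ new g, G.Adj m d}
  let c' : ℕ → ℕ → Fin k → V := fun i j a => if j = q then e i a else c i j a
  let f' : I → ℕ → ℕ → Fin k := fun g i j =>
    if j = q then (if hi : ∃ (hi : i < q + 1) (a : Fin k), ¬ g.1 ⟨i, hi⟩ (Sum.inl a) then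
      hi.choose_spec.choose else ⟨0, hk⟩) else f i j
  have M'old : ∀ g i j, j ≤ q → M' g i j = M i j := fun g i j hj => if_neg (by omega)
  have M'lt : ∀ g i, i < q → M' g i (q + 1) = old g i := fun g i hi => by
    simp only [M', if_true, hi]
  have M'q : ∀ g, M' g q (q + 1) = new g := fun g => by
    simp only [M', if_true, lt_irrefl, if_false]
  have goodM : ∀ g i, i ≤ q → ∀ m ∈ M' g i (q + 1), good g i m := by
    intro g i hi m hm
    rcases Nat.eq_or_lt_of_le hi with rfl | hi
    · rw [M'q] at hm
      exact hm.2.2.2.1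
    · rw [M'lt g i hi] at hm
      exact hm.2.2
  have D'old : ∀ g j, j ≤ q → Function.update D (q + 1) (D' g) j = D j := fun g j hj =>
    Function.update_of_ne (by omega) _ _
  have Kold : ∀ j, j < q → Function.update K q L j = K j := fun j hj =>
    Function.update_of_ne (by omega) _ _
  refine ⟨c', M', D', f', ?_, fun g => ⟨fun d hd => hd.1, ?_, M'old g, ?_⟩⟩
  · intro d hd
    by_cases hN : ∃ i < q, ∃ a, G.Adj (e i a) d
    · obtain ⟨i, hi, a, hia⟩ := hN
      refine Or.inl (Set.mem_iUnion.2 ⟨(⟨i, hi⟩, a), ?_⟩)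
      simpa [c'] using hia
    push Not at hN
    obtain ⟨m, hmE, hmL, hmd, hmR⟩ := hFR d hd
    have hold : ∀ i, ∃ m, i < q → m ∈ M i q ∧ G.Adj m d ∧ ∃ a, ¬ G.Adj (L a) m := by
      intro i
      by_cases hi : i < q
      · obtain ⟨m, hm⟩ := hFM d hd i hi
        exact ⟨m, fun _ => hm⟩
      · exact ⟨m, fun h' => absurd h' hi⟩
    choose mo hmo using hold
    let g : I := (fun i t => if (i : ℕ) = q then G.Adj (u t) m else G.Adj (u t) (mo i),
      ⟨col m, hcol m (hmL _)⟩)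
    refine Or.inr (Set.mem_iUnion.2 ⟨g, hd, hN, fun i hi => ⟨mo i, ⟨(hmo i hi).1, (hmo i hi).2.2,
      ?_⟩, (hmo i hi).2.1⟩, m, ⟨hmE, hmL, hmR, ?_, rfl⟩, hmd⟩)
    · intro hi' t
      simp only [g, hi.ne, if_false]
    · intro hi' t
      simp only [g, if_true]
  · intro m hm
    rw [M'q] at hm
    exact hm.2.2.1
  constructor
  · intro j hj
    rcases Nat.eq_or_lt_of_le (Nat.le_of_lt_succ hj) with rfl | hj'
    · rw [D'old g j le_rfl, Function.update_self]
      exact fun d hd => hE (hFE hd.1)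
    · rw [D'old g j hj'.le, D'old g (j + 1) hj']
      exact h.D_anti j hj'
  · intro j hj a
    rcases Nat.eq_or_lt_of_le (Nat.le_of_lt_succ hj) with rfl | hj'
    · rw [D'old g j le_rfl, Function.update_self]
      exact hE (hL.2 a)
    · rw [D'old g j hj'.le, Kold j hj']
      exact h.K_mem j hj' a
  · intro j hj a b hab
    rcases Nat.eq_or_lt_of_le (Nat.le_of_lt_succ hj) with rfl | hj'
    · rw [Function.update_self]
      exact hL.1 a b hab
    · rw [Kold j hj']
      exact h.K_adj j hj' a b hab
  · intro j hj d hd a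
    rcases Nat.eq_or_lt_of_le (Nat.le_of_lt_succ hj) with rfl | hj'
    · rw [Function.update_self] at hd ⊢
      exact hF d hd.1 a
    · rw [D'old g _ hj'] at hd
      rw [Kold j hj']
      exact h.D_K j hj' d hd a
  · intro i j hij hj m hm a
    rcases Nat.eq_or_lt_of_le hj with rfl | hj'
    · rcases Nat.eq_or_lt_of_le (Nat.le_of_lt_succ hij) with rfl | hi'
      · rw [M'q] at hm
        rw [Function.update_self]
        exact hm.2.1 a
      · rw [M'lt g i hi'] at hm
        rw [Kold i hi']
        exact h.M_K i q hi' le_rfl m hm.1 a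
    · rw [M'old g i j (by omega)] at hm
      rw [Kold i (by omega)]
      exact h.M_K i j hij (by omega) m hm a
  · intro i j hij hj
    rcases Nat.eq_or_lt_of_le (Nat.le_of_lt_succ hj) with rfl | hj'
    · rw [M'lt g i hij, M'old g i _ le_rfl]
      exact fun m hm => hm.1
    · rw [M'old g i j hj'.le, M'old g i _ hj']
      exact h.M_anti i j hij hj'
  · intro i hi m hm m' hm'
    rcases Nat.eq_or_lt_of_le (Nat.le_of_lt_succ hi) with rfl | hi'
    · rw [M'q] at hm hm'
      exact fun hmm => hcol' m (hm.2.1 _) m' (hm'.2.1 _) hmm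
        (hm.2.2.2.2.trans hm'.2.2.2.2.symm)
    · rw [M'old g i _ hi'] at hm hm'
      exact h.M_stable i hi' m hm m' hm'
  · intro i hi
    rcases Nat.eq_or_lt_of_le (Nat.le_of_lt_succ hi) with rfl | hi'
    · rw [M'q, D'old g _ le_rfl]
      exact fun m hm => hE hm.1
    · rw [M'old g i _ hi', D'old g _ hi'.le]
      exact h.M_D i hi'
  · intro i j hij hj d hd
    rcases Nat.eq_or_lt_of_le hj with rfl | hj'
    · rw [Function.update_self] at hd
      rcases Nat.eq_or_lt_of_le (Nat.le_of_lt_succ hij) with rfl | hi'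
      · rw [M'q]
        exact hd.2.2.2
      · rw [M'lt g i hi']
        exact hd.2.2.1 i hi'
    · rw [D'old g j (by omega)] at hd
      rw [M'old g i j (by omega)]
      exact h.cover i j hij (by omega) d hd
  · intro i j hij hj m hm
    rcases Nat.eq_or_lt_of_le (Nat.le_of_lt_succ hj) with rfl | hj'
    · rw [M'lt g i hij] at hm
      rw [Function.update_self]
      obtain ⟨-, ⟨a, ha⟩, hg⟩ := hm
      have hex : ∃ (hi : i < j + 1) (a : Fin k), ¬ g.1 ⟨i, hi⟩ (Sum.inl a) :=
        ⟨by omega, a, fun h' => ha ((hg _ _).1 h')⟩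
      have hf' : f' g i j = hex.choose_spec.choose := by
        simp only [f', if_true, dif_pos hex]
      rw [hf']
      exact fun h' => hex.choose_spec.choose_spec ((hg _ _).2 h')
    · rw [M'old g i _ hj'] at hm
      rw [Kold j hj', show f' g i j = f i j from if_neg hj'.ne]
      exact h.M_f i j hij hj' m hm
  · intro i j hij hj a
    rcases Nat.eq_or_lt_of_le (Nat.le_of_lt_succ hj) with rfl | hj'
    · rw [M'old g i _ le_rfl, show c' i j a = e i a from if_pos rfl]
      exact (he i a hij).1
    · rw [M'old g i _ hj'.le, show c' i j a = c i j a from if_neg hj'.ne]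
      exact h.c_mem i j hij hj' a
  · intro i j hij hj a
    rcases Nat.eq_or_lt_of_le (Nat.le_of_lt_succ hj) with rfl | hj'
    · rw [Function.update_self, show c' i j a = e i a from if_pos rfl]
      exact (he i a hij).2
    · rw [Kold j hj', show c' i j a = c i j a from if_neg hj'.ne]
      exact h.c_K i j hij hj' a
  · intro i j hij hj a d hd
    rcases Nat.eq_or_lt_of_le (Nat.le_of_lt_succ hj) with rfl | hj'
    · rw [Function.update_self] at hd
      rw [show c' i j a = e i a from if_pos rfl]
      exact hd.2.1 i hij a
    · rw [D'old g _ hj'] at hd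
      rw [show c' i j a = c i j a from if_neg hj'.ne]
      exact h.c_D i j hij hj' a d hd
  · intro i j hij hj a i' hi'
    rcases Nat.eq_or_lt_of_le (Nat.le_of_lt_succ hj) with rfl | hj'
    · rw [show c' i j a = e i a from if_pos rfl]
      by_cases hg : g.1 ⟨i', by omega⟩ (Sum.inr (⟨i, hij⟩, a))
      · exact Or.inl fun m hm => (goodM g i' hi' m hm (by omega) (Sum.inr (⟨i, hij⟩, a))).1 hg
      · exact Or.inr fun m hm h' =>
          hg ((goodM g i' hi' m hm (by omega) (Sum.inr (⟨i, hij⟩, a))).2 h')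
    · rw [M'old g i' _ hj', show c' i j a = c i j a from if_neg hj'.ne]
      exact h.hom i j hij hj' a i' hi'

end AChain

namespace GSeq

variable {S : GSeq} {k : ℕ}

/-- A relation between a `k`-tuple and a vertex, in every graph of the sequence. -/
abbrev Rel₂ (S : GSeq) (k : ℕ) := ∀ n, (Fin k → S.V n) → S.V n → Prop

/-- A sequence of chains of length `q` inside `Z` with large final zone, whose cliques are related
by `R` to their covers and by `T` to the later zones. -/
structure ChainIn (S : GSeq) (R T : S.Rel₂ k) (Z : S.Zone) (q : ℕ) (K : ∀ n, ℕ → Fin k → S.V n)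
    (M : ∀ n, ℕ → ℕ → Set (S.V n)) (D : ∀ n, ℕ → Set (S.V n)) (f : ∀ _ : ℕ, ℕ → ℕ → Fin k)
    (c : ∀ n, ℕ → ℕ → Fin k → S.V n) : Prop where
  chain : ∀ᶠ n in S.U, AChain (S.G n) k q (K n) (M n) (D n) (f n) (c n)
  sub : ∀ᶠ n in S.U, D n 0 ⊆ Z n
  large : S.Large (fun n => D n q)
  hR : ∀ᶠ n in S.U, ∀ i < q, ∀ m ∈ M n i (i + 1), R n (K n i) m
  hT : ∀ᶠ n in S.U, ∀ i < q, ∀ d ∈ D n (i + 1), T n (K n i) d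

theorem ChainIn.extend {R T : S.Rel₂ k} {Z : S.Zone} {q : ℕ} {K : ∀ n, ℕ → Fin k → S.V n}
    {M : ∀ n, ℕ → ℕ → Set (S.V n)} {D : ∀ n, ℕ → Set (S.V n)} {f : ∀ _ : ℕ, ℕ → ℕ → Fin k}
    {c : ∀ n, ℕ → ℕ → Fin k → S.V n} (h : ChainIn S R T Z q K M D f c) (hk : 0 < k)
    {E F : S.Zone} (hE : ∀ᶠ n in S.U, E n ⊆ D n q) {L : ∀ n, Fin k → S.V n}
    (hL : ∀ᶠ n in S.U, CliqueIn (S.G n) k (E n) (L n)) (hFL : S.Large F)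
    (hF : ∀ᶠ n in S.U, F n ⊆ E n ∧ (∀ d ∈ F n, (∀ a, d ≠ L n a ∧ ¬ (S.G n).Adj (L n a) d) ∧
      (∃ m ∈ E n, (∀ a, (S.G n).Adj (L n a) m) ∧ (S.G n).Adj m d ∧ R n (L n) m) ∧
      (∀ i < q, ∃ m ∈ M n i q, (S.G n).Adj m d ∧ ∃ a, ¬ (S.G n).Adj (L n a) m) ∧ T n (L n) d)) :
    ∃ K M D f c, ChainIn S R T Z (q + 1) K M D f c := by
  classical
  have : Nonempty (Fin k) := ⟨⟨0, hk⟩⟩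
  let I := (Fin (q + 1) → (Fin k ⊕ Fin q × Fin k) → Prop) × Fin S.τ
  obtain ⟨x, hx⟩ := exists_seq (S := S) (α := fun n => (ℕ → ℕ → Fin k → S.V n) ×
    (I → ℕ → ℕ → Set (S.V n)) × (I → Set (S.V n)) × (I → ℕ → ℕ → Fin k)) (P := fun n x =>
      F n ⊆ (⋃ p : Fin q × Fin k, {d | (S.G n).Adj (x.1 p.1 q p.2) d}) ∪ (⋃ g, x.2.2.1 g) ∧
      ∀ g, x.2.2.1 g ⊆ F n ∧ (∀ m ∈ x.2.1 g q (q + 1), R n (L n) m) ∧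
        (∀ i j, j ≤ q → x.2.1 g i j = M n i j) ∧
        AChain (S.G n) k (q + 1) (Function.update (K n) q (L n)) (x.2.1 g)
          (Function.update (D n) (q + 1) (x.2.2.1 g)) (x.2.2.2 g) x.1) (by
    filter_upwards [h.chain, hE, hL, hF] with n h1 h2 h3 h4
    obtain ⟨c', M', D', f', h5⟩ := h1.extend hk (S.nbr n) h2 h3 (R n (L n)) h4.1
      (fun d hd => (h4.2 d hd).1) (fun d hd => (h4.2 d hd).2.1) (fun d hd => (h4.2 d hd).2.2.1)
    exact ⟨(c', M', D', f'), h5⟩)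
  have hsmall : ¬ S.Large (fun n => ⋃ p : Fin q × Fin k,
      {d | (S.G n).Adj ((x n).1 p.1 q p.2) d}) :=
    not_large_iUnion fun p => not_large_nbr _
  obtain ⟨g, hg⟩ := (hFL.diff hsmall).of_iUnion (B := fun g n => (x n).2.2.1 g) (by
    filter_upwards [hx] with n h1
    exact fun d hd => (h1.1 hd.1).resolve_left hd.2)
  refine ⟨fun n => Function.update (K n) q (L n), fun n => (x n).2.1 g,
    fun n => Function.update (D n) (q + 1) ((x n).2.2.1 g), fun n => (x n).2.2.2 g,
    fun n => (x n).1, ?_, ?_, ?_, ?_, ?_⟩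
  · filter_upwards [hx] with n h1
    exact (h1.2 g).2.2.2
  · filter_upwards [h.sub] with n h1
    rwa [Function.update_of_ne (by omega)]
  · simpa only [Function.update_self] using hg
  · filter_upwards [hx, h.hR] with n h1 h2 i hi m hm
    rcases Nat.eq_or_lt_of_le (Nat.le_of_lt_succ hi) with rfl | hi'
    · rw [Function.update_self]
      exact (h1.2 g).2.1 m hm
    · rw [(h1.2 g).2.2.1 i _ hi'] at hm
      rw [Function.update_of_ne hi'.ne]
      exact h2 i hi' m hm
  · filter_upwards [hx, h.hT, hF] with n h1 h2 h3 i hi d hd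
    rcases Nat.eq_or_lt_of_le (Nat.le_of_lt_succ hi) with rfl | hi'
    · rw [Function.update_self] at hd ⊢
      exact (h3.2 d ((h1.2 g).1 hd)).2.2.2
    · rw [Function.update_of_ne (by omega)] at hd
      rw [Function.update_of_ne hi'.ne]
      exact h2 i hi' d hd

theorem exists_maximal_chain (hk : 0 < k) (R T : S.Rel₂ k) {Z : S.Zone} (hZ : S.Large Z) :
    ∃ q K M D f c, ChainIn S R T Z q K M D f c ∧
      ¬ ∃ K M D f c, ChainIn S R T Z (q + 1) K M D f c := by
  obtain ⟨Q, hQ⟩ := AChain.exists_cycle k S.κ S.ℓ S.le_ℓ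
  by_contra! hcon
  have key : ∀ q, ∃ K M D f c, ChainIn S R T Z q K M D f c := by
    intro q
    induction q with
    | zero =>
      refine ⟨fun n _ _ => Classical.arbitrary _, fun _ _ _ => ∅, fun n _ => Z n,
        fun _ _ _ => ⟨0, hk⟩, fun n _ _ _ => Classical.arbitrary _, ?_,
        Filter.Eventually.of_forall fun _ => subset_rfl, hZ, ?_, ?_⟩
      · refine Filter.Eventually.of_forall fun n => ?_
        constructor <;> intros <;> omega
      · exact Filter.Eventually.of_forall fun n i hi => by omega
      · exact Filter.Eventually.of_forall fun n i hi => by omega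
    | succ q ih =>
      obtain ⟨K, M, D, f, c, h⟩ := ih
      exact hcon q K M D f c h
  obtain ⟨K, M, D, f, c, h⟩ := key Q
  obtain ⟨n, h1, h2⟩ := (h.chain.and h.large.nonempty).exists
  exact S.hole n (hQ _ _ _ _ _ _ _ h1 h2 (S.clique n))

end GSeq

namespace GSeq

variable {S : GSeq} {k : ℕ}

/-- A relation is monotone in its zone argument. -/
def Rel.Mono (P : S.Rel k) : Prop :=
  ∀ n (E E' : Set (S.V n)) K d, E ⊆ E' → P n E K d → P n E' K d

theorem Full.split {ι : Type*} [Finite ι] {P : S.Rel k} {O : ι → S.Rel k} {Z : S.Zone}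
    (hP : S.Full k P Z) (hZ : S.Large Z) (hmP : Rel.Mono P) (hmO : ∀ i, Rel.Mono (O i))
    (hcov : ∀ E : S.Zone, (∀ᶠ n in S.U, E n ⊆ Z n) → ∀ K : ∀ n, Fin k → S.V n,
      (∀ᶠ n in S.U, CliqueIn (S.G n) k (E n) (K n)) →
      S.Large (fun n => {d | d ∈ E n ∧ P n (E n) (K n) d}) →
      ∃ i, S.Large (fun n => {d | d ∈ E n ∧ P n (E n) (K n) d ∧ O i n (E n) (K n) d})) :
    ∃ i, ∃ E : S.Zone, (∀ᶠ n in S.U, E n ⊆ Z n) ∧ S.Large E ∧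
      S.Full k (fun n E K d => P n E K d ∧ O i n E K d) E := by
  classical
  by_contra! hcon
  have := Fintype.ofFinite ι
  have key : ∀ s : Finset ι, ∃ E : S.Zone, (∀ᶠ n in S.U, E n ⊆ Z n) ∧ S.Large E ∧
      ∀ i ∈ s, ∀ K : ∀ n, Fin k → S.V n, (∀ᶠ n in S.U, CliqueIn (S.G n) k (E n) (K n)) →
        ¬ S.Large (fun n => {d | d ∈ E n ∧ P n (E n) (K n) d ∧ O i n (E n) (K n) d}) := by
    intro s
    induction s using Finset.induction_on with
    | empty => exact ⟨Z, Filter.Eventually.of_forall fun _ => subset_rfl, hZ, by simp⟩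
    | insert i s _ ih =>
      obtain ⟨E, hEZ, hE, hs⟩ := ih
      have h1 := hcon i E hEZ hE
      unfold Full at h1
      push Not at h1
      obtain ⟨E', hE', hL', hno⟩ := h1
      refine ⟨E', (hE'.and hEZ).mono fun _ h => h.1.trans h.2, hL', fun j hj K hK => ?_⟩
      rcases Finset.mem_insert.1 hj with rfl | hj
      · exact hno K hK
      · intro hL
        refine hs j hj K ?_ (hL.mono ?_)
        · filter_upwards [hK, hE'] with n h1 h2
          exact ⟨h1.1, fun a => h2 (h1.2 a)⟩
        · filter_upwards [hE'] with n h1 d hd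
          exact ⟨h1 hd.1, hmP _ _ _ _ _ h1 hd.2.1, hmO _ _ _ _ _ _ h1 hd.2.2⟩
  obtain ⟨E, hEZ, hE, hs⟩ := key Finset.univ
  obtain ⟨K, hK, hL⟩ := hP E hEZ hE
  obtain ⟨i, hi⟩ := hcov E hEZ K hK hL
  exact hs i (Finset.mem_univ _) K hK hi

/-- `y` lies in `Z₀` and is complete to a clique that misses `Z` but that is complete to every
vertex of `M` with a neighbour in `Z`. -/
def Shield (k : ℕ) (Z₀ Z M : S.Zone) (n : ℕ) (y : S.V n) : Prop :=
  y ∈ Z₀ n ∧ ∃ K : Fin k → S.V n, CliqueIn (S.G n) k (Z₀ n) K ∧ (∀ a, (S.G n).Adj (K a) y) ∧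
    ∀ d ∈ Z n, (∀ a, d ≠ K a ∧ ¬ (S.G n).Adj (K a) d) ∧
      ∀ m ∈ M n, (S.G n).Adj m d → ∀ a, (S.G n).Adj (K a) m

/-- Induced paths of length `b` run from `x` through `M₁` to each vertex of `Mₗ`, outside the
neighbourhood of `Z` except for their ends. -/
structure Hub (S : GSeq) (k : ℕ) (Z₀ : S.Zone) (b : ℕ) (Z : S.Zone) (R : S.Rel₂ k)
    (x : ∀ n, S.V n) (M₁ Mₗ : S.Zone) : Prop where
  esc : ∀ᶠ n in S.U, ∀ K m, R n K m → ∃ m' ∈ Mₗ n, (S.G n).Adj m' m ∧ ∃ a, ¬ (S.G n).Adj (K a) m'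
  x_Z : ∀ᶠ n in S.U, ∀ z ∈ Z n, ¬ (S.G n).Adj (x n) z
  x_M : ∀ᶠ n in S.U, ∀ m ∈ M₁ n, (S.G n).Adj (x n) m
  stable : ∀ᶠ n in S.U, ∀ m ∈ M₁ n, ∀ m' ∈ M₁ n, ¬ (S.G n).Adj m m'
  M_sub : ∀ᶠ n in S.U, M₁ n ⊆ Z₀ n
  cover : ∀ᶠ n in S.U, ∀ z ∈ Z n, ∃ m ∈ M₁ n, (S.G n).Adj m z
  desc : ∀ᶠ n in S.U, ∀ y ∈ Mₗ n, ∃ p : ℕ → S.V n, IndPath (S.G n) p b ∧ p 0 = x n ∧ p b = y ∧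
    p 1 ∈ M₁ n ∧ (∀ a < b, ∀ z ∈ Z n, ¬ (S.G n).Adj (p a) z) ∧
    ∀ a, 2 ≤ a → a ≤ b → Shield k Z₀ Z M₁ n (p a)

theorem Shield.anti {Z₀ Z Z' M : S.Zone} {n : ℕ} {y : S.V n} (h : Shield k Z₀ Z M n y)
    (hZ : Z' n ⊆ Z n) : Shield k Z₀ Z' M n y := by
  obtain ⟨h1, K, h2, h3, h4⟩ := h
  exact ⟨h1, K, h2, h3, fun d hd => h4 d (hZ hd)⟩

theorem Hub.anti {Z₀ Z Z' M₁ Mₗ : S.Zone} {b : ℕ} {R : S.Rel₂ k} {x : ∀ n, S.V n}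
    (h : Hub S k Z₀ b Z R x M₁ Mₗ) (hZ : ∀ᶠ n in S.U, Z' n ⊆ Z n) :
    Hub S k Z₀ b Z' R x M₁ Mₗ := by
  refine ⟨h.esc, ?_, h.x_M, h.stable, h.M_sub, ?_, ?_⟩
  · filter_upwards [h.x_Z, hZ] with n h1 h2 z hz using h1 z (h2 hz)
  · filter_upwards [h.cover, hZ] with n h1 h2 z hz using h1 z (h2 hz)
  · filter_upwards [h.desc, hZ] with n h1 h2 y hy
    obtain ⟨p, h3, h4, h5, h6, h7, h8⟩ := h1 y hy
    exact ⟨p, h3, h4, h5, h6, fun a ha z hz => h7 a ha z (h2 hz),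
      fun a ha ha' => (h8 a ha ha').anti h2⟩

/-- A stage of the main construction: `c` counts the vertices of cliques complete to vertices of
the zone and `b` is the length of the paths of the hub. -/
structure State (S : GSeq) (k : ℕ) (Z₀ : S.Zone) (c b : ℕ) (Z : S.Zone) (P : S.Rel k)
    (dom : ∀ n, S.V n → S.V n → Prop) (R : S.Rel₂ k) (x : ∀ n, S.V n) (M₁ Mₗ : S.Zone) :
    Prop where
  sub : ∀ᶠ n in S.U, Z n ⊆ Z₀ n
  large : S.Large Z
  mono : Rel.Mono P
  base : ∀ n E K d, P n E K d → S.Base k n E K d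
  full : S.Full k P Z
  trans : ∀ n u v w, dom n u v → dom n v w → dom n u w
  dominated : ∀ᶠ n in S.U, ∀ K d, P n (Z n) K d → ∀ m ∈ Z n, (∀ a, (S.G n).Adj (K a) m) →
    (S.G n).Adj m d → ∀ a, dom n m (K a)
  inv : ∀ᶠ n in S.U, ∀ v ∈ Z n, ∃ u : Finset (S.V n), (∀ y ∈ u, ∀ z ∈ u, y ≠ z → (S.G n).Adj y z) ∧
    u.card = c ∧ (∀ y ∈ u, (S.G n).Adj y v) ∧ ∀ w, dom n v w → ∀ y ∈ u, (S.G n).Adj y w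
  link : ∀ n E K d, P n E K d → ∃ m ∈ E, (∀ a, (S.G n).Adj (K a) m) ∧ (S.G n).Adj m d ∧ R n K m
  attach : ∀ᶠ n in S.U, ∀ K d, P n (Z n) K d → ∀ m, m ∈ M₁ n ∨ m ∈ Mₗ n → (S.G n).Adj m d →
    ∀ a, (S.G n).Adj (K a) m
  hub : 1 ≤ b → Hub S k Z₀ b Z R x M₁ Mₗ

variable {Z₀ : S.Zone} {c b : ℕ} {Z : S.Zone} {P : S.Rel k} {dom : ∀ n, S.V n → S.V n → Prop}
  {R : S.Rel₂ k} {x : ∀ n, S.V n} {M₁ Mₗ : S.Zone}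

theorem State.succ_le (h : State S k Z₀ c b Z P dom R x M₁ Mₗ) : c + 1 ≤ S.κ := by
  classical
  obtain ⟨n, ⟨v, hv⟩, h2⟩ := (h.large.nonempty.and h.inv).exists
  obtain ⟨u, hu, huc, huv, -⟩ := h2 v hv
  have hvu : v ∉ u := fun h' => (S.G n).irrefl (huv v h')
  have := S.clique n (insert v u) (by
    intro y hy z hz hyz
    rcases Finset.mem_insert.1 hy with hy' | hy' <;> rcases Finset.mem_insert.1 hz with hz' | hz'
    · exact absurd (hy'.trans hz'.symm) hyz
    · exact hy' ▸ (huv z hz').symm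
    · exact hz' ▸ huv y hy'
    · exact hu y hy' z hz' hyz)
  rwa [Finset.card_insert_of_notMem hvu, huc] at this

theorem State.start (hZ : S.Large Z₀) (hF : S.Full k (S.Base k) Z₀) (x : ∀ n, S.V n) :
    State S k Z₀ 0 0 Z₀ (S.Base k) (fun _ _ _ => True) (fun _ _ _ => True) x
      (fun _ => ∅) (fun _ => ∅) := by
  refine ⟨Filter.Eventually.of_forall fun _ => subset_rfl, hZ, ?_, fun _ _ _ _ h => h, hF,
    fun _ _ _ _ _ _ => trivial, Filter.Eventually.of_forall fun _ _ _ _ _ _ _ _ _ => trivial,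
    Filter.Eventually.of_forall fun n v _ => ⟨∅, by simp, by simp, by simp, by simp⟩, ?_,
    Filter.Eventually.of_forall fun n K d _ m hm => by simp at hm, fun h => by omega⟩
  · rintro n E E' K d hE ⟨h1, m, hm, h2⟩
    exact ⟨h1, m, hE hm, h2⟩
  · rintro n E K d ⟨h1, m, hm, h2, h3⟩
    exact ⟨m, hm, h2, h3, trivial⟩

/-- Every vertex of `M` with a neighbour `d` is complete to `K`. -/
def Absorb (M : S.Zone) : S.Rel k := fun n _ K d =>
  ∀ m ∈ M n, (S.G n).Adj m d → ∀ a, (S.G n).Adj (K a) m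

/-- Some vertex of `M` is adjacent to `m` and not complete to `K`. -/
def Escape (M : S.Zone) : S.Rel₂ k := fun n K m =>
  ∃ m' ∈ M n, (S.G n).Adj m' m ∧ ∃ a, ¬ (S.G n).Adj (K a) m'

theorem State.exists_absorbing (h : State S k Z₀ c b Z P dom R x M₁ Mₗ) (hk : 0 < k) :
    ∃ q K M D f c, ChainIn S R (fun n K d => ∀ m, m ∈ M₁ n ∨ m ∈ Mₗ n → (S.G n).Adj m d →
        ∀ a, (S.G n).Adj (K a) m) Z q K M D f c ∧
      ∃ e < q, ∃ E : S.Zone, (∀ᶠ n in S.U, E n ⊆ D n q) ∧ S.Large E ∧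
        S.Full k (fun n E K d => P n E K d ∧ Absorb (fun n => M n e q) n E K d) E := by
  classical
  obtain ⟨q, K, M, D, f, c, hc, hmax⟩ := exists_maximal_chain hk R (fun n K d =>
    ∀ m, m ∈ M₁ n ∨ m ∈ Mₗ n → (S.G n).Adj m d → ∀ a, (S.G n).Adj (K a) m) h.large
  refine ⟨q, K, M, D, f, c, hc, ?_⟩
  have hDZ : ∀ᶠ n in S.U, D n q ⊆ Z n := by
    filter_upwards [hc.chain, hc.sub] with n h1 h2
    exact (h1.D_le (Nat.zero_le _) le_rfl).trans h2
  obtain ⟨⟨e, he⟩, E, hE⟩ := (h.full.mono hDZ).split hc.large h.mono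
    (O := fun e : Fin q => Absorb (fun n => M n e q)) (fun _ _ _ _ _ _ _ h => h) (by
      intro E hE L hL hLarge
      by_contra! hcon
      refine hmax (hc.extend hk hE hL (hLarge.diff (not_large_iUnion hcon)) ?_)
      filter_upwards [hE, hDZ, h.attach] with n h1 h2 h3
      refine ⟨fun d hd => hd.1.1, fun d ⟨⟨hd, hdP⟩, hd'⟩ => ⟨(h.base _ _ _ _ hdP).1,
        h.link _ _ _ _ hdP, fun i hi => ?_, h3 _ _ (h.mono _ _ _ _ _ (h1.trans h2) hdP)⟩⟩
      by_contra! hno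
      exact hd' (Set.mem_iUnion.2 ⟨⟨i, hi⟩, hd, hdP, fun m hm hmd => hno m hm hmd⟩))
  exact ⟨e, he, E, hE⟩

end GSeq

namespace GSeq

variable {S : GSeq} {k : ℕ} {Z₀ : S.Zone} {c b : ℕ} {Z : S.Zone} {P : S.Rel k}
  {dom : ∀ n, S.V n → S.V n → Prop} {R : S.Rel₂ k} {x : ∀ n, S.V n} {M₁ Mₗ : S.Zone}
  {q : ℕ} {K : ∀ n, ℕ → Fin k → S.V n} {M : ∀ n, ℕ → ℕ → Set (S.V n)} {D : ∀ n, ℕ → Set (S.V n)}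
  {f : ℕ → ℕ → ℕ → Fin k} {cc : ∀ n, ℕ → ℕ → Fin k → S.V n} {T : S.Rel₂ k} {e : ℕ} {E : S.Zone}

theorem Hub.start (hc : ChainIn S R T Z q K M D f cc) (hZ : ∀ᶠ n in S.U, Z n ⊆ Z₀ n)
    (he : e < q) (hE : ∀ᶠ n in S.U, E n ⊆ D n q) (hk : 0 < k) :
    Hub S k Z₀ 1 E (Escape fun n => M n e q) (fun n => K n e ⟨0, hk⟩) (fun n => M n e q)
      (fun n => M n e q) := by
  have hED : ∀ᶠ n in S.U, E n ⊆ D n (e + 1) := by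
    filter_upwards [hE, hc.chain] with n h1 h2 using h1.trans (h2.D_le he le_rfl)
  refine ⟨Filter.Eventually.of_forall fun n K m h => h, ?_, ?_, ?_, ?_, ?_, ?_⟩
  · filter_upwards [hED, hc.chain] with n h1 h2 z hz using (h2.D_K e he z (h1 hz) _).2
  · filter_upwards [hc.chain] with n h2 m hm using h2.M_K e q he le_rfl m hm _
  · filter_upwards [hc.chain] with n h2 m hm m' hm' using h2.M_stab he le_rfl he le_rfl hm hm'
  · filter_upwards [hc.chain, hc.sub, hZ] with n h2 h3 h4
    exact (h2.M_sub_D he le_rfl).trans ((h2.D_le (Nat.zero_le _) he.le).trans (h3.trans h4))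
  · filter_upwards [hE, hc.chain] with n h1 h2 z hz using h2.cover e q he le_rfl z (h1 hz)
  · filter_upwards [hED, hc.chain] with n h1 h2 y hy
    refine ⟨snoc (fun _ => K n e ⟨0, hk⟩) 0 y, ?_, snoc_le _ _ le_rfl, snoc_succ _ _ _, ?_, ?_, ?_⟩
    · refine (indPath_zero _).snoc fun a ha => ?_
      simp only [show a = 0 by omega, h2.M_K e q he le_rfl _ hy]
    · rw [show (1 : ℕ) = 0 + 1 from rfl, snoc_succ]
      exact hy
    · intro a ha z hz
      rw [snoc_le _ _ (by omega)]
      exact (h2.D_K e he z (h1 hz) _).2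
    · intro a ha ha'
      omega

theorem Hub.lengthen (h : Hub S k Z₀ b Z R x M₁ Mₗ)
    (hc : ChainIn S R (fun n K d => ∀ m, m ∈ M₁ n ∨ m ∈ Mₗ n → (S.G n).Adj m d →
      ∀ a, (S.G n).Adj (K a) m) Z q K M D f cc) (hb : 1 ≤ b) (hZ : ∀ᶠ n in S.U, Z n ⊆ Z₀ n)
    (he : e < q) (hE : ∀ᶠ n in S.U, E n ⊆ D n q) :
    Hub S k Z₀ (b + 1) E (Escape fun n => M n e q) x M₁ (fun n => M n e q) := by
  have hED : ∀ᶠ n in S.U, E n ⊆ D n (e + 1) := by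
    filter_upwards [hE, hc.chain] with n h1 h2 using h1.trans (h2.D_le he le_rfl)
  have hDZ : ∀ᶠ n in S.U, D n e ⊆ Z n := by
    filter_upwards [hc.chain, hc.sub] with n h1 h2
    exact (h1.D_le (Nat.zero_le _) he.le).trans h2
  have hEZ : ∀ᶠ n in S.U, E n ⊆ Z n := by
    filter_upwards [hED, hDZ, hc.chain] with n h1 h2 h3
    exact h1.trans ((h3.D_anti e he).trans h2)
  have ha := h.anti hEZ
  refine ⟨Filter.Eventually.of_forall fun n K m h => h, ha.x_Z, ha.x_M, ha.stable, ha.M_sub,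
    ha.cover, ?_⟩
  filter_upwards [h.desc, h.esc, hc.chain, hc.hR, hc.hT, hED, hEZ, hDZ, hZ]
    with n h1 h2 h3 h4 h5 h6 h7 h8 h9 y hy
  have hy' : y ∈ M n e (e + 1) := h3.M_le (Nat.lt_succ_self e) he le_rfl hy
  have hyD : y ∈ D n e := h3.M_D e he hy'
  obtain ⟨m', hm', hmy, a₀, ha₀⟩ := h2 _ _ (h4 e he y hy')
  obtain ⟨p, hp, hp0, hpb, hp1, hpZ, hpS⟩ := h1 m' hm'
  refine ⟨snoc p b y, hp.snoc fun a hab => ?_, ?_, snoc_succ _ _ _, ?_, ?_, ?_⟩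
  · rcases Nat.eq_or_lt_of_le hab with rfl | hlt
    · simp only [hpb, hmy]
    · simp only [hpZ a hlt y (h8 hyD), hlt.ne]
  · rw [snoc_le _ _ (Nat.zero_le _), hp0]
  · rw [snoc_le _ _ hb]
    exact hp1
  · intro a hab z hz
    rw [snoc_le _ _ (by omega)]
    rcases Nat.eq_or_lt_of_le (Nat.le_of_lt_succ hab) with rfl | hlt
    · rw [hpb]
      exact fun hadj => ha₀ (h5 e he z (h6 hz) m' (Or.inr hm') hadj a₀)
    · exact hpZ a hlt z (h7 hz)
  · intro a ha2 hab
    rcases Nat.eq_or_lt_of_le hab with rfl | hlt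
    · rw [snoc_succ]
      refine ⟨h9 (h8 hyD), K n e, ⟨h3.K_adj e he, fun a => h9 (h8 (h3.K_mem e he a))⟩,
        h3.M_K e _ (Nat.lt_succ_self e) he y hy', fun d hd => ⟨h3.D_K e he d (h6 hd), ?_⟩⟩
      exact fun m hm hmd => h5 e he d (h6 hd) m (Or.inl hm) hmd
    · rw [snoc_le _ _ (by omega)]
      exact (hpS a ha2 (by omega)).anti h7

/-- Some common neighbour of `K` and `d` in the zone escapes `K` through `M`. -/
def Linked (M : S.Zone) : S.Rel k := fun n E K d =>
  ∃ m ∈ E, (∀ a, (S.G n).Adj (K a) m) ∧ (S.G n).Adj m d ∧ Escape M n K m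

theorem Linked.mono (M : S.Zone) : Rel.Mono (Linked (k := k) M) := by
  rintro n E E' K d hE ⟨m, hm, h⟩
  exact ⟨m, hE hm, h⟩

theorem State.lengthen (h : State S k Z₀ c b Z P dom R x M₁ Mₗ) (hk : 0 < k)
    (hc : ChainIn S R (fun n K d => ∀ m, m ∈ M₁ n ∨ m ∈ Mₗ n → (S.G n).Adj m d →
      ∀ a, (S.G n).Adj (K a) m) Z q K M D f cc)
    (he : e < q) (hE : ∀ᶠ n in S.U, E n ⊆ D n q) (hL : S.Large E)
    (hF : S.Full k (fun n E K d => (P n E K d ∧ Absorb (fun n => M n e q) n E K d) ∧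
      Linked (fun n => M n e q) n E K d) E) :
    ∃ Z P dom R x M₁ Mₗ, State S k Z₀ c (b + 1) Z P dom R x M₁ Mₗ := by
  have hEZ : ∀ᶠ n in S.U, E n ⊆ Z n := by
    filter_upwards [hE, hc.chain, hc.sub] with n h1 h2 h3
    exact h1.trans ((h2.D_le (Nat.zero_le _) le_rfl).trans h3)
  have hub : ∃ x' M₁', (∀ n m, m ∈ M₁' n → m ∈ M₁ n ∨ m ∈ M n e q) ∧
      Hub S k Z₀ (b + 1) E (Escape fun n => M n e q) x' M₁' (fun n => M n e q) := by
    rcases Nat.eq_zero_or_pos b with rfl | hb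
    · exact ⟨_, _, fun n m hm => Or.inr hm, Hub.start hc h.sub he hE hk⟩
    · exact ⟨x, M₁, fun n m hm => Or.inl hm, (h.hub hb).lengthen hc hb h.sub he hE⟩
  obtain ⟨x', M₁', hM, hub⟩ := hub
  refine ⟨E, _, dom, Escape fun n => M n e q, x', M₁', fun n => M n e q, ?_, hL, ?_, ?_, hF,
    h.trans, ?_, ?_, ?_, ?_, fun _ => hub⟩
  · filter_upwards [hEZ, h.sub] with n h1 h2 using h1.trans h2
  · rintro n E E' K d hE ⟨⟨h1, h2⟩, h3⟩
    exact ⟨⟨h.mono _ _ _ _ _ hE h1, h2⟩, Linked.mono _ _ _ _ _ _ hE h3⟩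
  · exact fun n E K d hP => h.base _ _ _ _ hP.1.1
  · filter_upwards [hEZ, h.dominated] with n h1 h2 K d hP m hm
    exact h2 K d (h.mono _ _ _ _ _ h1 hP.1.1) m (h1 hm)
  · filter_upwards [hEZ, h.inv] with n h1 h2 v hv using h2 v (h1 hv)
  · exact fun n E K d hP => hP.2
  · filter_upwards [hEZ, h.attach] with n h1 h2 K d hP m hm hmd
    have h3 := h2 K d (h.mono _ _ _ _ _ h1 hP.1.1) m
    rcases hm with hm | hm
    · rcases hM n m hm with hm' | hm'
      · exact h3 (Or.inl hm') hmd
      · exact hP.1.2 m hm' hmd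
    · exact hP.1.2 m hm hmd

/-- Neighbours in `M` of a common neighbour of `K` and `d` are complete to `K`. -/
def Closed (S : GSeq) {k : ℕ} (E M : S.Zone) : S.Rel k := fun n _ K d =>
  ∀ m ∈ E n, (∀ a, (S.G n).Adj (K a) m) → (S.G n).Adj m d →
    ∀ m' ∈ M n, (S.G n).Adj m' m → ∀ a, (S.G n).Adj (K a) m'

theorem State.enlarge (h : State S k Z₀ c b Z P dom R x M₁ Mₗ) (hk : 0 < k)
    (hc : ChainIn S R T Z q K M D f cc)
    (he : e < q) (hE : ∀ᶠ n in S.U, E n ⊆ D n q) (hL : S.Large E)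
    (hF : S.Full k (fun n E' K d => (P n E' K d ∧ Absorb (fun n => M n e q) n E' K d) ∧
      Closed S E (fun n => M n e q) n E' K d) E) :
    ∃ Z P dom R x M₁ Mₗ, State S k Z₀ (c + 1) b Z P dom R x M₁ Mₗ := by
  classical
  have hEZ : ∀ᶠ n in S.U, E n ⊆ Z n := by
    filter_upwards [hE, hc.chain, hc.sub] with n h1 h2 h3
    exact h1.trans ((h2.D_le (Nat.zero_le _) le_rfl).trans h3)
  have hMZ : ∀ᶠ n in S.U, M n e q ⊆ Z n := by
    filter_upwards [hc.chain, hc.sub] with n h2 h3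
    exact (h2.M_sub_D he le_rfl).trans ((h2.D_le (Nat.zero_le _) he.le).trans h3)
  set P' : S.Rel k := fun n E' K d => (P n E' K d ∧ Absorb (fun n => M n e q) n E' K d) ∧
    Closed S E (fun n => M n e q) n E' K d with hP'
  have hmono : Rel.Mono P' := by
    rintro n E E' K d hE ⟨⟨h1, h2⟩, h3⟩
    exact ⟨⟨h.mono _ _ _ _ _ hE h1, h2⟩, h3⟩
  set Z' : S.Zone := fun n => {v | v ∈ E n ∧ ∃ K, (∃ a, K a = v) ∧ (∀ a, K a ∈ E n) ∧
    ∃ d ∈ E n, P' n (E n) K d} with hZ'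
  have hZE : ∀ n, Z' n ⊆ E n := fun n v hv => hv.1
  have hZL : S.Large Z' := by
    by_contra hcon
    obtain ⟨L, hL', hLL⟩ := hF _ (Filter.Eventually.of_forall fun n => Set.sdiff_subset)
      (hL.diff hcon)
    obtain ⟨n, h1, d, hd, hP⟩ := (hL'.and hLL.nonempty).exists
    exact (h1.2 ⟨0, hk⟩).2 ⟨(h1.2 ⟨0, hk⟩).1, L n, ⟨_, rfl⟩, fun a => (h1.2 a).1, d, hd.1,
      hmono _ _ _ _ _ Set.sdiff_subset hP⟩
  have hZZ : ∀ᶠ n in S.U, Z' n ⊆ Z n := hEZ.mono fun n h => (hZE n).trans h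
  refine ⟨Z', P', fun n v w => dom n v w ∧ ∀ m' ∈ M n e q, (S.G n).Adj m' v → (S.G n).Adj m' w,
    R, x, M₁, Mₗ, ?_, hZL, hmono, ?_, hF.mono (Filter.Eventually.of_forall hZE), ?_, ?_, ?_, ?_, ?_,
    fun hb => (h.hub hb).anti hZZ⟩
  · filter_upwards [hZZ, h.sub] with n h1 h2 using h1.trans h2
  · exact fun n E K d hP => h.base _ _ _ _ hP.1.1
  · rintro n u v w ⟨h1, h2⟩ ⟨h3, h4⟩
    exact ⟨h.trans n u v w h1 h3, fun m' hm' hu => h4 m' hm' (h2 m' hm' hu)⟩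
  · filter_upwards [hZZ, h.dominated] with n h1 h2 K d hP m hm hKm hmd a
    exact ⟨h2 K d (h.mono _ _ _ _ _ h1 hP.1.1) m (h1 hm) hKm hmd a, fun m' hm' hmm =>
      ((hP.2 m (hZE n hm) hKm hmd m' hm' hmm) a).symm⟩
  · filter_upwards [hE, hEZ, hMZ, hc.chain, h.dominated, h.inv] with n h1 h2 h3 h4 h5 h6 v hv
    obtain ⟨hvE, K', ⟨a, rfl⟩, hK', d, hd, hP⟩ := hv
    obtain ⟨m, hm, hmd⟩ := h4.cover e q he le_rfl d (h1 hd)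
    have hKm := hP.1.2 m hm hmd
    have hmv : dom n m (K' a) :=
      h5 K' d (h.mono _ _ _ _ _ h2 hP.1.1) m (h3 hm) hKm hmd a
    obtain ⟨u, hu, huc, hum, hud⟩ := h6 m (h3 hm)
    have hmu : m ∉ u := fun h' => (S.G n).irrefl (hum m h')
    refine ⟨insert m u, ?_, ?_, ?_, ?_⟩
    · intro y hy z hz hyz
      rcases Finset.mem_insert.1 hy with hy' | hy' <;> rcases Finset.mem_insert.1 hz with hz' | hz'
      · exact absurd (hy'.trans hz'.symm) hyz
      · exact hy' ▸ (hum z hz').symm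
      · exact hz' ▸ hum y hy'
      · exact hu y hy' z hz' hyz
    · rw [Finset.card_insert_of_notMem hmu, huc]
    · intro y hy
      rcases Finset.mem_insert.1 hy with rfl | hy'
      · exact (hKm a).symm
      · exact hud _ hmv y hy'
    · rintro w ⟨hw, hw'⟩ y hy
      rcases Finset.mem_insert.1 hy with rfl | hy'
      · exact hw' _ hm (hKm a).symm
      · exact hud _ (h.trans _ _ _ _ hmv hw) y hy'
  · exact fun n E K d hP => h.link _ _ _ _ hP.1.1
  · filter_upwards [hZZ, h.attach] with n h1 h2 K d hP
    exact h2 K d (h.mono _ _ _ _ _ h1 hP.1.1)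

theorem State.step (h : State S k Z₀ c b Z P dom R x M₁ Mₗ) (hk : 0 < k) :
    (∃ Z P dom R x M₁ Mₗ, State S k Z₀ (c + 1) b Z P dom R x M₁ Mₗ) ∨
      ∃ Z P dom R x M₁ Mₗ, State S k Z₀ c (b + 1) Z P dom R x M₁ Mₗ := by
  obtain ⟨q, K, M, D, f, cc, hc, e, he, E, hE, hL, hF⟩ := h.exists_absorbing hk
  by_cases hB : S.Full k (fun n E K d => (P n E K d ∧ Absorb (fun n => M n e q) n E K d) ∧
      Linked (fun n => M n e q) n E K d) E
  · exact Or.inr (h.lengthen hk hc he hE hL hB)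
  · left
    unfold Full at hB
    push Not at hB
    obtain ⟨E₂, hE₂, hL₂, hno⟩ := hB
    refine h.enlarge hk hc he (E := E₂) ((hE₂.and hE).mono fun _ h => h.1.trans h.2) hL₂ ?_
    intro A hA hAL
    obtain ⟨L, hL, hLL⟩ := hF A ((hA.and hE₂).mono fun _ h => h.1.trans h.2) hAL
    refine ⟨L, hL, (hLL.diff (hno L ?_)).mono ?_⟩
    · filter_upwards [hL, hA] with n h1 h2 using ⟨h1.1, fun a => h2 (h1.2 a)⟩
    · filter_upwards [hA] with n h1
      rintro d ⟨⟨hd, hP⟩, hd'⟩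
      refine ⟨hd, hP, fun m hm hKm hmd m' hm' hmm => ?_⟩
      by_contra! hno'
      exact hd' ⟨h1 hd, ⟨h.mono _ _ _ _ _ h1 hP.1, hP.2⟩, m, hm, hKm, hmd, m', hm', hmm, hno'⟩

end GSeq

namespace GSeq

variable {S : GSeq} {k : ℕ} {Z₀ : S.Zone} {c b : ℕ} {Z : S.Zone} {P : S.Rel k}
  {dom : ∀ n, S.V n → S.V n → Prop} {R : S.Rel₂ k} {x : ∀ n, S.V n} {M₁ Mₗ : S.Zone}

theorem not_large_of_shield (hext : ∀ K : ∀ n, Fin (k + 1) → S.V n,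
      (∀ᶠ n in S.U, CliqueIn (S.G n) (k + 1) (Z₀ n) (K n)) →
      ¬ S.Large (fun n => {d | d ∈ Z₀ n ∧ S.Base (k + 1) n (Z₀ n) (K n) d}))
    {F M : S.Zone} {y : ∀ n, S.V n} (hy : ∀ᶠ n in S.U, Shield k Z₀ F M n (y n))
    (hF : ∀ᶠ n in S.U, F n ⊆ Z₀ n) (hM : ∀ᶠ n in S.U, M n ⊆ Z₀ n) :
    ¬ S.Large (fun n => {d | d ∈ F n ∧ ∃ m ∈ M n, (S.G n).Adj m d ∧ (S.G n).Adj m (y n)}) := by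
  obtain ⟨K, hK⟩ := exists_seq (hy.mono fun n h => h.2)
  intro hL
  refine hext (fun n => Fin.cons (y n) (K n)) ?_ ((hL.diff (not_large_union
    (not_large_singleton y) (not_large_nbr y))).mono ?_)
  · filter_upwards [hy, hK] with n h1 h2
    refine ⟨fun a b hab => ?_, fun a => ?_⟩
    · rcases Fin.eq_zero_or_eq_succ a with rfl | ⟨a, rfl⟩ <;>
        rcases Fin.eq_zero_or_eq_succ b with rfl | ⟨b, rfl⟩
      · exact absurd rfl hab
      · exact (h2.2.1 b).symm
      · exact h2.2.1 a
      · exact h2.1.1 a b fun h => hab (h ▸ rfl)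
    · rcases Fin.eq_zero_or_eq_succ a with rfl | ⟨a, rfl⟩
      · exact h1.1
      · exact h2.1.2 a
  · filter_upwards [hK, hF, hM] with n h2 h3 h4
    rintro d ⟨⟨hd, m, hm, hmd, hmy⟩, hd'⟩
    simp only [Set.mem_union, Set.mem_singleton_iff, Set.mem_ofPred_eq, not_or] at hd'
    refine ⟨h3 hd, fun a => ?_, m, h4 hm, fun a => ?_, hmd⟩
    · rcases Fin.eq_zero_or_eq_succ a with rfl | ⟨a, rfl⟩
      · exact hd'
      · exact (h2.2.2 d hd).1 a
    · rcases Fin.eq_zero_or_eq_succ a with rfl | ⟨a, rfl⟩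
      · exact hmy.symm
      · exact (h2.2.2 d hd).2 m hm hmd a

theorem State.not_long (h : State S k Z₀ c b Z P dom R x M₁ Mₗ) (hb : b + 4 = S.ℓ)
    (hext : ∀ K : ∀ n, Fin (k + 1) → S.V n,
      (∀ᶠ n in S.U, CliqueIn (S.G n) (k + 1) (Z₀ n) (K n)) →
      ¬ S.Large (fun n => {d | d ∈ Z₀ n ∧ S.Base (k + 1) n (Z₀ n) (K n) d})) : False := by
  have hb1 : 1 ≤ b := by
    have := S.le_ℓ
    omega
  have hub := h.hub hb1
  obtain ⟨K, hK, hL⟩ := h.full Z (Filter.Eventually.of_forall fun _ => subset_rfl) h.large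
  set F : S.Zone := fun n => {d | d ∈ Z n ∧ P n (Z n) (K n) d} with hFdef
  obtain ⟨w, hw⟩ := exists_seq (S := S) (α := fun n => S.V n × (ℕ → S.V n) × S.V n)
    (P := fun n w => w.1 ∈ Z n ∧ (∀ a, (S.G n).Adj (K n a) w.1) ∧ (∃ a, K n a = w.2.2) ∧
      ¬ (S.G n).Adj (w.2.1 b) w.2.2 ∧ (S.G n).Adj (w.2.1 b) w.1 ∧ IndPath (S.G n) w.2.1 b ∧
      w.2.1 0 = x n ∧ w.2.1 1 ∈ M₁ n ∧ (∀ a < b, ∀ z ∈ Z n, ¬ (S.G n).Adj (w.2.1 a) z) ∧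
      ∀ a, 2 ≤ a → a ≤ b → Shield k Z₀ Z M₁ n (w.2.1 a)) (by
    filter_upwards [hL.nonempty, hub.esc, hub.desc] with n ⟨d, hd, hP⟩ h1 h2
    obtain ⟨m, hm, hKm, -, hR⟩ := h.link _ _ _ _ hP
    obtain ⟨m', hm', hmm, a, ha⟩ := h1 _ _ hR
    obtain ⟨p, hp, hp0, rfl, hp1, hpZ, hpS⟩ := h2 m' hm'
    exact ⟨(m, p, K n a), hm, hKm, ⟨a, rfl⟩, fun h => ha h.symm, hmm, hp, hp0, hp1, hpZ, hpS⟩)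
  have hFZ : ∀ n, F n ⊆ Z n := fun n d hd => hd.1
  have hFZ₀ : ∀ᶠ n in S.U, F n ⊆ Z₀ n := h.sub.mono fun n h => (hFZ n).trans h
  have hs1 := not_large_biUnion (Finset.Icc 2 b) (B := fun a n => {d | d ∈ F n ∧ ∃ m ∈ M₁ n,
      (S.G n).Adj m d ∧ (S.G n).Adj m ((w n).2.1 a)}) fun a ha => not_large_of_shield hext
    (y := fun n => (w n).2.1 a) (by
      filter_upwards [hw] with n h1
      obtain ⟨ha1, ha2⟩ := Finset.mem_Icc.1 ha
      exact (h1.2.2.2.2.2.2.2.2.2 a ha1 ha2).anti (hFZ n)) hFZ₀ hub.M_sub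
  have hs2 := not_large_of_shield hext (F := F) (M := M₁) (y := fun n => (w n).1) (by
    filter_upwards [hw, hK, h.sub, h.attach] with n h1 h2 h3 h4
    exact ⟨h3 h1.1, K n, ⟨h2.1, fun a => h3 (h2.2 a)⟩, h1.2.1, fun d hd =>
      ⟨(h.base _ _ _ _ hd.2).1, fun m hm hmd => h4 _ d hd.2 m (Or.inl hm) hmd⟩⟩) hFZ₀ hub.M_sub
  obtain ⟨n, ⟨d, hd, hd'⟩, hwn, hKn, hx, hst, hcov, hatt⟩ :=
    ((hL.diff (not_large_union hs1 hs2)).nonempty.and (hw.and (hK.and (hub.x_M.and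
      (hub.stable.and (hub.cover.and h.attach)))))).exists
  obtain ⟨y, hy, hyd⟩ := hcov d hd.1
  obtain ⟨h1, h2, ⟨a₀, h3⟩, h4, h5, h6, h7, h8, h9, -⟩ := hwn
  have hym : ¬ (S.G n).Adj (w n).1 y := fun hadj =>
    hd' (Or.inr ⟨hd, y, hy, hyd, hadj.symm⟩)
  have hyp : ∀ a, 2 ≤ a → a ≤ b → ¬ (S.G n).Adj ((w n).2.1 a) y := fun a ha1 ha2 hadj =>
    hd' (Or.inl (Set.mem_iUnion₂.2 ⟨a, Finset.mem_Icc.2 ⟨ha1, ha2⟩, hd, y, hy, hyd, hadj.symm⟩))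
  have hyK : (S.G n).Adj (w n).2.2 y := h3 ▸ hatt _ d hd.2 y (Or.inl hy) hyd a₀
  have hKZ : (w n).2.2 ∈ Z n := h3 ▸ hKn.2 a₀
  have hmK : (S.G n).Adj (w n).1 (w n).2.2 := h3 ▸ (h2 a₀).symm
  have hp1 : IndPath (S.G n) (snoc (w n).2.1 b (w n).1) (b + 1) := by
    refine h6.snoc fun a ha => ?_
    rcases Nat.eq_or_lt_of_le ha with rfl | hlt
    · simp only [h5]
    · simp only [h9 a hlt _ h1, hlt.ne]
  have hp2 : IndPath (S.G n) (snoc (snoc (w n).2.1 b (w n).1) (b + 1) (w n).2.2) (b + 1 + 1) := by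
    refine hp1.snoc fun a ha => ?_
    rcases Nat.eq_or_lt_of_le ha with rfl | hlt
    · rw [snoc_succ]
      simp only [hmK]
    · rw [snoc_le _ _ (by omega)]
      simp only [hlt.ne, iff_false]
      rcases Nat.eq_or_lt_of_le (Nat.le_of_lt_succ hlt) with rfl | hlt'
      · exact h4
      · exact h9 a hlt' _ hKZ
  refine S.hole n (hp2.cycle (w := y) (fun a ha => ?_) (by omega) (by omega))
  rcases Nat.eq_or_lt_of_le ha with rfl | hlt
  · rw [snoc_succ]
    simp only [hyK, or_true]
  rw [snoc_le _ _ (by omega)]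
  rcases Nat.eq_or_lt_of_le (Nat.le_of_lt_succ hlt) with rfl | hlt
  · rw [snoc_succ]
    simp only [hym, false_iff]
    omega
  rw [snoc_le _ _ (by omega)]
  rcases Nat.lt_or_ge a 2 with ha2 | ha2
  · obtain rfl | rfl : a = 0 ∨ a = 1 := by omega
    · rw [h7]
      simp only [hx y hy, true_or]
    · simp only [hst _ h8 _ hy, false_iff]
      omega
  · simp only [hyp a ha2 (by omega), false_iff]
    omega

theorem false (S : GSeq) : False := by
  obtain ⟨k, hk, Z₀, hZ₀, hF, hext⟩ := S.exists_extremal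
  have key : ∀ N c b, S.κ + S.ℓ ≤ c + b + N → b + 4 ≤ S.ℓ → ¬ ∃ Z P dom R x M₁ Mₗ,
      State S k Z₀ c b Z P dom R x M₁ Mₗ := by
    intro N
    induction N with
    | zero =>
      rintro c b h1 h2 ⟨Z, P, dom, R, x, M₁, Mₗ, h⟩
      have := h.succ_le
      omega
    | succ N ih =>
      rintro c b h1 h2 ⟨Z, P, dom, R, x, M₁, Mₗ, h⟩
      rcases Nat.eq_or_lt_of_le h2 with h3 | h3
      · exact h.not_long h3 hext
      · rcases h.step hk with h4 | h4
        · exact ih (c + 1) b (by omega) h2 h4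
        · exact ih c (b + 1) (by omega) (by omega) h4
  have := S.le_ℓ
  exact key (S.κ + S.ℓ) 0 0 (by omega) (by omega) ⟨_, _, _, _, _, _, _,
    State.start hZ₀ hF fun n => Classical.arbitrary _⟩

end GSeq

theorem colorable_induce_iff {V : Type*} {G : SimpleGraph V} {A : Set V} {k : ℕ} :
    (G.induce A).Colorable k ↔ SetCol G A k := by
  classical
  constructor
  · rintro ⟨C⟩
    refine ⟨fun v => if h : v ∈ A then C ⟨v, h⟩ else 0, fun v hv => ?_, fun u hu v hv huv => ?_⟩
    · simp only [hv, dif_pos]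
      exact (C ⟨v, hv⟩).2
    · simp only [hu, hv, dif_pos]
      exact fun h => C.valid (v := ⟨u, hu⟩) (w := ⟨v, hv⟩) huv (Fin.ext h)
  · rintro ⟨c, hc, hc'⟩
    exact ⟨Coloring.mk (fun v => (⟨c v, hc v v.2⟩ : Fin k)) fun {u v} huv h =>
      hc' u u.2 v v.2 huv (Fin.mk.inj_iff.1 h)⟩

theorem setCol_univ_iff {V : Type*} {G : SimpleGraph V} {k : ℕ} :
    SetCol G Set.univ k ↔ G.Colorable k := by
  constructor
  · rintro ⟨c, hc, hc'⟩
    exact ⟨Coloring.mk (fun v => (⟨c v, hc v (Set.mem_univ _)⟩ : Fin k)) fun {u v} huv h =>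
      hc' u (Set.mem_univ _) v (Set.mem_univ _) huv (Fin.mk.inj_iff.1 h)⟩
  · rintro ⟨C⟩
    exact ⟨fun v => C v, fun v _ => (C v).2, fun u _ v _ huv h => C.valid huv (Fin.ext h)⟩

theorem setCol_induce_iff {V : Type*} {G : SimpleGraph V} {N : Set V} {X : Set N} {k : ℕ} :
    SetCol (G.induce N) X k ↔ SetCol G (Subtype.val '' X) k := by
  constructor
  · rintro ⟨c, hc, hc'⟩
    have he : ∀ v : N, Function.extend Subtype.val c 0 (v : V) = c v := fun v =>
      Subtype.val_injective.extend_apply _ _ _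
    refine ⟨Function.extend Subtype.val c 0, ?_, ?_⟩
    · rintro _ ⟨v, hv, rfl⟩
      rw [he]
      exact hc v hv
    · rintro _ ⟨u, hu, rfl⟩ _ ⟨v, hv, rfl⟩ huv
      rw [he, he]
      exact hc' u hu v hv huv
  · rintro ⟨c, hc, hc'⟩
    exact ⟨fun v => c v, fun v hv => hc v ⟨v, hv, rfl⟩,
      fun u hu v hv huv => hc' u ⟨u, hu, rfl⟩ v ⟨v, hv, rfl⟩ huv⟩

theorem SetCol.biUnion {V ι : Type*} {G : SimpleGraph V} {A : ι → Set V} {k : ℕ} (s : Finset ι)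
    (h : ∀ i ∈ s, SetCol G (A i) k) : SetCol G (⋃ i ∈ s, A i) (s.card * k) := by
  classical
  induction s using Finset.induction_on with
  | empty => simpa using setCol_empty G
  | insert a s ha ih =>
    rw [Finset.set_biUnion_insert, Finset.card_insert_of_notMem ha]
    exact ((h a (Finset.mem_insert_self _ _)).union
      (ih fun i hi => h i (Finset.mem_insert_of_mem hi))).mono subset_rfl (by ring_nf; rfl)

/-- Colourability of induced subgraphs is controlled by colourability of balls of radius two. -/
def BallControlled {V : Type*} (φ : ℕ → ℕ) (G : SimpleGraph V) : Prop :=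
  ∀ k X, (∀ v ∈ X, SetCol G (ballIn G X v) k) → SetCol G X (φ k)

theorem mem_ballIn_of_mem_closedNbhd {V : Type*} {G : SimpleGraph V} {X : Set V} {v d : X}
    (h : d ∈ closedNbhd (G.induce X) v 2) : (d : V) ∈ ballIn G X v := by
  obtain ⟨hr, hd⟩ := h
  obtain ⟨p, hp⟩ := hr.exists_walk_length_eq_dist
  rw [← hp] at hd
  refine ⟨d.2, ?_⟩
  match p, hd with
  | .nil, _ => exact Or.inl rfl
  | .cons h .nil, _ => exact Or.inr (Or.inl h)
  | .cons (v := m) h (.cons h' .nil), _ => exact Or.inr (Or.inr ⟨m, m.2, h, h'⟩)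
  | .cons _ (.cons _ (.cons _ _)), hd => simp at hd

theorem Controlled.ballControlled {V : Type*} {φ : ℕ → ℕ} {G : SimpleGraph V}
    (h : Controlled 2 φ G) (hφ : Monotone φ) : BallControlled φ G := by
  intro k X hX
  have h1 : chiRho (G.induce X) 2 ≤ (k : ℕ∞) := by
    refine iSup_le fun v => ?_
    rw [chromaticNumber_le_iff_colorable, colorable_induce_iff, setCol_induce_iff]
    refine (hX v v.2).mono ?_ le_rfl
    rintro _ ⟨d, hd, rfl⟩
    exact mem_ballIn_of_mem_closedNbhd hd
  rw [← colorable_induce_iff, ← chromaticNumber_le_iff_colorable]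
  exact (h X).trans (Nat.cast_le.2 (hφ (ENat.toNat_le_of_le_natCast h1)))

theorem BallControlled.induce {V : Type*} {φ : ℕ → ℕ} {G : SimpleGraph V}
    (h : BallControlled φ G) (N : Set V) : BallControlled φ (G.induce N) := by
  intro k X hX
  rw [setCol_induce_iff]
  refine h k _ ?_
  rintro _ ⟨v, hv, rfl⟩
  refine (setCol_induce_iff.1 (hX v hv)).mono ?_ le_rfl
  rintro _ ⟨⟨d, hd, rfl⟩, hd'⟩
  refine ⟨d, ⟨hd, ?_⟩, rfl⟩
  rcases hd' with h1 | h1 | ⟨_, ⟨m, hm, rfl⟩, h1, h2⟩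
  · exact Or.inl (Subtype.ext h1)
  · exact Or.inr (Or.inl h1)
  · exact Or.inr (Or.inr ⟨m, hm, h1, h2⟩)

theorem exists_bound_of_no_hole (ℓ : ℕ) (hℓ : 24 ≤ ℓ) (φ : ℕ → ℕ) (κ τ : ℕ) :
    ∃ c : ℕ, ∀ (V : Type) [Finite V] (G : SimpleGraph V), BallControlled φ G → CliqueLE G κ →
      (∀ v, SetCol G {w | G.Adj v w} τ) → ¬ Nonempty (cycleGraph ℓ ↪g G) →
      SetCol G Set.univ c := by
  by_contra! hcon
  choose V fin G hctrl hclique hnbr hhole hlarge using hcon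
  refine GSeq.false ⟨V, fin, fun n => ?_, G, Filter.hyperfilter ℕ, φ, κ, τ, ℓ, hctrl, hclique,
    hnbr, fun k => ?_, hℓ, fun n => by simpa using hhole n⟩
  · by_contra hne
    rw [not_nonempty_iff] at hne
    exact hlarge n ((setCol_empty _).mono (fun v => hne.elim v) (Nat.zero_le _))
  · filter_upwards [Nat.hyperfilter_le_atTop (Filter.eventually_ge_atTop k)] with n hn h
    exact hlarge n (h.mono subset_rfl hn)

theorem setCol_univ_of_periphSet {V : Type*} {G : SimpleGraph V} {n τ d : ℕ} (f : Fin n → V)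
    (hτ : ∀ v, SetCol G {w | G.Adj v w} τ) (hd : SetCol G (periphSet G f) d) :
    SetCol G Set.univ (d + n * (1 + τ)) := by
  have h := hd.union (SetCol.biUnion Finset.univ
    fun (i : Fin n) _ => (setCol_singleton G (f i)).union (hτ (f i)))
  rw [Finset.card_univ, Fintype.card_fin] at h
  refine h.mono (fun v _ => ?_) le_rfl
  by_contra hcon
  simp only [Set.mem_union, Set.mem_iUnion, Set.mem_singleton_iff, Set.mem_ofPred_eq,
    Finset.mem_univ, exists_true_left, not_or, not_exists] at hcon
  refine hcon.1 ⟨?_, ?_⟩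
  · rintro ⟨i, rfl⟩
    exact (hcon.2 i).1 rfl
  · rintro _ ⟨i, rfl⟩ hadj
    exact (hcon.2 i).2 hadj.symm

theorem CliqueLE.induce_nbr {V : Type*} {G : SimpleGraph V} {κ : ℕ} (h : CliqueLE G (κ + 1))
    (v : V) : CliqueLE (G.induce {w | G.Adj v w}) κ := by
  classical
  intro s hs
  have hv : v ∉ s.map (Function.Embedding.subtype _) := by
    intro hv
    obtain ⟨w, -, hw⟩ := Finset.mem_map.1 hv
    have h1 : G.Adj v w := w.2
    exact h1.ne hw.symm
  have := h (insert v (s.map (Function.Embedding.subtype _))) (by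
    intro x hx y hy hxy
    rcases Finset.mem_insert.1 hx with hx' | hx' <;> rcases Finset.mem_insert.1 hy with hy' | hy'
    · exact absurd (hx'.trans hy'.symm) hxy
    · obtain ⟨w, -, rfl⟩ := Finset.mem_map.1 hy'
      rw [hx']
      exact w.2
    · obtain ⟨w, -, rfl⟩ := Finset.mem_map.1 hx'
      rw [hy']
      exact SimpleGraph.Adj.symm w.2
    · obtain ⟨w, hw, rfl⟩ := Finset.mem_map.1 hx'
      obtain ⟨z, hz, rfl⟩ := Finset.mem_map.1 hy'
      exact hs w hw z hz fun h => hxy (h ▸ rfl))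
  rw [Finset.card_insert_of_notMem hv, Finset.card_map] at this
  omega

theorem exists_bound_of_no_periphHole (ℓ : ℕ) (hℓ : 24 ≤ ℓ) (φ : ℕ → ℕ) (κ d : ℕ) :
    ∃ c : ℕ, ∀ (V : Type) [Finite V] (G : SimpleGraph V), BallControlled φ G → CliqueLE G κ →
      ¬ SetCol G Set.univ c → ∃ f : cycleGraph ℓ ↪g G, ¬ SetCol G (periphSet G f) d := by
  induction κ with
  | zero =>
    refine ⟨0, fun V _ G _ hG hc => (hc ((setCol_empty G).mono (fun v _ => ?_) le_rfl)).elim⟩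
    simpa using hG {v} (by simp)
  | succ κ ih =>
    obtain ⟨τ, hτ⟩ := ih
    obtain ⟨c, hc⟩ := exists_bound_of_no_hole ℓ hℓ φ (κ + 1) τ
    refine ⟨max c (d + ℓ * (1 + τ)), fun V _ G hctrl hG hlarge => ?_⟩
    by_cases hnbr : ∀ v, SetCol G {w | G.Adj v w} τ
    · by_contra! hcon
      refine hlarge ?_
      by_cases hhole : Nonempty (cycleGraph ℓ ↪g G)
      · obtain ⟨f⟩ := hhole
        exact (setCol_univ_of_periphSet f hnbr (hcon f)).mono subset_rfl (le_max_right _ _)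
      · exact (hc V G hctrl hG hnbr hhole).mono subset_rfl (le_max_left _ _)
    · push Not at hnbr
      obtain ⟨v, hv⟩ := hnbr
      obtain ⟨f, hf⟩ := hτ _ _ (hctrl.induce _) (hG.induce_nbr v) (by
        rwa [setCol_induce_iff, Set.image_univ, Subtype.range_coe])
      refine ⟨f.trans (Embedding.induce _), fun h => hf (setCol_induce_iff.2 (h.mono ?_ le_rfl))⟩
      rintro _ ⟨w, ⟨hw1, hw2⟩, rfl⟩
      refine ⟨?_, ?_⟩
      · rintro ⟨i, hi⟩
        exact hw1 ⟨i, Subtype.ext hi⟩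
      · rintro _ ⟨i, rfl⟩ hadj
        exact hw2 _ ⟨i, rfl⟩ hadj

theorem stmt6 (ℓ : ℕ) (hℓ : 24 ≤ ℓ) (φ : ℕ → ℕ) (hφ : Monotone φ) (κ d : ℕ) :
    ∃ c : ℕ, ∀ (V : Type) [Fintype V] (G : SimpleGraph V),
      Controlled 2 φ G → G.cliqueNum ≤ κ → (c : ℕ∞) < G.chromaticNumber →
      HasPeriphHole G d ℓ := by
  obtain ⟨c, hc⟩ := exists_bound_of_no_periphHole ℓ hℓ φ κ d
  refine ⟨c, fun V _ G hctrl hω hχ => ⟨by omega, ?_⟩⟩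
  obtain ⟨f, hf⟩ := hc V G (hctrl.ballControlled hφ)
    (fun s hs => (IsClique.card_le_cliqueNum (tc := fun x hx y hy => hs x hx y hy)).trans hω)
    (by rwa [setCol_univ_iff, ← chromaticNumber_le_iff_colorable, not_le])
  exact ⟨f, by rwa [← not_le, chromaticNumber_le_iff_colorable, colorable_induce_iff]⟩
end

section
/- Let τ, κ, m', c' ≥ 0 be integers, and let κ' be an integer with 0 ≤ κ' ≤ κ. Then there exist integers m, c ≥ 0 with the following property. Let G be a graph such that ω(G) ≤ κ, every induced subgraph H of G with ω(H) < κ has χ(H) ≤ τ, and G admits a stable multicover (N_x : x ∈ X) of length m of a set C with χ(C) > c, whose cover clique number is at most κ'. Then there is an oddity P for this multicover, and a multicover (N'_x : x ∈ X') of a set C' ⊆ C contained in (N_x : x ∈ X) and compatible with P, such that |X'| = m' and χ(C') > c'. -/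
open SimpleGraph

variable {V : Type*}

/-- Sets `A`, `B` are anticomplete: disjoint, with no edges between them. -/
def Anticomplete (G : SimpleGraph V) (A B : Set V) : Prop :=
  Disjoint A B ∧ ∀ a ∈ A, ∀ b ∈ B, ¬ G.Adj a b

/-- `B` covers `C`: they are disjoint and every vertex of `C` has a neighbour in `B`. -/
def Covers (G : SimpleGraph V) (B C : Set V) : Prop :=
  Disjoint B C ∧ ∀ v ∈ C, ∃ b ∈ B, G.Adj b v

/-- `(x, N)` is a cover of `C`. -/
def IsCover (G : SimpleGraph V) (x : V) (N C : Set V) : Prop :=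
  (∀ u ∈ N, G.Adj x u) ∧ x ∉ C ∧ (∀ u ∈ C, ¬ G.Adj x u) ∧ Covers G N C

/-- `S` is a stable set of `G`. -/
def StableSet (G : SimpleGraph V) (S : Set V) : Prop :=
  ∀ u ∈ S, ∀ v ∈ S, ¬ G.Adj u v

/-- `(N x : x ∈ X)` is a multicover of `C` in `G`. -/
def IsMulticover (G : SimpleGraph V) (X : Finset V) (N : V → Set V) (C : Set V) : Prop :=
  StableSet G ↑X ∧
  (∀ x ∈ X, IsCover G x (N x) C) ∧
  (∀ x ∈ X, ∀ y ∈ X, x ≠ y → y ∉ N x ∧ ∀ u ∈ N x, ¬ G.Adj y u)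

/-- A multicover is stable if each of the sets `N x` is stable. -/
def IsStableMulticover (G : SimpleGraph V) (X : Finset V) (N : V → Set V) (C : Set V) : Prop :=
  IsMulticover G X N C ∧ ∀ x ∈ X, StableSet G (N x)

/-- `f` describes an oddity for the multicover `(N x : x ∈ X)` of `C`:
an induced path of length 3 or 5 with ends in `X`, such that no vertex of `X` other
than the ends belongs to or has a neighbour in the path, and every vertex of the path
belongs to `X ∪ ⋃_{x ∈ X} N x ∪ C`. -/
def IsOddity (G : SimpleGraph V) (X : Finset V) (N : V → Set V) (C : Set V)
    {k : ℕ} (f : pathGraph (k + 1) ↪g G) : Prop :=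
  (k = 3 ∨ k = 5) ∧
  f 0 ∈ X ∧ f (Fin.last k) ∈ X ∧
  (∀ x ∈ X, x ≠ f 0 → x ≠ f (Fin.last k) →
    x ∉ Set.range f ∧ ∀ u ∈ Set.range f, ¬ G.Adj x u) ∧
  Set.range f ⊆ (↑X : Set V) ∪ (⋃ x ∈ X, N x) ∪ C

/-- The multicover `(N' x : x ∈ X')` of `C'` is contained in the multicover
`(N x : x ∈ X)` of `C`. -/
def MulticoverContained (G : SimpleGraph V) (X' : Finset V) (N' : V → Set V) (C' : Set V)
    (X : Finset V) (N : V → Set V) (C : Set V) : Prop :=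
  X' ⊆ X ∧ (∀ x ∈ X', N' x ⊆ N x) ∧ C' ⊆ C ∧ (∀ x ∈ X', Covers G (N' x) C') ∧
  IsMulticover G X' N' C'

section InducedColorings

variable {G : SimpleGraph V} {A B C : Set V} {m n : ℕ}

theorem SimpleGraph.Colorable.induce_subset (h : (G.induce B).Colorable n) (hAB : A ⊆ B) :
    (G.induce A).Colorable n :=
  h.of_hom (induceHomOfLE G hAB).toHom

theorem SimpleGraph.Colorable.induce_union (hA : (G.induce A).Colorable m)
    (hB : (G.induce B).Colorable n) : (G.induce (A ∪ B)).Colorable (m + n) := by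
  classical
  obtain ⟨f⟩ := hA
  obtain ⟨g⟩ := hB
  let col : (G.induce (A ∪ B)).Coloring (Fin m ⊕ Fin n) := Coloring.mk
    (fun v => if h : v.1 ∈ A then .inl (f ⟨v.1, h⟩)
      else .inr (g ⟨v.1, v.2.resolve_left h⟩)) (by
    rintro ⟨u, hu⟩ ⟨v, hv⟩ huv
    by_cases h1 : u ∈ A <;> by_cases h2 : v ∈ A <;> simp only [h1, h2, dite_true, dite_false]
    · intro h
      exact f.valid (v := ⟨u, h1⟩) (w := ⟨v, h2⟩) huv (Sum.inl.inj h)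
    · simp
    · simp
    · intro h
      exact g.valid (v := ⟨u, hu.resolve_left h1⟩) (w := ⟨v, hv.resolve_left h2⟩) huv
        (Sum.inr.inj h))
  simpa using col.colorable

theorem SimpleGraph.Colorable.induce_of_fibers {ι : Type*} [Fintype ι] (f : V → ι)
    (h : ∀ i, (G.induce {v ∈ C | f v = i}).Colorable n) :
    (G.induce C).Colorable (Fintype.card ι * n) := by
  have g := fun i => (h i).some
  let col : (G.induce C).Coloring (ι × Fin n) := Coloring.mk
    (fun v => (f v.1, g (f v.1) ⟨v.1, v.2, rfl⟩)) (by
    rintro ⟨u, hu⟩ ⟨v, hv⟩ huv h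
    simp only [Prod.mk.injEq] at h
    obtain ⟨h1, h2⟩ := h
    have key : ∀ i j (hi : f u = i) (hj : f v = j), i = j → g i ⟨u, hu, hi⟩ ≠ g j ⟨v, hv, hj⟩ := by
      rintro i _ hi hj rfl
      exact (g i).valid (v := ⟨u, hu, hi⟩) (w := ⟨v, hv, hj⟩) huv
    exact key _ _ rfl rfl h1 h2)
  simpa using col.colorable

theorem colorable_induce_singleton (v : V) : (G.induce {v}).Colorable 1 :=
  ⟨Coloring.mk (fun _ => 0) (by
    rintro ⟨a, rfl⟩ ⟨b, hb⟩ hab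
    obtain rfl : b = a := hb
    exact (G.loopless.irrefl _ hab).elim)⟩

theorem nonempty_of_not_colorable (h : ¬ (G.induce C).Colorable n) : C.Nonempty := by
  by_contra hC
  rw [Set.not_nonempty_iff_eq_empty] at hC
  subst hC
  exact h (Colorable.of_isEmpty n)

end InducedColorings

/-- `G` has no clique of size `κ + 1`, and the induced subgraphs without cliques of size `κ`
are `τ`-colorable. -/
def LocallyColorable (G : SimpleGraph V) (κ τ : ℕ) : Prop :=
  G.CliqueFree (κ + 1) ∧
  ∀ Y : Set V, (∀ K : Finset V, ↑K ⊆ Y → ¬ G.IsNClique κ K) → (G.induce Y).Colorable τ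

/-- The multicover has an oddity and a compatible multicover of length `m` contained in it which
covers a set that is not `c`-colorable. -/
def HasCompatibleOddity (G : SimpleGraph V) (X : Finset V) (N : V → Set V) (C : Set V)
    (m c : ℕ) : Prop :=
  ∃ (k : ℕ) (f : pathGraph (k + 1) ↪g G) (X' : Finset V) (N' : V → Set V) (C' : Set V),
    IsOddity G X N C f ∧
    MulticoverContained G X' N' C' X N C ∧
    Anticomplete G (Set.range f) ((↑X' : Set V) ∪ (⋃ x ∈ X', N' x) ∪ C') ∧
    X'.card = m ∧ ¬ (G.induce C').Colorable c

section LocallyColorable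

variable {G : SimpleGraph V} {κ τ : ℕ}

theorem LocallyColorable.neighbors (hG : LocallyColorable G κ τ) (v : V) :
    (G.induce {w | G.Adj v w}).Colorable τ := by
  classical
  exact hG.2 _ fun K hK hKc => hG.1 _ (hKc.insert fun b hb => hK hb)

theorem LocallyColorable.closed_neighbors (hG : LocallyColorable G κ τ) (v : V) :
    (G.induce ({w | G.Adj v w} ∪ {v})).Colorable (τ + 1) :=
  (hG.neighbors v).induce_union (colorable_induce_singleton v)

end LocallyColorable

section Multicovers

variable {G : SimpleGraph V} {X X' : Finset V} {N N' : V → Set V} {C C' : Set V} {κ τ : ℕ}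

theorem IsMulticover.exists_adj (h : IsMulticover G X N C) {x v : V} (hx : x ∈ X) (hv : v ∈ C) :
    ∃ b ∈ N x, G.Adj b v :=
  (h.2.1 x hx).2.2.2.2 v hv

theorem IsMulticover.contained (h : IsMulticover G X N C) (hX : X' ⊆ X)
    (hN : ∀ x ∈ X', N' x ⊆ N x) (hC : C' ⊆ C)
    (hcov : ∀ x ∈ X', ∀ v ∈ C', ∃ b ∈ N' x, G.Adj b v) :
    MulticoverContained G X' N' C' X N C := by
  have hcovers : ∀ x ∈ X', Covers G (N' x) C' := fun x hx =>
    ⟨((h.2.1 x (hX hx)).2.2.2.1).mono (hN x hx) hC, hcov x hx⟩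
  refine ⟨hX, hN, hC, hcovers, fun u hu v hv => h.1 u (hX hu) v (hX hv), fun x hx => ?_,
    fun x hx y hy hxy => ?_⟩
  · have hc := h.2.1 x (hX hx)
    exact ⟨fun u hu => hc.1 u (hN x hx hu), fun hxC => hc.2.1 (hC hxC),
      fun u hu => hc.2.2.1 u (hC hu), hcovers x hx⟩
  · have hd := h.2.2 x (hX hx) y (hX hy) hxy
    exact ⟨fun hy' => hd.1 (hN x hx hy'), fun u hu => hd.2 u (hN x hx hu)⟩

theorem MulticoverContained.trans {X'' : Finset V} {N'' : V → Set V} {C'' : Set V}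
    (h : MulticoverContained G X'' N'' C'' X' N' C')
    (h' : MulticoverContained G X' N' C' X N C) : MulticoverContained G X'' N'' C'' X N C :=
  ⟨h.1.trans h'.1, fun x hx => (h.2.1 x hx).trans (h'.2.1 x (h.1 hx)), h.2.2.1.trans h'.2.2.1,
    h.2.2.2.1, h.2.2.2.2⟩

theorem IsMulticover.notMem (h : IsMulticover G X N C) {x z : V} (hx : x ∈ X) (hz : z ∈ X) :
    z ∉ N x := by
  intro hzx
  by_cases hxz : x = z
  · subst hxz
    exact G.loopless.irrefl _ ((h.2.1 x hx).1 x hzx)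
  · exact (h.2.2 x hx z hz hxz).1 hzx

theorem IsOddity.of_contained (h : IsMulticover G X N C)
    (h' : MulticoverContained G X' N' C' X N C) {k : ℕ} {f : pathGraph (k + 1) ↪g G}
    (hf : IsOddity G X' N' C' f) : IsOddity G X N C f := by
  obtain ⟨hk, h0, hl, hends, hrange⟩ := hf
  refine ⟨hk, h'.1 h0, h'.1 hl, fun x hx hx0 hxl => ?_, fun u hu => ?_⟩
  · by_cases hxX : x ∈ X'
    · exact hends x hxX hx0 hxl
    refine ⟨fun hxf => ?_, fun u hu hxu => ?_⟩
    · rcases hrange hxf with (hm | hm) | hm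
      · exact hxX hm
      · simp only [Set.mem_iUnion] at hm
        obtain ⟨z, hz, hm⟩ := hm
        exact h.notMem (h'.1 hz) hx (h'.2.1 z hz hm)
      · exact (h.2.1 x hx).2.1 (h'.2.2.1 hm)
    · rcases hrange hu with (hm | hm) | hm
      · exact h.1 x hx u (h'.1 hm) hxu
      · simp only [Set.mem_iUnion] at hm
        obtain ⟨z, hz, hm⟩ := hm
        have hzx : z ≠ x := by
          rintro rfl
          exact hxX hz
        exact (h.2.2 z (h'.1 hz) x hx hzx).2 u (h'.2.1 z hz hm) hxu
      · exact (h.2.1 x hx).2.2.1 u (h'.2.2.1 hm) hxu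
  · rcases hrange hu with (hm | hm) | hm
    · exact .inl (.inl (h'.1 hm))
    · simp only [Set.mem_iUnion] at hm
      obtain ⟨z, hz, hm⟩ := hm
      exact .inl (.inr (Set.mem_biUnion (h'.1 hz) (h'.2.1 z hz hm)))
    · exact .inr (h'.2.2.1 hm)

theorem HasCompatibleOddity.of_contained {m c : ℕ} (h : IsMulticover G X N C)
    (h' : MulticoverContained G X' N' C' X N C) (ho : HasCompatibleOddity G X' N' C' m c) :
    HasCompatibleOddity G X N C m c := by
  obtain ⟨k, f, X₁, N₁, C₁, hf, hc, ha, hm, hχ⟩ := ho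
  exact ⟨k, f, X₁, N₁, C₁, hf.of_contained h h', hc.trans h', ha, hm, hχ⟩

/-- A cover of two sets of large chromatic number contains a set that covers a large part of one
of them and is anticomplete to a large part of the other one. -/
theorem LocallyColorable.exists_split [Finite V] (hG : LocallyColorable G κ τ) {d : ℕ}
    {N S T : Set V} (hS : ¬ (G.induce S).Colorable (2 * d + τ))
    (hT : ¬ (G.induce T).Colorable (2 * d + τ)) (hcov : ∀ v ∈ S, ∃ b ∈ N, G.Adj b v) :
    ∃ A ⊆ N, ∃ S' ⊆ S, ∃ T' ⊆ T,
      ¬ (G.induce S').Colorable d ∧ ¬ (G.induce T').Colorable d ∧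
      (((∀ v ∈ S', ∃ b ∈ A, G.Adj b v) ∧ ∀ b ∈ A, ∀ v ∈ T', ¬ G.Adj b v) ∨
        ((∀ v ∈ T', ∃ b ∈ A, G.Adj b v) ∧ ∀ b ∈ A, ∀ v ∈ S', ¬ G.Adj b v)) := by
  classical
  let cov : Set V → Set V → Set V := fun A S => {v ∈ S | ∃ b ∈ A, G.Adj b v}
  have hcovN : cov N S = S := Set.ext fun v => ⟨fun h => h.1, fun h => ⟨h, hcov v h⟩⟩
  obtain ⟨A, ⟨hAN, hA⟩, hmin⟩ := exists_minimal_of_wellFoundedLT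
    (fun A : Set V => A ⊆ N ∧
      (¬ (G.induce (cov A S)).Colorable d ∨ ¬ (G.induce (cov A T)).Colorable d))
    ⟨N, subset_rfl, .inl fun h => hS ((hcovN ▸ h).mono (by omega))⟩
  have hsmall : ∀ a ∈ A, (G.induce (cov (A \ {a}) S)).Colorable d ∧
      (G.induce (cov (A \ {a}) T)).Colorable d := by
    intro a ha
    by_contra hcon
    rw [not_and_or] at hcon
    exact (hmin ⟨Set.sdiff_subset.trans hAN, hcon⟩ Set.sdiff_subset ha).2 rfl
  have hAne : A.Nonempty := by
    rcases hA with h | h <;> obtain ⟨v, -, b, hb, -⟩ := nonempty_of_not_colorable h <;>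
      exact ⟨b, hb⟩
  obtain ⟨a, ha⟩ := hAne
  have hrest : ∀ R : Set V, ¬ (G.induce R).Colorable (2 * d + τ) →
      (G.induce (cov (A \ {a}) R)).Colorable d → ¬ (G.induce (R \ cov A R)).Colorable d := by
    intro R hR h1 h2
    refine hR ((((h1.induce_union (hG.neighbors a)).induce_union h2).induce_subset ?_).mono
      (by omega))
    intro v hv
    by_cases hvA : v ∈ cov A R
    · obtain ⟨-, b, hb, hbv⟩ := hvA
      by_cases hba : b = a
      · exact .inl (.inr (hba ▸ hbv))
      · exact .inl (.inl ⟨hv, b, ⟨hb, hba⟩, hbv⟩)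
    · exact .inr ⟨hv, hvA⟩
  rcases hA with h | h
  · exact ⟨A, hAN, cov A S, fun v hv => hv.1, T \ cov A T, Set.sdiff_subset, h,
      hrest T hT (hsmall a ha).2, .inl ⟨fun v hv => hv.2,
        fun b hb v hv hbv => hv.2 ⟨hv.1, b, hb, hbv⟩⟩⟩
  · exact ⟨A, hAN, S \ cov A S, Set.sdiff_subset, cov A T, fun v hv => hv.1,
      hrest S hS (hsmall a ha).1, h, .inr ⟨fun v hv => hv.2,
        fun b hb v hv hbv => hv.2 ⟨hv.1, b, hb, hbv⟩⟩⟩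

theorem exists_split_family (τ d n : ℕ) : ∃ c : ℕ, ∀ {V : Type*} [Finite V] (G : SimpleGraph V)
    (κ : ℕ) (X : Finset V) (N : V → Set V) (S T : Set V), LocallyColorable G κ τ →
    X.card = n → ¬ (G.induce S).Colorable c → ¬ (G.induce T).Colorable c →
    (∀ x ∈ X, ∀ v ∈ S, ∃ b ∈ N x, G.Adj b v) →
    ∃ (A : V → Set V) (P Q : Finset V), (∀ x, x ∈ X ↔ x ∈ P ∨ x ∈ Q) ∧ (∀ x ∈ X, A x ⊆ N x) ∧
      ∃ S' ⊆ S, ∃ T' ⊆ T, ¬ (G.induce S').Colorable d ∧ ¬ (G.induce T').Colorable d ∧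
      (∀ x ∈ P, (∀ v ∈ S', ∃ b ∈ A x, G.Adj b v) ∧ ∀ b ∈ A x, ∀ v ∈ T', ¬ G.Adj b v) ∧
      (∀ x ∈ Q, (∀ v ∈ T', ∃ b ∈ A x, G.Adj b v) ∧ ∀ b ∈ A x, ∀ v ∈ S', ¬ G.Adj b v) := by
  classical
  induction n with
  | zero =>
    refine ⟨d, fun G κ X N S T _ hX hS hT _ => ?_⟩
    rw [Finset.card_eq_zero] at hX
    subst hX
    exact ⟨N, ∅, ∅, by simp, by simp, S, subset_rfl, T, subset_rfl, hS, hT, by simp, by simp⟩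
  | succ n ih =>
    obtain ⟨c, ih⟩ := ih
    refine ⟨2 * c + τ, fun G κ X N S T hG hX hS hT hcov => ?_⟩
    obtain ⟨x₀, X₀, hx₀, rfl, hX₀⟩ := Finset.card_eq_succ.1 hX
    obtain ⟨A₀, hA₀, S₁, hS₁, T₁, hT₁, hS₁c, hT₁c, hor⟩ :=
      hG.exists_split hS hT (hcov x₀ (Finset.mem_insert_self _ _))
    obtain ⟨A, P, Q, hPQ, hA, S', hS', T', hT', hS'c, hT'c, hP, hQ⟩ :=
      ih G κ X₀ N S₁ T₁ hG hX₀ hS₁c hT₁c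
        (fun x hx v hv => hcov x (Finset.mem_insert_of_mem hx) v (hS₁ hv))
    have hne : ∀ x ∈ X₀, x ≠ x₀ := fun x hx h => hx₀ (h ▸ hx)
    have hAP : ∀ x ∈ P, Function.update A x₀ A₀ x = A x := fun x hx =>
      Function.update_of_ne (hne x ((hPQ x).2 (.inl hx))) _ _
    have hAQ : ∀ x ∈ Q, Function.update A x₀ A₀ x = A x := fun x hx =>
      Function.update_of_ne (hne x ((hPQ x).2 (.inr hx))) _ _
    have hAX : ∀ x ∈ insert x₀ X₀, Function.update A x₀ A₀ x ⊆ N x := by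
      intro x hx
      rcases Finset.mem_insert.1 hx with rfl | hx
      · simpa using hA₀
      · rw [Function.update_of_ne (hne x hx)]
        exact hA x hx
    rcases hor with ⟨h1, h2⟩ | ⟨h1, h2⟩
    · refine ⟨Function.update A x₀ A₀, insert x₀ P, Q, fun x => by
        simp only [Finset.mem_insert, hPQ, or_assoc], hAX, S', hS'.trans hS₁, T', hT'.trans hT₁,
        hS'c, hT'c, fun x hx => ?_, fun x hx => by rw [hAQ x hx]; exact hQ x hx⟩
      rcases Finset.mem_insert.1 hx with rfl | hx
      · rw [Function.update_self]
        exact ⟨fun v hv => h1 v (hS' hv), fun b hb v hv => h2 b hb v (hT' hv)⟩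
      · rw [hAP x hx]
        exact hP x hx
    · refine ⟨Function.update A x₀ A₀, P, insert x₀ Q, fun x => by
        simp only [Finset.mem_insert, hPQ, or_left_comm], hAX, S', hS'.trans hS₁, T',
        hT'.trans hT₁, hS'c, hT'c, fun x hx => by rw [hAP x hx]; exact hP x hx, fun x hx => ?_⟩
      rcases Finset.mem_insert.1 hx with rfl | hx
      · rw [Function.update_self]
        exact ⟨fun v hv => h1 v (hT' hv), fun b hb v hv => h2 b hb v (hS' hv)⟩
      · rw [hAQ x hx]
        exact hQ x hx

theorem exists_pathGraph_embedding (G : SimpleGraph V) {n : ℕ} (g : Fin n → V)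
    (hg : ∀ i j : Fin n, i < j → g i ≠ g j ∧ (G.Adj (g i) (g j) ↔ i.val + 1 = j.val)) :
    ∃ f : pathGraph n ↪g G, ⇑f = g := by
  refine ⟨⟨⟨g, fun i j hij => ?_⟩, fun {i j} => ?_⟩, rfl⟩
  · rcases lt_trichotomy i j with h | h | h
    · exact ((hg i j h).1 hij).elim
    · exact h
    · exact ((hg j i h).1 hij.symm).elim
  · rw [pathGraph_adj]
    change G.Adj (g i) (g j) ↔ _
    rcases lt_trichotomy i j with h | h | h
    · rw [(hg i j h).2]
      omega
    · subst h
      simp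
    · rw [G.adj_comm, (hg j i h).2]
      omega

theorem IsMulticover.isOddity (h : IsMulticover G X N C) {x y a b u v : V} (hx : x ∈ X)
    (hy : y ∈ X) (ha : a ∈ N x) (hb : b ∈ N y) (hu : u ∈ C) (hv : v ∈ C) {k : ℕ}
    (hk : k = 3 ∨ k = 5) (f : pathGraph (k + 1) ↪g G) (h0 : f 0 = x) (hl : f (Fin.last k) = y)
    (hf : Set.range f ⊆ {x, y, a, b, u, v}) : IsOddity G X N C f := by
  subst h0 hl
  refine ⟨hk, hx, hy, fun z hz hzx hzy => ⟨fun hzf => ?_, fun w hw hzw => ?_⟩, fun w hw => ?_⟩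
  · rcases hf hzf with rfl | rfl | rfl | rfl | rfl | rfl
    · exact hzx rfl
    · exact hzy rfl
    · exact h.notMem hx hz ha
    · exact h.notMem hy hz hb
    · exact (h.2.1 _ hz).2.1 hu
    · exact (h.2.1 _ hz).2.1 hv
  · rcases hf hw with rfl | rfl | rfl | rfl | rfl | rfl
    · exact h.1 z hz _ hx hzw
    · exact h.1 z hz _ hy hzw
    · exact (h.2.2 _ hx z hz hzx.symm).2 _ ha hzw
    · exact (h.2.2 _ hy z hz hzy.symm).2 _ hb hzw
    · exact (h.2.1 z hz).2.2.1 _ hu hzw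
    · exact (h.2.1 z hz).2.2.1 _ hv hzw
  · rcases hf hw with rfl | rfl | rfl | rfl | rfl | rfl
    · exact .inl (.inl hx)
    · exact .inl (.inl hy)
    · exact .inl (.inr (Set.mem_biUnion hx ha))
    · exact .inl (.inr (Set.mem_biUnion hy hb))
    · exact .inr hu
    · exact .inr hv

/-- Some clique of size `κ` provides two vertices whose neighbours in two of the sets of the
multicover are incomparable in the way needed for an induced path. -/
theorem LocallyColorable.exists_incomparable (hG : LocallyColorable G κ τ)
    (h : IsMulticover G X N C) (hX : κ * κ < X.card) (hC : ¬ (G.induce C).Colorable τ) :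
    ∃ x ∈ X, ∃ y ∈ X, x ≠ y ∧ ∃ u ∈ C, ∃ v ∈ C, G.Adj u v ∧
      (∃ a ∈ N x, G.Adj a u ∧ ¬ G.Adj a v) ∧ ∃ b ∈ N y, G.Adj b v ∧ ¬ G.Adj b u := by
  classical
  obtain ⟨K, hKC, hK⟩ : ∃ K : Finset V, ↑K ⊆ C ∧ G.IsNClique κ K := by
    by_contra! hcon
    exact hC (hG.2 C hcon)
  have hKne : K.Nonempty := by
    obtain ⟨w, -⟩ := nonempty_of_not_colorable hC
    rw [Finset.nonempty_iff_ne_empty]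
    rintro rfl
    have hκ : κ = 0 := by simpa using hK.card_eq.symm
    subst hκ
    exact hG.1 {w} (by simp [isNClique_iff])
  let nbr : V → V → Set V := fun x w => {a ∈ N x | G.Adj a w}
  have hpair : ∀ x ∈ X, ∃ p : V × V, p ∈ K ×ˢ K ∧ ¬ nbr x p.1 ⊆ nbr x p.2 ∧
      ¬ nbr x p.2 ⊆ nbr x p.1 := by
    intro x hx
    by_contra! hcon
    obtain ⟨u, hu, hmin⟩ := Finset.exists_minimalFor (nbr x) K hKne
    obtain ⟨a, ha, hau⟩ := h.exists_adj hx (hKC hu)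
    refine hG.1 _ (hK.insert (a := a) fun w hw => ?_)
    have hle : nbr x u ⊆ nbr x w := by
      by_contra hnle
      exact hnle (hmin hw (hcon (u, w) (Finset.mk_mem_product hu hw) hnle))
    exact (hle ⟨ha, hau⟩).2
  choose! p hpK hp1 hp2 using hpair
  obtain ⟨x, hx, y, hy, hxy, hpxy⟩ := Finset.exists_ne_map_eq_of_card_lt_of_maps_to
    (s := X) (t := K ×ˢ K) (by rwa [Finset.card_product, hK.card_eq]) (f := p) hpK
  have hmem := Finset.mem_product.1 (hpK x hx)
  obtain ⟨a, ⟨ha, hau⟩, hav⟩ := Set.not_subset.1 (hp1 x hx)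
  obtain ⟨b, ⟨hb, hbv⟩, hbu⟩ := Set.not_subset.1 (hp2 y hy)
  rw [← hpxy] at hbv hbu
  refine ⟨x, hx, y, hy, hxy, (p x).1, hKC hmem.1, (p x).2, hKC hmem.2,
    hK.isClique hmem.1 hmem.2 fun he => hav ⟨ha, he ▸ hau⟩, ⟨a, ha, hau, fun h' => hav ⟨ha, h'⟩⟩,
    b, hb, hbv, fun h' => hbu ⟨hb, h'⟩⟩

theorem LocallyColorable.exists_isOddity (hG : LocallyColorable G κ τ)
    (h : IsMulticover G X N C) {X₀ : Finset V} (hX₀ : X₀ ⊆ X) (hcard : κ * κ < X₀.card)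
    {T : Set V} (hT : T ⊆ C) (hTc : ¬ (G.induce T).Colorable τ) :
    ∃ x ∈ X₀, ∃ y ∈ X₀, ∃ a ∈ N x, ∃ b ∈ N y, ∃ u ∈ T, ∃ v ∈ T,
      ∃ (k : ℕ) (f : pathGraph (k + 1) ↪g G), IsOddity G X N C f ∧
        Set.range f ⊆ {x, y, a, b, u, v} := by
  have h₀ : IsMulticover G X₀ N T := (h.contained hX₀ (fun _ _ => subset_rfl) hT
    fun x hx v hv => h.exists_adj (hX₀ hx) (hT hv)).2.2.2.2
  have hNC : ∀ x ∈ X, ∀ a ∈ N x, ∀ w ∈ C, a ≠ w := fun x hx a ha w hw haw =>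
    Set.disjoint_left.1 (h.2.1 x hx).2.2.2.1 ha (haw ▸ hw)
  have hXC : ∀ x ∈ X, ∀ w ∈ C, x ≠ w ∧ ¬ G.Adj x w := fun x hx w hw =>
    ⟨fun e => (h.2.1 x hx).2.1 (e ▸ hw), (h.2.1 x hx).2.2.1 w hw⟩
  have hXN : ∀ x ∈ X, ∀ y ∈ X, x ≠ y → ∀ b ∈ N y, x ≠ b ∧ ¬ G.Adj x b :=
    fun x hx y hy hxy b hb => ⟨fun e => h.notMem hy hx (e ▸ hb), (h.2.2 y hy x hx hxy.symm).2 b hb⟩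
  have hadj : ∀ x ∈ X, ∀ a ∈ N x, G.Adj x a := fun x hx => (h.2.1 x hx).1
  by_cases hedge : ∃ x ∈ X₀, ∃ y ∈ X₀, x ≠ y ∧ ∃ a ∈ N x, ∃ b ∈ N y, G.Adj a b
  · obtain ⟨x, hx, y, hy, hxy, a, ha, b, hb, hab⟩ := hedge
    obtain ⟨w, hw⟩ := nonempty_of_not_colorable hTc
    have hx' := hX₀ hx
    have hy' := hX₀ hy
    have hxa := hadj x hx' a ha
    have hyb := hadj y hy' b hb
    have hxb := hXN x hx' y hy' hxy b hb
    have hya := hXN y hy' x hx' hxy.symm a ha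
    have hxy' := h.1 x hx' y hy'
    obtain ⟨f, hf⟩ := exists_pathGraph_embedding G ![x, a, b, y] (by
      intro i j hij
      fin_cases i <;> fin_cases j <;> first | (exact absurd hij (by decide)) | skip
      · exact ⟨hxa.ne, by simpa using hxa⟩
      · exact ⟨hxb.1, by simpa using hxb.2⟩
      · exact ⟨hxy, by simpa using hxy'⟩
      · exact ⟨hab.ne, by simpa using hab⟩
      · exact ⟨hya.1.symm, by simpa [G.adj_comm a y] using hya.2⟩
      · exact ⟨hyb.ne', by simpa using hyb.symm⟩)
    have hrange : Set.range f ⊆ {x, y, a, b, w, w} := by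
      rw [hf]
      rintro _ ⟨i, rfl⟩
      fin_cases i <;> simp
    exact ⟨x, hx, y, hy, a, ha, b, hb, w, hw, w, hw, 3, f,
      h.isOddity hx' hy' ha hb (hT hw) (hT hw) (.inl rfl) f (by simp [hf]) (by
        rw [hf]
        rfl) hrange, hrange⟩
  · push Not at hedge
    obtain ⟨x, hx, y, hy, hxy, u, hu, v, hv, huv, ⟨a, ha, hau, hav⟩, b, hb, hbv, hbu⟩ :=
      hG.exists_incomparable h₀ hcard hTc
    have hx' := hX₀ hx
    have hy' := hX₀ hy
    have hxa := hadj x hx' a ha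
    have hyb := hadj y hy' b hb
    have hxb := hXN x hx' y hy' hxy b hb
    have hya := hXN y hy' x hx' hxy.symm a ha
    have hxy' := h.1 x hx' y hy'
    have hxu := hXC x hx' u (hT hu)
    have hxv := hXC x hx' v (hT hv)
    have hyu := hXC y hy' u (hT hu)
    have hyv := hXC y hy' v (hT hv)
    have hab := hedge x hx y hy hxy a ha b hb
    have hab' : a ≠ b := fun e => hxb.2 (e ▸ hxa)
    obtain ⟨f, hf⟩ := exists_pathGraph_embedding G ![x, a, u, v, b, y] (by
      intro i j hij
      fin_cases i <;> fin_cases j <;> first | (exact absurd hij (by decide)) | skip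
      · exact ⟨hxa.ne, by simpa using hxa⟩
      · exact ⟨hxu.1, by simpa using hxu.2⟩
      · exact ⟨hxv.1, by simpa using hxv.2⟩
      · exact ⟨hxb.1, by simpa using hxb.2⟩
      · exact ⟨hxy, by simpa using hxy'⟩
      · exact ⟨hau.ne, by simpa using hau⟩
      · exact ⟨hNC x hx' a ha v (hT hv), by simpa using hav⟩
      · exact ⟨hab', by simpa using hab⟩
      · exact ⟨hya.1.symm, by simpa [G.adj_comm a y] using hya.2⟩
      · exact ⟨huv.ne, by simpa using huv⟩
      · exact ⟨(hNC y hy' b hb u (hT hu)).symm, by simpa [G.adj_comm u b] using hbu⟩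
      · exact ⟨hyu.1.symm, by simpa [G.adj_comm u y] using hyu.2⟩
      · exact ⟨hbv.ne', by simpa using hbv.symm⟩
      · exact ⟨hyv.1.symm, by simpa [G.adj_comm v y] using hyv.2⟩
      · exact ⟨hyb.ne', by simpa using hyb.symm⟩)
    have hrange : Set.range f ⊆ {x, y, a, b, u, v} := by
      rw [hf]
      rintro _ ⟨i, rfl⟩
      fin_cases i <;> simp
    exact ⟨x, hx, y, hy, a, ha, b, hb, u, hu, v, hv, 5, f,
      h.isOddity hx' hy' ha hb (hT hu) (hT hv) (.inr rfl) f (by simp [hf]) (by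
        rw [hf]
        rfl) hrange, hrange⟩

/-- Given a split of the multicover, an oddity found in one part is either compatible with a large
multicover in the other part, or one of its vertices is complete to the covers of a large
multicover. -/
theorem LocallyColorable.exists_oddity_or_complete (hG : LocallyColorable G κ τ)
    (h : IsMulticover G X N C) {X₀ Z : Finset V} (hX₀ : X₀ ⊆ X) (hcard : κ * κ < X₀.card)
    (hZ : Z ⊆ X) (hdisj : Disjoint X₀ Z) {A : V → Set V} (hA : ∀ z ∈ Z, A z ⊆ N z) {S T : Set V}
    (hS : S ⊆ C) (hT : T ⊆ C) {M D : ℕ} (hM : 3 * M ≤ Z.card)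
    (hSc : ¬ (G.induce S).Colorable (3 ^ Z.card * D + 4 * (τ + 1)))
    (hTc : ¬ (G.induce T).Colorable τ)
    (hAS : ∀ z ∈ Z, ∀ v ∈ S, ∃ b ∈ A z, G.Adj b v)
    (hAT : ∀ z ∈ Z, ∀ b ∈ A z, ∀ v ∈ T, ¬ G.Adj b v) :
    ∃ (Z' : Finset V) (N' : V → Set V) (S' : Set V), M ≤ Z'.card ∧
      MulticoverContained G Z' N' S' X N C ∧ ¬ (G.induce S').Colorable D ∧
      ((∃ p ∈ ⋃ x ∈ X, N x, ∀ z ∈ Z', ∀ e ∈ N' z, G.Adj p e) ∨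
        ∃ (k : ℕ) (f : pathGraph (k + 1) ↪g G), IsOddity G X N C f ∧
          Anticomplete G (Set.range f) ((↑Z' : Set V) ∪ (⋃ z ∈ Z', N' z) ∪ S')) := by
  classical
  obtain ⟨x, hx, y, hy, a, ha, b, hb, u, hu, v, hv, k, f, hf, hrange⟩ :=
    hG.exists_isOddity h hX₀ hcard hT hTc
  let B : V → Set V := fun p => {w | G.Adj p w} ∪ {p}
  let S₁ := S \ (B a ∪ B b ∪ (B u ∪ B v))
  have hS₁c : ¬ (G.induce S₁).Colorable (3 ^ Z.card * D) := fun hcon => hSc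
    (((hcon.induce_union (((hG.closed_neighbors a).induce_union (hG.closed_neighbors b)).induce_union
      ((hG.closed_neighbors u).induce_union (hG.closed_neighbors v)))).induce_subset
      fun w hw => by
        by_cases hwB : w ∈ B a ∪ B b ∪ (B u ∪ B v)
        · exact .inr hwB
        · exact .inl ⟨hw, hwB⟩).mono (by omega))
  let Q : Fin 3 → V → Prop :=
    ![fun e => ¬ G.Adj a e ∧ ¬ G.Adj b e, fun e => G.Adj a e, fun e => G.Adj b e]
  have htype : ∀ (w : V) (z : Z), ∃ i : Fin 3, w ∈ S₁ → ∃ e ∈ A z, G.Adj e w ∧ Q i e := by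
    intro w z
    by_cases hw : w ∈ S₁
    · obtain ⟨e, he, hew⟩ := hAS z z.2 w hw.1
      by_cases h1 : G.Adj a e
      · exact ⟨1, fun _ => ⟨e, he, hew, h1⟩⟩
      by_cases h2 : G.Adj b e
      · exact ⟨2, fun _ => ⟨e, he, hew, h2⟩⟩
      exact ⟨0, fun _ => ⟨e, he, hew, h1, h2⟩⟩
    · exact ⟨0, fun h' => (hw h').elim⟩
  choose t ht using htype
  obtain ⟨t₀, ht₀⟩ : ∃ t₀, ¬ (G.induce {w ∈ S₁ | t w = t₀}).Colorable D := by
    by_contra! hcon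
    exact hS₁c (by simpa using Colorable.induce_of_fibers t hcon)
  obtain ⟨i, -, hi⟩ := Finset.exists_le_card_fiber_of_mul_le_card_of_maps_to
    (s := (Finset.univ : Finset Z)) (t := (Finset.univ : Finset (Fin 3))) (f := t₀) (n := M)
    (fun _ _ => Finset.mem_univ _) Finset.univ_nonempty (by simpa using hM)
  let Z' : Finset V := (Finset.univ.filter fun z : Z => t₀ z = i).map (Function.Embedding.subtype _)
  have hZ'Z : Z' ⊆ Z := by
    intro z hz
    obtain ⟨z', -, rfl⟩ := Finset.mem_map.1 hz
    exact z'.2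
  have hcov : ∀ z ∈ Z', ∀ w ∈ {w ∈ S₁ | t w = t₀}, ∃ e ∈ {e ∈ A z | Q i e}, G.Adj e w := by
    intro z hz w hw
    obtain ⟨z', hz', rfl⟩ := Finset.mem_map.1 hz
    obtain ⟨e, he, hew, heQ⟩ := ht w z' hw.1
    rw [hw.2, (Finset.mem_filter.1 hz').2] at heQ
    exact ⟨e, ⟨he, heQ⟩, hew⟩
  refine ⟨Z', fun z => {e ∈ A z | Q i e}, {w ∈ S₁ | t w = t₀}, by simpa [Z'] using hi,
    h.contained (hZ'Z.trans hZ) (fun z hz e he => hA z (hZ'Z hz) he.1)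
      (fun w hw => hS hw.1.1) hcov, ht₀, ?_⟩
  have hx' := hX₀ hx
  have hy' := hX₀ hy
  have hcases : i = 0 ∨ i = 1 ∨ i = 2 := by
    fin_cases i <;> simp
  rcases hcases with rfl | rfl | rfl
  · refine .inr ⟨k, f, hf, ?_⟩
    have hxZ : ∀ q ∈ X₀, ∀ z ∈ Z, q ≠ z := fun q hq z hz hqz =>
      Finset.disjoint_left.1 hdisj hq (hqz ▸ hz)
    have key : ∀ p ∈ ({x, y, a, b, u, v} : Set V),
        ∀ q ∈ (↑Z' : Set V) ∪ (⋃ z ∈ Z', {e ∈ A z | Q 0 e}) ∪ {w ∈ S₁ | t w = t₀},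
        p ≠ q ∧ ¬ G.Adj p q := by
      have hend : ∀ p ∈ X₀,
          ∀ q ∈ (↑Z' : Set V) ∪ (⋃ z ∈ Z', {e ∈ A z | Q 0 e}) ∪ {w ∈ S₁ | t w = t₀},
          p ≠ q ∧ ¬ G.Adj p q := by
        rintro p hp q ((hq | hq) | hq)
        · exact ⟨hxZ p hp q (hZ'Z hq), h.1 p (hX₀ hp) q (hZ (hZ'Z hq))⟩
        · simp only [Set.mem_iUnion] at hq
          obtain ⟨z, hz, hq⟩ := hq
          have hqN := hA z (hZ'Z hz) hq.1
          have hd := h.2.2 z (hZ (hZ'Z hz)) p (hX₀ hp) (hxZ p hp z (hZ'Z hz)).symm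
          exact ⟨fun e => hd.1 (e ▸ hqN), hd.2 q hqN⟩
        · have hc := h.2.1 p (hX₀ hp)
          exact ⟨fun e => hc.2.1 (e ▸ hS hq.1.1), hc.2.2.1 q (hS hq.1.1)⟩
      have hnbr : ∀ p ∈ X₀, ∀ c ∈ N p, (c = a ∨ c = b) →
          ∀ q ∈ (↑Z' : Set V) ∪ (⋃ z ∈ Z', {e ∈ A z | Q 0 e}) ∪ {w ∈ S₁ | t w = t₀},
          c ≠ q ∧ ¬ G.Adj c q := by
        rintro p hp c hc hcab q ((hq | hq) | hq)
        · have hd := h.2.2 p (hX₀ hp) q (hZ (hZ'Z hq)) (hxZ p hp q (hZ'Z hq))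
          exact ⟨fun e => hd.1 (e ▸ hc), fun hcq => hd.2 c hc hcq.symm⟩
        · simp only [Set.mem_iUnion] at hq
          obtain ⟨z, hz, hqA, hqa, hqb⟩ := hq
          have hqN := hA z (hZ'Z hz) hqA
          have hzX := hZ (hZ'Z hz)
          refine ⟨?_, by rcases hcab with rfl | rfl <;> assumption⟩
          rintro rfl
          exact (h.2.2 p (hX₀ hp) z hzX (hxZ p hp z (hZ'Z hz))).2 c hc
            ((h.2.1 z hzX).1 c hqN)
        · have hqB := hq.1.2
          simp only [Set.mem_union, not_or, B, Set.mem_ofPred_eq, Set.mem_singleton_iff] at hqB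
          rcases hcab with rfl | rfl
          · exact ⟨Ne.symm hqB.1.1.2, hqB.1.1.1⟩
          · exact ⟨Ne.symm hqB.1.2.2, hqB.1.2.1⟩
      have hmid : ∀ p ∈ T, (p = u ∨ p = v) →
          ∀ q ∈ (↑Z' : Set V) ∪ (⋃ z ∈ Z', {e ∈ A z | Q 0 e}) ∪ {w ∈ S₁ | t w = t₀},
          p ≠ q ∧ ¬ G.Adj p q := by
        rintro p hp hpuv q ((hq | hq) | hq)
        · have hc := h.2.1 q (hZ (hZ'Z hq))
          exact ⟨fun e => hc.2.1 (e ▸ hT hp), fun hpq => hc.2.2.1 p (hT hp) hpq.symm⟩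
        · simp only [Set.mem_iUnion] at hq
          obtain ⟨z, hz, hqA, -⟩ := hq
          refine ⟨?_, fun hpq => hAT z (hZ'Z hz) q hqA p hp hpq.symm⟩
          rintro rfl
          exact Set.disjoint_left.1 (h.2.1 z (hZ (hZ'Z hz))).2.2.2.1 (hA z (hZ'Z hz) hqA) (hT hp)
        · have hqB := hq.1.2
          simp only [Set.mem_union, not_or, B, Set.mem_ofPred_eq, Set.mem_singleton_iff] at hqB
          rcases hpuv with rfl | rfl
          · exact ⟨Ne.symm hqB.2.1.2, hqB.2.1.1⟩
          · exact ⟨Ne.symm hqB.2.2.2, hqB.2.2.1⟩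
      rintro p (rfl | rfl | rfl | rfl | rfl | rfl)
      · exact hend _ hx
      · exact hend _ hy
      · exact hnbr x hx _ ha (.inl rfl)
      · exact hnbr y hy _ hb (.inr rfl)
      · exact hmid _ hu (.inl rfl)
      · exact hmid _ hv (.inr rfl)
    exact ⟨Set.disjoint_left.2 fun p hp hq => (key p (hrange hp) p hq).1 rfl,
      fun p hp q hq => (key p (hrange hp) q hq).2⟩
  · exact .inl ⟨a, Set.mem_biUnion hx' ha, fun z _ e he => he.2⟩
  · exact .inl ⟨b, Set.mem_biUnion hy' hb, fun z _ e he => he.2⟩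

theorem exists_hasCompatibleOddity (τ κ m c k : ℕ) : ∃ m₁ c₁ : ℕ, ∀ {V : Type*} [Finite V]
    (G : SimpleGraph V) (X : Finset V) (N : V → Set V) (C : Set V), LocallyColorable G κ τ →
    IsMulticover G X N C → m₁ ≤ X.card → ¬ (G.induce C).Colorable c₁ →
    (∀ K : Finset V, ↑K ⊆ (⋃ x ∈ X, N x) → G.IsClique K → K.card ≤ k) →
    HasCompatibleOddity G X N C m c := by
  classical
  induction k with
  | zero =>
    refine ⟨1, 0, fun G X N C _ h hX hC hK => ?_⟩
    obtain ⟨w, hw⟩ := nonempty_of_not_colorable hC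
    obtain ⟨x, hx⟩ := Finset.card_pos.1 hX
    obtain ⟨b, hb, -⟩ := h.exists_adj hx hw
    have := hK {b} (by simpa using ⟨x, hx, hb⟩) (by simp)
    simp at this
  | succ k ih =>
    obtain ⟨m₁, c₁, ih⟩ := ih
    obtain ⟨c₂, hsplit⟩ := exists_split_family τ
      (3 ^ (3 * max m m₁) * max c c₁ + 4 * (τ + 1)) (6 * max m m₁)
    set M := max m m₁
    set D := max c c₁
    refine ⟨κ * κ + 1 + 6 * M, c₂, fun {V} _ G X N C hG h hX hC hK => ?_⟩
    obtain ⟨X₀, hX₀, hX₀c⟩ := Finset.exists_subset_card_eq (s := X) (n := κ * κ + 1) (by omega)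
    obtain ⟨R, hR, hRc⟩ := Finset.exists_subset_card_eq (s := X \ X₀) (n := 6 * M) (by
      rw [Finset.card_sdiff_of_subset hX₀]
      omega)
    have hRX : R ⊆ X := hR.trans Finset.sdiff_subset
    obtain ⟨A, P, Q, hPQ, hA, S, hS, T, hT, hSc, hTc, hP, hQ⟩ := hsplit G κ R N C C hG hRc hC hC
      fun x hx v hv => h.exists_adj (hRX hx) hv
    have main : ∀ (Z : Finset V) (S T : Set V), Z ⊆ R → 3 * M ≤ Z.card → S ⊆ C → T ⊆ C →
        ¬ (G.induce S).Colorable (3 ^ (3 * M) * D + 4 * (τ + 1)) →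
        ¬ (G.induce T).Colorable (3 ^ (3 * M) * D + 4 * (τ + 1)) →
        (∀ x ∈ Z, (∀ v ∈ S, ∃ b ∈ A x, G.Adj b v) ∧ ∀ b ∈ A x, ∀ v ∈ T, ¬ G.Adj b v) →
        HasCompatibleOddity G X N C m c := by
      intro Z S T hZ hZc hS hT hSc hTc hZA
      obtain ⟨Z₁, hZ₁, hZ₁c⟩ := Finset.exists_subset_card_eq hZc
      have hdisj : Disjoint X₀ Z₁ := Finset.disjoint_left.2 fun z hz hz' =>
        (Finset.mem_sdiff.1 (hR (hZ (hZ₁ hz')))).2 hz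
      obtain ⟨Z', N', S', hZ'c, hcont, hS'c, hor⟩ := hG.exists_oddity_or_complete h hX₀ (by omega)
        ((hZ₁.trans hZ).trans hRX) hdisj (fun z hz => hA z (hZ (hZ₁ hz))) hS hT hZ₁c.ge
        (by rwa [hZ₁c]) (fun h' => hTc (h'.mono (by omega))) (fun z hz => (hZA z (hZ₁ hz)).1)
        (fun z hz => (hZA z (hZ₁ hz)).2)
      rcases hor with ⟨p, hp, hpN⟩ | ⟨l, f, hf, hanti⟩
      · refine HasCompatibleOddity.of_contained h hcont (ih G Z' N' S' hG hcont.2.2.2.2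
          ((le_max_right m m₁).trans hZ'c) (fun h' => hS'c (h'.mono (le_max_right c c₁)))
          fun K hKN hKc => ?_)
        have hpK : ∀ e ∈ K, G.Adj p e := by
          intro e he
          have heN := hKN he
          simp only [Set.mem_iUnion] at heN
          obtain ⟨z, hz, heN⟩ := heN
          exact hpN z hz e heN
        have hcard := hK (insert p K) (by
          rw [Finset.coe_insert, Set.insert_subset_iff]
          exact ⟨hp, hKN.trans (Set.iUnion₂_subset fun z hz =>
            (hcont.2.1 z hz).trans (Set.subset_biUnion_of_mem (u := N) (hcont.1 hz)))⟩) (by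
          rw [Finset.coe_insert]
          exact hKc.insert fun e he _ => hpK e he)
        rw [Finset.card_insert_of_notMem fun h' => G.loopless.irrefl _ (hpK p h')] at hcard
        omega
      · obtain ⟨X', hX', hX'c⟩ := Finset.exists_subset_card_eq ((le_max_left m m₁).trans hZ'c)
        have hcont' : MulticoverContained G X' N' S' Z' N' S' :=
          hcont.2.2.2.2.contained hX' (fun _ _ => subset_rfl) subset_rfl
            fun x hx v hv => hcont.2.2.2.2.exists_adj (hX' hx) hv
        have hsub : (↑X' : Set V) ∪ (⋃ z ∈ X', N' z) ∪ S' ⊆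
            (↑Z' : Set V) ∪ (⋃ z ∈ Z', N' z) ∪ S' :=
          Set.union_subset_union_left _ (Set.union_subset_union hX'
            (Set.biUnion_subset_biUnion_left hX'))
        exact ⟨l, f, X', N', S', hf, hcont'.trans hcont, ⟨hanti.1.mono_right hsub,
          fun p hp q hq => hanti.2 p hp q (hsub hq)⟩, hX'c,
          fun h' => hS'c (h'.mono (le_max_left c c₁))⟩
    have hcard : R.card ≤ P.card + Q.card :=
      (Finset.card_le_card fun x hx => Finset.mem_union.2 ((hPQ x).1 hx)).trans
        (Finset.card_union_le P Q)
    rcases le_total (3 * M) P.card with hPc | hPc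
    · exact main P S T (fun x hx => (hPQ x).2 (.inl hx)) hPc hS hT hSc hTc hP
    · exact main Q T S (fun x hx => (hPQ x).2 (.inr hx)) (by omega) hT hS hTc hSc hQ

end Multicovers

theorem locallyColorable_of_cliqueNum [Finite V] {G : SimpleGraph V} {κ τ : ℕ}
    (hκ : G.cliqueNum ≤ κ)
    (hτ : ∀ Y : Set V, (G.induce Y).cliqueNum < κ →
      (G.induce Y).chromaticNumber ≤ (τ : ℕ∞)) : LocallyColorable G κ τ := by
  refine ⟨fun K hK => ?_, fun Y hY => chromaticNumber_le_iff_colorable.1 (hτ Y ?_)⟩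
  · have := hK.isClique.card_le_cliqueNum
    have := hK.card_eq
    omega
  · by_contra! hcon
    obtain ⟨K, hK⟩ := (G.induce Y).exists_isNClique_cliqueNum
    obtain ⟨L, hLK, hL⟩ := Finset.exists_subset_card_eq (hcon.trans_eq hK.card_eq.symm)
    refine hY (L.map (Function.Embedding.subtype _)) (by simp) ?_
    refine ⟨?_, by simpa using hL⟩
    intro u hu v hv huv
    simp only [Finset.coe_map, Set.mem_image, Finset.mem_coe] at hu hv
    obtain ⟨u', hu', rfl⟩ := hu
    obtain ⟨v', hv', rfl⟩ := hv
    exact hK.isClique (hLK hu') (hLK hv') fun e => huv (by rw [e])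

theorem SimpleGraph.IsClique.card_le_cliqueNum_induce [Finite V] {G : SimpleGraph V} {Y : Set V}
    {K : Finset V} (hK : G.IsClique K) (hKY : ↑K ⊆ Y) : K.card ≤ (G.induce Y).cliqueNum := by
  classical
  have hL : (G.induce Y).IsClique (K.subtype (· ∈ Y) : Set Y) := by
    intro u hu v hv huv
    exact hK (by simpa using hu) (by simpa using hv) fun e => huv (Subtype.ext e)
  have := hL.card_le_cliqueNum
  rwa [Finset.card_subtype, Finset.filter_true_of_mem fun v hv => hKY hv] at this

theorem stmt7 (τ κ m' c' κ' : ℕ) (hκ' : κ' ≤ κ) :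
    ∃ m c : ℕ, ∀ (V : Type) [Fintype V] (G : SimpleGraph V)
      (X : Finset V) (N : V → Set V) (C : Set V),
      G.cliqueNum ≤ κ →
      (∀ Y : Set V, (G.induce Y).cliqueNum < κ →
        (G.induce Y).chromaticNumber ≤ (τ : ℕ∞)) →
      IsStableMulticover G X N C → X.card = m →
      (c : ℕ∞) < (G.induce C).chromaticNumber →
      (G.induce (⋃ x ∈ X, N x)).cliqueNum ≤ κ' →
      ∃ (k : ℕ) (f : pathGraph (k + 1) ↪g G) (X' : Finset V) (N' : V → Set V) (C' : Set V),
        IsOddity G X N C f ∧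
        MulticoverContained G X' N' C' X N C ∧
        Anticomplete G (Set.range f) ((↑X' : Set V) ∪ (⋃ x ∈ X', N' x) ∪ C') ∧
        X'.card = m' ∧ (c' : ℕ∞) < (G.induce C').chromaticNumber := by
  obtain ⟨m, c, hmc⟩ := exists_hasCompatibleOddity τ κ m' c' κ'
  refine ⟨m, c, fun V _ G X N C hκ hτ hN hX hC hK => ?_⟩
  obtain ⟨k, f, X', N', C', hf, hcont, hanti, hcard, hχ⟩ := hmc G X N C
    (locallyColorable_of_cliqueNum hκ hτ) hN.1 hX.ge
    (fun h => hC.not_ge (chromaticNumber_le_iff_colorable.2 h))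
    (fun K hKN hKc => (hKc.card_le_cliqueNum_induce hKN).trans hK)
  exact ⟨k, f, X', N', C', hf, hcont, hanti, hcard,
    lt_of_not_ge fun h => hχ (chromaticNumber_le_iff_colorable.1 h)⟩
end
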